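/- arXiv:2408.08523 — 2 statements merged into one kernel-verified Lean document; each statement's English description precedes it below -/
import Mathlib

section
/- Let m, n, r, s be nonnegative integers with m = 3r + s, 1 ≤ s ≤ 3, and n ≥ 120m. If F1, …, Fm are 3-partite 3-graphs on the same vertex classes V1, V2, V3, each class of size n, and δ1(Fi) > δ(n,r,s) for every i ∈ [m], then {F1, …, Fm} admits a rainbow matching of size m. -/
open Finset

/-- The number of edges of `E` containing the vertex `v` (the vertex degree). -/
def hdeg {α : Type} [DecidableEq α] (E : Finset (Finset α)) (v : α) : ℕ :=
  (E.filter (fun e => v ∈ e)).card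

/-- `E` is the edge set of a 3-partite 3-graph with vertex classes `V1, V2, V3`:
every edge has exactly one vertex in each class. -/
def IsPartite3 {α : Type} [DecidableEq α] (V1 V2 V3 : Finset α)
    (E : Finset (Finset α)) : Prop :=
  ∀ e ∈ E, e ⊆ V1 ∪ V2 ∪ V3 ∧
    (e ∩ V1).card = 1 ∧ (e ∩ V2).card = 1 ∧ (e ∩ V3).card = 1

/-- The degree bound `δ(n,r,s)` from the paper. -/
def deltaLM (n r s : ℕ) : ℕ :=
  if s = 1 then n ^ 2 - (n - r) ^ 2
  else if s = 2 then n ^ 2 - (n - r + 1) * (n - r - 1)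
  else n ^ 2 - (n - r) * (n - r - 1)


lemma hall_def {m : ℕ} {α : Type} [DecidableEq α] (a : α) (H : Fin m → Finset α) :
    ∃ (U : Finset (Fin m)) (τ : Fin m → α) (B : Finset α),
      (∀ i, i ∉ U → ∀ j, j ∉ U → τ i = τ j → i = j) ∧ (∀ i, i ∉ U → τ i ∈ H i) ∧
      (∀ i ∈ U, H i ⊆ B) ∧ B ⊆ (univ \ U).image τ := by
  classical
  obtain ⟨S, -, hS⟩ := Finset.exists_max_image (univ : Finset (Finset (Fin m)))
    (fun S => (S.card : ℤ) - (S.biUnion H).card) ⟨∅, mem_univ _⟩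
  have h0 := hS ∅ (mem_univ _)
  simp only [card_empty, biUnion_empty] at h0
  obtain ⟨d, hd⟩ : ∃ d : ℕ, S.card = (S.biUnion H).card + d :=
    Nat.exists_eq_add_of_le (by push_cast at h0; omega)
  have hall : ∀ P : Finset (Fin m), P.card ≤
      (P.biUnion (fun i => (H i).disjSum (univ : Finset (Fin d)))).card := by
    intro P
    rcases P.eq_empty_or_nonempty with rfl | ⟨p, hp⟩
    · simp
    have h1 := hS P (mem_univ _)
    have h2 : (P.biUnion H).disjSum (univ : Finset (Fin d)) ⊆
        P.biUnion (fun i => (H i).disjSum (univ : Finset (Fin d))) := by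
      intro x hx
      rw [mem_biUnion]
      rcases x with x | x
      · simp only [inl_mem_disjSum, mem_biUnion] at hx ⊢
        exact hx
      · exact ⟨p, hp, by simp⟩
    have h3 := card_le_card h2
    rw [card_disjSum, card_univ, Fintype.card_fin] at h3
    omega
  obtain ⟨g, ginj, hg⟩ := (Finset.all_card_le_biUnion_card_iff_exists_injective _).1 hall
  set U : Finset (Fin m) := univ.filter (fun i => ∃ x, g i = Sum.inr x) with hU
  set τ : Fin m → α := fun i => Sum.elim id (fun _ => a) (g i) with hτ
  have hgτ : ∀ i, i ∉ U → g i = Sum.inl (τ i) := by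
    intro i hi
    rcases h : g i with x | x
    · simp [hτ, h]
    · exact absurd (by simp [hU, h]) hi
  have hτH : ∀ i, i ∉ U → τ i ∈ H i := by
    intro i hi
    have := hg i
    rw [hgτ i hi] at this
    simpa using this
  have hinj : ∀ i, i ∉ U → ∀ j, j ∉ U → τ i = τ j → i = j := by
    intro i hi j hj h
    apply ginj
    rw [hgτ i hi, hgτ j hj, h]
  have hUd : U.card ≤ d := by
    have h1 : U.image g ⊆ (univ : Finset (Fin d)).image Sum.inr := by
      intro x hx
      obtain ⟨i, hi, rfl⟩ := mem_image.1 hx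
      obtain ⟨y, hy⟩ := (mem_filter.1 hi).2
      rw [hy]; simp
    have h2 := card_le_card h1
    rw [card_image_of_injective _ ginj] at h2
    have h3 := card_image_le (s := (univ : Finset (Fin d))) (f := (Sum.inr : Fin d → α ⊕ Fin d))
    simp only [card_univ, Fintype.card_fin] at h3 h2
    omega
  have hsub : (S \ U).image τ ⊆ S.biUnion H := by
    intro x hx
    obtain ⟨i, hi, rfl⟩ := mem_image.1 hx
    rw [mem_sdiff] at hi
    exact mem_biUnion.2 ⟨i, hi.1, hτH i hi.2⟩
  have hci : ((S \ U).image τ).card = (S \ U).card := by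
    apply card_image_of_injOn
    intro i hi j hj h
    simp only [coe_sdiff, Set.mem_sdiff, mem_coe] at hi hj
    exact hinj i hi.2 j hj.2 h
  have hc := card_le_card hsub
  have hSU := card_sdiff_add_card_inter S U
  have hUS : (S ∩ U).card ≤ U.card := card_le_card inter_subset_right
  have hUS' : S ∩ U = U := eq_of_subset_of_card_le inter_subset_right (by omega)
  have hBe : (S \ U).image τ = S.biUnion H := eq_of_subset_of_card_le hsub (by omega)
  refine ⟨U, τ, S.biUnion H, hinj, hτH, ?_, ?_⟩
  · intro i hi
    rw [← hUS'] at hi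
    exact subset_biUnion_of_mem H (mem_inter.1 hi).1
  · rw [← hBe]
    exact image_subset_image (sdiff_subset_sdiff (subset_univ _) (Subset.refl _))

section lems
variable {α : Type} [DecidableEq α] {V1 V2 V3 : Finset α} {E : Finset (Finset α)}

lemma p213 (h : IsPartite3 V1 V2 V3 E) : IsPartite3 V2 V1 V3 E := by
  intro e he
  obtain ⟨a, b, c, d⟩ := h e he
  exact ⟨by rwa [union_comm V2 V1], c, b, d⟩

lemma p312 (h : IsPartite3 V1 V2 V3 E) : IsPartite3 V3 V1 V2 E := by
  intro e he
  obtain ⟨a, b, c, d⟩ := h e he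
  exact ⟨by rwa [union_assoc, union_comm V3 (V1 ∪ V2)], d, b, c⟩

lemma part_rep (h : IsPartite3 V1 V2 V3 E) {e : Finset α} (he : e ∈ E) :
    ∃ x ∈ V1, ∃ y ∈ V2, ∃ z ∈ V3, e = {x, y, z} := by
  obtain ⟨h0, h1, h2, h3⟩ := h e he
  obtain ⟨x, hx⟩ := card_eq_one.1 h1
  obtain ⟨y, hy⟩ := card_eq_one.1 h2
  obtain ⟨z, hz⟩ := card_eq_one.1 h3
  have hx' : x ∈ e ∩ V1 := by simp [hx]
  have hy' : y ∈ e ∩ V2 := by simp [hy]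
  have hz' : z ∈ e ∩ V3 := by simp [hz]
  rw [mem_inter] at hx' hy' hz'
  refine ⟨x, hx'.2, y, hy'.2, z, hz'.2, ?_⟩
  ext u
  simp only [mem_insert, mem_singleton]
  constructor
  · intro hu
    have := h0 hu
    simp only [mem_union] at this
    rcases this with (h | h) | h
    · left; have : u ∈ e ∩ V1 := mem_inter.2 ⟨hu, h⟩
      rw [hx] at this; simpa using this
    · right; left; have : u ∈ e ∩ V2 := mem_inter.2 ⟨hu, h⟩
      rw [hy] at this; simpa using this
    · right; right; have : u ∈ e ∩ V3 := mem_inter.2 ⟨hu, h⟩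
      rw [hz] at this; simpa using this
  · rintro (rfl | rfl | rfl)
    exacts [hx'.1, hy'.1, hz'.1]

/-- edges through `v` avoiding `X` -/
lemma deg_off {n p q : ℕ} (h : IsPartite3 V1 V2 V3 E) (h12 : Disjoint V1 V2) (h13 : Disjoint V1 V3)
    (hc2 : V2.card = n) (hc3 : V3.card = n) {v : α} (hv : v ∈ V1) {X : Finset α} (hvX : v ∉ X)
    (hp : (X ∩ V2).card ≤ p) (hq : (X ∩ V3).card ≤ q) :
    hdeg E v + (n - p) * (n - q) ≤ n * n + (E.filter (fun e => v ∈ e ∧ Disjoint e X)).card := by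
  have hsub : E.filter (fun e => v ∈ e) ⊆ E.filter (fun e => v ∈ e ∧ Disjoint e X) ∪
      ((V2 ×ˢ V3) \ ((V2 \ X) ×ˢ (V3 \ X))).image (fun t => ({v, t.1, t.2} : Finset α)) := by
    intro e he
    rw [mem_filter] at he
    rw [mem_union, mem_filter]
    by_cases hd : Disjoint e X
    · exact Or.inl ⟨he.1, he.2, hd⟩
    right
    obtain ⟨x, hx, y, hy, z, hz, rfl⟩ := part_rep h he.1
    have hvx : v = x := by
      have h1 := he.2
      simp only [mem_insert, mem_singleton] at h1
      rcases h1 with h1 | rfl | rfl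
      · exact h1
      · exact absurd hy (disjoint_left.1 h12 hv)
      · exact absurd hz (disjoint_left.1 h13 hv)
    subst hvx
    refine mem_image.2 ⟨(y, z), ?_, rfl⟩
    simp only [mem_sdiff, mem_product, hy, hz, true_and]
    rintro ⟨h1, h2⟩
    apply hd
    simp [h1, h2, hvX]
  have h1 := (card_le_card hsub).trans (card_union_le _ _)
  have h2 := card_image_le (s := (V2 ×ˢ V3) \ ((V2 \ X) ×ˢ (V3 \ X)))
    (f := fun t => ({v, t.1, t.2} : Finset α))
  have h3 : ((V2 \ X) ×ˢ (V3 \ X)) ⊆ V2 ×ˢ V3 := product_subset_product sdiff_subset sdiff_subset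
  have h4 := card_sdiff_add_card_eq_card h3
  rw [card_product, card_product, hc2, hc3, card_sdiff (s := X) (t := V2),
    card_sdiff (s := X) (t := V3), hc2, hc3] at h4
  have h5 : (n - p) * (n - q) ≤ (n - (X ∩ V2).card) * (n - (X ∩ V3).card) := by
    gcongr
  unfold hdeg
  omega

lemma edges_off {n b g : ℕ} (h : IsPartite3 V1 V2 V3 E)
    (hc1 : V1.card = n) {X : Finset α} (hb : (X ∩ V1).card = b)
    (hg : ∀ v ∈ V1, v ∉ X → g ≤ (E.filter (fun e => v ∈ e ∧ Disjoint e X)).card) :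
    (n - b) * g ≤ (E.filter (fun e => Disjoint e X)).card := by
  have h1 : ((V1 \ X).biUnion (fun v => E.filter (fun e => v ∈ e ∧ Disjoint e X))) ⊆
      E.filter (fun e => Disjoint e X) := by
    intro e he
    simp only [mem_biUnion, mem_filter] at he ⊢
    obtain ⟨v, -, h1, h2, h3⟩ := he
    exact ⟨h1, h3⟩
  have h2 := card_le_card h1
  rw [card_biUnion] at h2
  · refine le_trans ?_ h2
    have h3 := Finset.card_nsmul_le_sum (V1 \ X)
      (fun v => (E.filter (fun e => v ∈ e ∧ Disjoint e X)).card) g ?_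
    · rw [card_sdiff, hc1, hb] at h3
      simpa using h3
    · intro v hv
      rw [mem_sdiff] at hv
      exact hg v hv.1 hv.2
  · intro x hx y hy hxy
    rw [mem_coe, mem_sdiff] at hx hy
    rw [Function.onFun, disjoint_left]
    intro e he he'
    rw [mem_filter] at he he'
    have h4 := (h e he.1).2.1
    rw [card_eq_one] at h4
    obtain ⟨u, hu⟩ := h4
    have hx' : x ∈ e ∩ V1 := mem_inter.2 ⟨he.2.1, hx.1⟩
    have hy' : y ∈ e ∩ V1 := mem_inter.2 ⟨he'.2.1, hy.1⟩
    rw [hu, mem_singleton] at hx' hy'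
    exact hxy (hx'.trans hy'.symm)

lemma light_pick {L : ℕ} {B Y : Finset α} (hY : ∀ y ∈ Y, hdeg E y ≤ L)
    (hc : Y.card * L < (E.filter (fun e => Disjoint e B)).card) :
    ∃ e ∈ E, Disjoint e B ∧ Disjoint e Y := by
  by_contra hcon
  push Not at hcon
  have h1 : E.filter (fun e => Disjoint e B) ⊆ Y.biUnion (fun y => E.filter (fun e => y ∈ e)) := by
    intro e he
    rw [mem_filter] at he
    have := hcon e he.1 he.2
    rw [not_disjoint_iff] at this
    obtain ⟨y, hy, hy'⟩ := this
    exact mem_biUnion.2 ⟨y, hy', mem_filter.2 ⟨he.1, hy⟩⟩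
  have h2 := (card_le_card h1).trans (card_biUnion_le_card_mul Y _ L hY)
  omega

end lems

set_option maxHeartbeats 2000000 in
lemma numeric (m n r s k b1 b2 b3 : ℕ) (hm : m = 3 * r + s) (hs1 : 1 ≤ s) (hs3 : s ≤ 3)
    (hn : 120 * m ≤ n) (hk : 1 ≤ k) (hb : b1 + b2 + b3 + k = m) (h2 : b2 ≤ b1) (h3 : b3 ≤ b1)
    (hsp : ¬ (s = 2 ∧ k = 2 ∧ b1 = r ∧ b2 = r ∧ b3 = r)) :
    ∃ g : ℕ, n * n + g ≤ deltaLM n r s + 1 + (n - b2) * (n - b3) ∧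
      3 * (k - 1) * (2 * m * n) < (n - b1) * g := by
  obtain ⟨N, rfl⟩ : ∃ N, n = N + r := ⟨n - r, by omega⟩
  obtain ⟨σ, hσ, hσ1, hσ2, hσ3⟩ : ∃ σ : ℤ, ((deltaLM (N + r) r s : ℕ) : ℤ) + 1 =
      ((N : ℤ) + r) ^ 2 - N ^ 2 + σ ∧ (s = 1 → σ = 1) ∧ (s = 2 → σ = 2) ∧ (s = 3 → σ = N + 1) := by
    have hN : 1 ≤ N := by omega
    obtain ⟨M, rfl⟩ : ∃ M, N = M + 1 := ⟨N - 1, by omega⟩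
    have e1 : M + 1 + r - r = M + 1 := by omega
    have e2 : M + 1 - 1 = M := by omega
    obtain rfl | rfl | rfl : s = 1 ∨ s = 2 ∨ s = 3 := by omega
    · refine ⟨1, ?_, by simp⟩
      simp only [deltaLM, e1, if_true]
      rw [Nat.cast_sub (Nat.pow_le_pow_left (by omega) 2)]; push_cast; ring
    · refine ⟨2, ?_, by simp⟩
      simp only [deltaLM, e1, e2]
      norm_num
      rw [Nat.cast_sub (by nlinarith)]; push_cast; ring
    · refine ⟨M + 1 + 1, ?_, by simp⟩
      simp only [deltaLM, e1, e2]
      norm_num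
      rw [Nat.cast_sub (by nlinarith)]; push_cast; ring
  -- integer variables
  obtain ⟨x, hx⟩ : ∃ x : ℤ, (b1 : ℤ) = r + x := ⟨b1 - r, by ring⟩
  obtain ⟨y, hy⟩ : ∃ y : ℤ, (b2 : ℤ) = r - y := ⟨r - b2, by ring⟩
  obtain ⟨z, hz⟩ : ∃ z : ℤ, (b3 : ℤ) = r - z := ⟨r - b3, by ring⟩
  have hyz : y + z = x + k - s := by
    have : ((b1 + b2 + b3 + k : ℕ) : ℤ) = ((3 * r + s : ℕ) : ℤ) := by rw [hb, hm]
    push_cast at this; linarith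
  have hyx : -x ≤ y := by have : (b2 : ℤ) ≤ b1 := by exact_mod_cast h2
                          linarith
  have hzx : -x ≤ z := by have : (b3 : ℤ) ≤ b1 := by exact_mod_cast h3
                          linarith
  have hyr : y ≤ r := by have : (0 : ℤ) ≤ b2 := by positivity
                         linarith
  have hzr : z ≤ r := by have : (0 : ℤ) ≤ b3 := by positivity
                         linarith
  have hr0 : (0 : ℤ) ≤ r := by positivity
  have hNr : 359 * (r : ℤ) + 120 * s ≤ N := by
    have : ((120 * (3 * r + s) : ℕ) : ℤ) ≤ ((N + r : ℕ) : ℤ) := by rw [← hm]; exact_mod_cast hn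
    push_cast at this; linarith
  have hs1' : (1 : ℤ) ≤ s := by exact_mod_cast hs1
  have hk1' : (1 : ℤ) ≤ k := by exact_mod_cast hk
  -- gain
  have key : (1 : ℤ) ≤ N * (x + k - s) + y * z + σ ∧
      ((k : ℤ) - 1) * (N + r) ≤ 19 * (N * (x + k - s) + y * z + σ) := by
    have hP : 0 ≤ x → -(x * r) ≤ y * z := by
      intro hx0
      have t1 : 0 ≤ x * r := mul_nonneg hx0 hr0
      rcases le_total 0 y with hy0 | hy0 <;> rcases le_total 0 z with hz0 | hz0
      · nlinarith [mul_nonneg hy0 hz0]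
      · nlinarith [mul_nonneg hy0 (by linarith : 0 ≤ z + x), mul_nonneg hx0 (sub_nonneg.2 hyr)]
      · nlinarith [mul_nonneg hz0 (by linarith : 0 ≤ y + x), mul_nonneg hx0 (sub_nonneg.2 hzr)]
      · nlinarith [mul_nonneg_of_nonpos_of_nonpos hy0 hz0]
    have hN0 : (120 : ℤ) ≤ N := by linarith
    have hσ0 : 1 ≤ σ := by
      obtain h | h | h : s = 1 ∨ s = 2 ∨ s = 3 := by omega
      · rw [hσ1 h]
      · rw [hσ2 h]; norm_num
      · rw [hσ3 h]; linarith
    have hs3' : (s : ℤ) ≤ 3 := by exact_mod_cast hs3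
    -- a convenient criterion
    have crit : (N : ℤ) * (k - 1) ≤ 4 * (N * (x + k - s) + y * z + σ) → 2 ≤ k →
        (1 : ℤ) ≤ N * (x + k - s) + y * z + σ ∧
      ((k : ℤ) - 1) * (N + r) ≤ 19 * (N * (x + k - s) + y * z + σ) := by
      intro h1 h2
      have h2' : (2 : ℤ) ≤ k := by exact_mod_cast h2
      have h3 : (N : ℤ) * 1 ≤ N * (k - 1) := mul_le_mul_of_nonneg_left (by linarith) (by linarith)
      have h4 : ((k : ℤ) - 1) * r ≤ (k - 1) * N :=
        mul_le_mul_of_nonneg_left (by linarith) (by linarith)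
      constructor
      · linarith
      · linarith
    rcases lt_or_ge x 0 with hx0 | hx0
    · have t1 : 0 ≤ y * z := mul_nonneg (by linarith) (by linarith)
      have t2 : 3 ≤ (k : ℤ) - s := by linarith
      apply crit
      · have : (N : ℤ) * (k - 1) ≤ N * (4 * (x + k - s)) :=
          mul_le_mul_of_nonneg_left (by linarith) (by linarith)
        linarith
      · omega
    · have hP' := hP hx0
      obtain h | h | h : s = 1 ∨ s = 2 ∨ s = 3 := by omega
      · subst h
        rw [hσ1 rfl] at *
        have t0 : x * r ≤ x * N := mul_le_mul_of_nonneg_left (by linarith) hx0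
        rcases Nat.lt_or_ge k 2 with hk2 | hk2
        · obtain rfl : k = 1 := by omega
          push_cast
          constructor <;> linarith
        · apply crit _ hk2
          have h2' : (2 : ℤ) ≤ k := by exact_mod_cast hk2
          have h3 : (N : ℤ) * 1 ≤ N * (k - 1) :=
            mul_le_mul_of_nonneg_left (by linarith) (by linarith)
          push_cast
          linarith
      · subst h
        rw [hσ2 rfl] at *
        have t0 : x * (359 * r) ≤ x * N := mul_le_mul_of_nonneg_left (by linarith) hx0
        rcases Nat.lt_or_ge k 2 with hk2 | hk2
        · obtain rfl : k = 1 := by omega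
          push_cast at *
          have hx1 : 1 ≤ x := by omega
          rcases eq_or_lt_of_le hx1 with hx1 | hx1
          · subst hx1
            have : y * z = -(y * y) := by
              have : z = -y := by linarith
              rw [this]; ring
            have : y * y ≤ 1 := by nlinarith
            constructor <;> linarith
          · have : 2 * (N : ℤ) ≤ x * N := mul_le_mul_of_nonneg_right (by linarith) (by linarith)
            constructor <;> linarith
        · rcases Nat.lt_or_ge k 3 with hk3 | hk3
          · obtain rfl : k = 2 := by omega
            have hx1 : 1 ≤ x := by
              by_contra hcon
              have : x = 0 := by omega
              push_cast at hyz
              exact hsp ⟨rfl, rfl, by omega, by omega, by omega⟩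
            have : 1 * (N : ℤ) ≤ x * N := mul_le_mul_of_nonneg_right (by linarith) (by linarith)
            apply crit _ hk2
            push_cast
            linarith [mul_nonneg hx0 hr0]
          · apply crit _ hk2
            have h2' : (3 : ℤ) ≤ k := by exact_mod_cast hk3
            have h3 : (N : ℤ) * (k - 1) ≤ N * (2 * (k - 2)) :=
              mul_le_mul_of_nonneg_left (by linarith) (by linarith)
            have h4 : 0 ≤ (N : ℤ) * (k - 2) := mul_nonneg (by linarith) (by linarith)
            push_cast
            linarith [mul_nonneg hx0 hr0]
      · subst h
        rw [hσ3 rfl] at *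
        have t0 : x * (359 * r) ≤ x * N := mul_le_mul_of_nonneg_left (by linarith) hx0
        rcases Nat.lt_or_ge k 2 with hk2 | hk2
        · obtain rfl : k = 1 := by omega
          push_cast at *
          have hx1 : 1 ≤ x := by omega
          rcases eq_or_lt_of_le hx1 with hx1 | hx1
          · subst hx1
            have : 0 ≤ y * z := mul_nonneg_of_nonpos_of_nonpos (by linarith) (by linarith)
            constructor <;> linarith
          · have : 2 * (N : ℤ) ≤ x * N := mul_le_mul_of_nonneg_right (by linarith) (by linarith)
            constructor <;> linarith
        · rcases Nat.lt_or_ge k 3 with hk3 | hk3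
          · obtain rfl : k = 2 := by omega
            push_cast at *
            have hx1 : 1 ≤ x := by omega
            have : 1 * (N : ℤ) ≤ x * N := mul_le_mul_of_nonneg_right (by linarith) (by linarith)
            apply crit _ (by norm_num)
            linarith
          · apply crit _ hk2
            have h2' : (3 : ℤ) ≤ k := by exact_mod_cast hk3
            have h3 : (N : ℤ) * (k - 1) ≤ N * (2 * (k - 2)) :=
              mul_le_mul_of_nonneg_left (by linarith) (by linarith)
            have h4 : 0 ≤ (N : ℤ) * (k - 2) := mul_nonneg (by linarith) (by linarith)
            push_cast
            linarith [mul_nonneg hx0 hr0]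
  obtain ⟨key1, key2⟩ := key
  obtain ⟨g, hg⟩ := Int.eq_ofNat_of_zero_le (a := N * (x + k - s) + y * z + σ) (by linarith)
  rw [hg] at key1 key2
  refine ⟨g, ?_, ?_⟩
  · zify [show b2 ≤ N + r by omega, show b3 ≤ N + r by omega]
    rw [hσ, ← hg, hy, hz, ← hyz]
    apply le_of_eq
    ring
  · obtain ⟨j, rfl⟩ : ∃ j, k = j + 1 := ⟨k - 1, by omega⟩
    have e : j + 1 - 1 = j := by omega
    rw [e]
    have hg1 : 1 ≤ g := by exact_mod_cast key1
    have hg2 : j * (N + r) ≤ 19 * g := by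
      push_cast at key2; have : (j : ℤ) * (N + r) ≤ 19 * g := by linarith
      exact_mod_cast this
    have hb1 : 119 * (N + r) ≤ 120 * (N + r - b1) := by omega
    have a1 : 119 * (N + r) * g ≤ 120 * (N + r - b1) * g := Nat.mul_le_mul_right _ hb1
    have a2 : 120 * m * (j * (N + r)) ≤ (N + r) * (19 * g) := Nat.mul_le_mul hn hg2
    have a3 : 0 < (N + r) * g := Nat.mul_pos (by omega) hg1
    nlinarith

section lems2
variable {α : Type} [DecidableEq α] {V1 V2 V3 : Finset α} {E : Finset (Finset α)}

lemma count_off1 {m n r s k b1 b2 b3 : ℕ} (hm : m = 3 * r + s) (hs1 : 1 ≤ s) (hs3 : s ≤ 3)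
    (hn : 120 * m ≤ n) (hk : 1 ≤ k) (hb : b1 + b2 + b3 + k = m) (h2 : b2 ≤ b1) (h3 : b3 ≤ b1)
    (hsp : ¬ (s = 2 ∧ k = 2 ∧ b1 = r ∧ b2 = r ∧ b3 = r))
    (h : IsPartite3 V1 V2 V3 E) (h12 : Disjoint V1 V2) (h13 : Disjoint V1 V3)
    (hc1 : V1.card = n) (hc2 : V2.card = n) (hc3 : V3.card = n)
    (hd : ∀ v ∈ V1, deltaLM n r s < hdeg E v) {B : Finset α}
    (hB1 : (B ∩ V1).card = b1) (hB2 : (B ∩ V2).card = b2) (hB3 : (B ∩ V3).card = b3) :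
    3 * (k - 1) * (2 * m * n) < (E.filter (fun e => Disjoint e B)).card := by
  obtain ⟨g, hg1, hg2⟩ := numeric m n r s k b1 b2 b3 hm hs1 hs3 hn hk hb h2 h3 hsp
  refine lt_of_lt_of_le hg2 (edges_off h hc1 hB1 ?_)
  intro v hv hvB
  have := deg_off h h12 h13 hc2 hc3 hv hvB hB2.le hB3.le
  have := hd v hv
  omega

lemma count_off {m n r s k b1 b2 b3 : ℕ} (hm : m = 3 * r + s) (hs1 : 1 ≤ s) (hs3 : s ≤ 3)
    (hn : 120 * m ≤ n) (hk : 1 ≤ k) (hb : b1 + b2 + b3 + k = m)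
    (hsp : ¬ (s = 2 ∧ k = 2 ∧ b1 = r ∧ b2 = r ∧ b3 = r))
    (h : IsPartite3 V1 V2 V3 E) (h12 : Disjoint V1 V2) (h13 : Disjoint V1 V3)
    (h23 : Disjoint V2 V3)
    (hc1 : V1.card = n) (hc2 : V2.card = n) (hc3 : V3.card = n)
    (hd : ∀ v ∈ V1 ∪ V2 ∪ V3, deltaLM n r s < hdeg E v) {B : Finset α}
    (hB1 : (B ∩ V1).card = b1) (hB2 : (B ∩ V2).card = b2) (hB3 : (B ∩ V3).card = b3) :
    3 * (k - 1) * (2 * m * n) < (E.filter (fun e => Disjoint e B)).card := by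
  have hcase : (b2 ≤ b1 ∧ b3 ≤ b1) ∨ (b1 ≤ b2 ∧ b3 ≤ b2) ∨ (b1 ≤ b3 ∧ b2 ≤ b3) := by omega
  rcases hcase with ⟨i, j⟩ | ⟨i, j⟩ | ⟨i, j⟩
  · exact count_off1 hm hs1 hs3 hn hk hb i j hsp h h12 h13 hc1 hc2 hc3
      (fun v hv => hd v (by simp [hv])) hB1 hB2 hB3
  · exact count_off1 hm hs1 hs3 hn hk (by omega) i j (by omega) (p213 h) h12.symm h23 hc2 hc1 hc3
      (fun v hv => hd v (by simp [hv])) hB2 hB1 hB3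
  · exact count_off1 hm hs1 hs3 hn hk (by omega) i j (by omega) (p312 h) h13.symm h23.symm
      hc3 hc1 hc2 (fun v hv => hd v (by simp [hv])) hB3 hB1 hB2

lemma deg_two {n r : ℕ} (hr : r + 1 ≤ n)
    (h : IsPartite3 V1 V2 V3 E) (h12 : Disjoint V1 V2) (h13 : Disjoint V1 V3)
    (hc2 : V2.card = n) (hc3 : V3.card = n)
    (hd : ∀ v ∈ V1, deltaLM n r 2 < hdeg E v) {B : Finset α}
    (hB2 : (B ∩ V2).card = r) (hB3 : (B ∩ V3).card = r) :
    ∀ v ∈ V1, v ∉ B → 2 ≤ (E.filter (fun e => v ∈ e ∧ Disjoint e B)).card := by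
  intro v hv hvB
  have h1 := deg_off h h12 h13 hc2 hc3 hv hvB hB2.le hB3.le
  have h2 := hd v hv
  have h3 : n * n + 1 ≤ deltaLM n r 2 + (n - r) * (n - r) := by
    obtain ⟨M, rfl⟩ : ∃ M, n = M + 1 + r := ⟨n - r - 1, by omega⟩
    have e1 : M + 1 + r - r = M + 1 := by omega
    have e2 : M + 1 - 1 = M := by omega
    simp only [deltaLM, e1, e2]
    norm_num
    have : (M + 1 + 1) * M ≤ (M + 1 + r) ^ 2 := by nlinarith
    zify [this]
    linarith
  omega

lemma avoid_one {n r : ℕ} (hr : r + 2 ≤ n) (h : IsPartite3 V1 V2 V3 E)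
    (hc1 : V1.card = n) {B : Finset α} (hB1 : (B ∩ V1).card = r)
    (hg : ∀ v ∈ V1, v ∉ B → 2 ≤ (E.filter (fun e => v ∈ e ∧ Disjoint e B)).card)
    {w : α} (hw : w ∈ V1) : ∃ e ∈ E, Disjoint e B ∧ w ∉ e := by
  have h1 : 1 < (V1 \ B).card := by rw [card_sdiff, hB1, hc1]; omega
  obtain ⟨v, hv, hvw⟩ := exists_mem_ne h1 w
  rw [mem_sdiff] at hv
  have h2 := hg v hv.1 hv.2
  obtain ⟨e, he⟩ := card_pos.1 (by omega : 0 < (E.filter (fun e => v ∈ e ∧ Disjoint e B)).card)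
  rw [mem_filter] at he
  refine ⟨e, he.1, he.2.2, fun hwe => ?_⟩
  obtain ⟨u, hu⟩ := card_eq_one.1 (h e he.1).2.1
  have hx' : v ∈ e ∩ V1 := mem_inter.2 ⟨he.2.1, hv.1⟩
  have hy' : w ∈ e ∩ V1 := mem_inter.2 ⟨hwe, hw⟩
  rw [hu, mem_singleton] at hx' hy'
  exact hvw (hx'.trans hy'.symm)

lemma cross_abs (P Q : α → α → α → Prop) (W1 W2 W3 : Finset α)
    (hne : W1.Nonempty) (hW1 : ∀ u v, ∃ w ∈ W1, w ≠ u ∧ w ≠ v) (hW2 : ∀ u v, ∃ w ∈ W2, w ≠ u ∧ w ≠ v)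
    (hW3 : ∀ u v, ∃ w ∈ W3, w ≠ u ∧ w ≠ v)
    (hP : ∀ v ∈ W1, ∃ a b a' b', P v a b ∧ P v a' b' ∧ ¬ (a = a' ∧ b = b'))
    (hQ : ∀ v ∈ W1, ∃ a b a' b', Q v a b ∧ Q v a' b' ∧ ¬ (a = a' ∧ b = b'))
    (hP2 : ∀ y ∈ W2, ∃ x z, P x y z) (hP3 : ∀ z ∈ W3, ∃ x y, P x y z)
    (hc : ∀ x y z x' y' z', P x y z → Q x' y' z' → x = x' ∨ y = y' ∨ z = z') : False := by
  obtain ⟨v, hv⟩ := hne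
  obtain ⟨a, b, a', b', h1, h2, hab⟩ := hP v hv
  by_cases haa : a = a'
  · subst haa
    have hbb : b ≠ b' := fun h => hab ⟨rfl, h⟩
    have hall : ∀ u y z, P u y z → y = a := by
      intro u y z hp
      obtain ⟨w, hw, hwu, hwv⟩ := hW1 u v
      obtain ⟨c, d, c', d', q1, q2, hcd⟩ := hQ w hw
      have := hc _ _ _ _ _ _ h1 q1
      have := hc _ _ _ _ _ _ h2 q1
      have := hc _ _ _ _ _ _ h1 q2
      have := hc _ _ _ _ _ _ h2 q2
      have := hc _ _ _ _ _ _ hp q1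
      have := hc _ _ _ _ _ _ hp q2
      grind
    obtain ⟨y, hy, hya, -⟩ := hW2 a a
    obtain ⟨x, z, hp⟩ := hP2 y hy
    exact hya (hall _ _ _ hp)
  by_cases hbb : b = b'
  · subst hbb
    have hall : ∀ u y z, P u y z → z = b := by
      intro u y z hp
      obtain ⟨w, hw, hwu, hwv⟩ := hW1 u v
      obtain ⟨c, d, c', d', q1, q2, hcd⟩ := hQ w hw
      have := hc _ _ _ _ _ _ h1 q1
      have := hc _ _ _ _ _ _ h2 q1
      have := hc _ _ _ _ _ _ h1 q2
      have := hc _ _ _ _ _ _ h2 q2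
      have := hc _ _ _ _ _ _ hp q1
      have := hc _ _ _ _ _ _ hp q2
      grind
    obtain ⟨y, hy, hya, -⟩ := hW3 b b
    obtain ⟨x, z, hp⟩ := hP3 y hy
    exact hya (hall _ _ _ hp)
  have hall : ∀ u y z, P u y z → y = a ∨ y = a' := by
    intro u y z hp
    obtain ⟨w, hw, hwu, hwv⟩ := hW1 u v
    obtain ⟨c, d, c', d', q1, q2, hcd⟩ := hQ w hw
    have := hc _ _ _ _ _ _ h1 q1
    have := hc _ _ _ _ _ _ h2 q1
    have := hc _ _ _ _ _ _ h1 q2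
    have := hc _ _ _ _ _ _ h2 q2
    have := hc _ _ _ _ _ _ hp q1
    have := hc _ _ _ _ _ _ hp q2
    grind
  obtain ⟨y, hy, hya, hya'⟩ := hW2 a a'
  obtain ⟨x, z, hp⟩ := hP2 y hy
  rcases hall _ _ _ hp with h | h
  exacts [hya h, hya' h]

lemma exists_third {V B : Finset α} (h : 3 ≤ (V \ B).card) (u v : α) :
    ∃ w ∈ V \ B, w ≠ u ∧ w ≠ v := by
  have h1 : 0 < (((V \ B).erase u).erase v).card := by
    have := pred_card_le_card_erase (s := V \ B) (a := u)
    have := pred_card_le_card_erase (s := (V \ B).erase u) (a := v)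
    omega
  obtain ⟨w, hw⟩ := card_pos.1 h1
  simp only [mem_erase] at hw
  exact ⟨w, hw.2.2, hw.2.1, hw.1⟩

lemma first_edge (h : IsPartite3 V1 V2 V3 E) (h12 : Disjoint V1 V2) (h13 : Disjoint V1 V3)
    {e : Finset α} (he : e ∈ E) {v : α} (hv : v ∈ V1) (hve : v ∈ e) :
    ∃ y ∈ V2, ∃ z ∈ V3, e = {v, y, z} := by
  obtain ⟨x, hx, y, hy, z, hz, rfl⟩ := part_rep h he
  have hvx : v = x := by
    simp only [mem_insert, mem_singleton] at hve
    rcases hve with h1 | rfl | rfl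
    · exact h1
    · exact absurd hy (disjoint_left.1 h12 hv)
    · exact absurd hz (disjoint_left.1 h13 hv)
  subst hvx
  exact ⟨y, hy, z, hz, rfl⟩

lemma cross_pair {E' : Finset (Finset α)} {B : Finset α} (h : IsPartite3 V1 V2 V3 E)
    (h' : IsPartite3 V1 V2 V3 E')
    (h12 : Disjoint V1 V2) (h13 : Disjoint V1 V3) (h23 : Disjoint V2 V3)
    (hV1 : 3 ≤ (V1 \ B).card) (hV2 : 3 ≤ (V2 \ B).card) (hV3 : 3 ≤ (V3 \ B).card)
    (g1 : ∀ v ∈ V1, v ∉ B → 2 ≤ (E.filter (fun e => v ∈ e ∧ Disjoint e B)).card)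
    (g2 : ∀ v ∈ V2, v ∉ B → 2 ≤ (E.filter (fun e => v ∈ e ∧ Disjoint e B)).card)
    (g3 : ∀ v ∈ V3, v ∉ B → 2 ≤ (E.filter (fun e => v ∈ e ∧ Disjoint e B)).card)
    (g1' : ∀ v ∈ V1, v ∉ B → 2 ≤ (E'.filter (fun e => v ∈ e ∧ Disjoint e B)).card) :
    ∃ e ∈ E, ∃ e' ∈ E', Disjoint e B ∧ Disjoint e' B ∧ Disjoint e e' := by
  by_contra hcon
  push Not at hcon
  have two : ∀ E : Finset (Finset α), IsPartite3 V1 V2 V3 E →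
      (∀ v ∈ V1, v ∉ B → 2 ≤ (E.filter (fun e => v ∈ e ∧ Disjoint e B)).card) →
      ∀ v ∈ V1 \ B, ∃ a b a' b', 
        (v ∈ V1 ∧ a ∈ V2 ∧ b ∈ V3 ∧ {v, a, b} ∈ E ∧ Disjoint {v, a, b} B) ∧
        (v ∈ V1 ∧ a' ∈ V2 ∧ b' ∈ V3 ∧ {v, a', b'} ∈ E ∧ Disjoint {v, a', b'} B) ∧
        ¬ (a = a' ∧ b = b') := by
    intro E h g v hv
    rw [mem_sdiff] at hv
    obtain ⟨e, he, e', he', hee⟩ := one_lt_card.1 (g v hv.1 hv.2)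
    rw [mem_filter] at he he'
    obtain ⟨y, hy, z, hz, rfl⟩ := first_edge h h12 h13 he.1 hv.1 he.2.1
    obtain ⟨y', hy', z', hz', rfl⟩ := first_edge h h12 h13 he'.1 hv.1 he'.2.1
    refine ⟨y, z, y', z', ⟨hv.1, hy, hz, he.1, he.2.2⟩, ⟨hv.1, hy', hz', he'.1, he'.2.2⟩, ?_⟩
    rintro ⟨rfl, rfl⟩
    exact hee rfl
  refine cross_abs
    (fun x y z => x ∈ V1 ∧ y ∈ V2 ∧ z ∈ V3 ∧ {x, y, z} ∈ E ∧ Disjoint {x, y, z} B)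
    (fun x y z => x ∈ V1 ∧ y ∈ V2 ∧ z ∈ V3 ∧ {x, y, z} ∈ E' ∧ Disjoint {x, y, z} B)
    (V1 \ B) (V2 \ B) (V3 \ B) (card_pos.1 (by omega)) (exists_third hV1) (exists_third hV2) (exists_third hV3)
    (two E h g1) (two E' h' g1') ?_ ?_ ?_
  · intro v hv
    rw [mem_sdiff] at hv
    obtain ⟨e, he, -⟩ := one_lt_card.1 (g2 v hv.1 hv.2)
    rw [mem_filter] at he
    obtain ⟨x, hx, z, hz, rfl⟩ := first_edge (p213 h) h12.symm h23 he.1 hv.1 he.2.1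
    rw [Finset.insert_comm] at he
    exact ⟨x, z, hx, hv.1, hz, he.1, he.2.2⟩
  · intro v hv
    rw [mem_sdiff] at hv
    obtain ⟨e, he, -⟩ := one_lt_card.1 (g3 v hv.1 hv.2)
    rw [mem_filter] at he
    obtain ⟨x, hx, y, hy, rfl⟩ := first_edge (p312 h) h13.symm h23.symm he.1 hv.1 he.2.1
    have : ({v, x, y} : Finset α) = {x, y, v} := by
      rw [Finset.insert_comm, Finset.pair_comm]
    rw [this] at he
    exact ⟨x, y, hx, hy, hv.1, he.1, he.2.2⟩
  · rintro x y z x' y' z' ⟨hx, hy, hz, he, hB⟩ ⟨hx', hy', hz', he', hB'⟩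
    by_contra hne
    push Not at hne
    apply hcon _ he _ he' hB hB'
    have d12 : ∀ a ∈ V1, a ∉ V2 := fun a ha => disjoint_left.1 h12 ha
    have d13 : ∀ a ∈ V1, a ∉ V3 := fun a ha => disjoint_left.1 h13 ha
    have d23 : ∀ a ∈ V2, a ∉ V3 := fun a ha => disjoint_left.1 h23 ha
    rw [disjoint_left]
    intro u hu hu'
    simp only [mem_insert, mem_singleton] at hu hu'
    grind

lemma heavy_pick1 {m n : ℕ} (hmn : m ≤ n) (h : IsPartite3 V1 V2 V3 E) (h12 : Disjoint V1 V2)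
    (h13 : Disjoint V1 V3) (hc2 : V2.card = n) (hc3 : V3.card = n) {v : α} (hv : v ∈ V1)
    (hh : 2 * m * n < hdeg E v)
    {X : Finset α} (hvX : v ∉ X) (hp : (X ∩ V2).card ≤ m) (hq : (X ∩ V3).card ≤ m) :
    ∃ e ∈ E, v ∈ e ∧ Disjoint e X := by
  have h1 := deg_off h h12 h13 hc2 hc3 hv hvX hp hq
  have h2 : n * n ≤ 2 * m * n + (n - m) * (n - m) := by
    obtain ⟨c, rfl⟩ := Nat.exists_eq_add_of_le hmn
    have : m + c - m = c := by omega
    rw [this]; nlinarith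
  obtain ⟨e, he⟩ := card_pos.1 (by omega : 0 < (E.filter (fun e => v ∈ e ∧ Disjoint e X)).card)
  rw [mem_filter] at he
  exact ⟨e, he⟩

lemma heavy_pick {m n : ℕ} (hmn : m ≤ n) (h : IsPartite3 V1 V2 V3 E) (h12 : Disjoint V1 V2)
    (h13 : Disjoint V1 V3) (h23 : Disjoint V2 V3)
    (hc1 : V1.card = n) (hc2 : V2.card = n) (hc3 : V3.card = n) {v : α} (hv : v ∈ V1 ∪ V2 ∪ V3)
    (hh : 2 * m * n < hdeg E v)
    {X : Finset α} (hvX : v ∉ X) (h1 : (X ∩ V1).card ≤ m) (h2 : (X ∩ V2).card ≤ m)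
    (h3 : (X ∩ V3).card ≤ m) :
    ∃ e ∈ E, v ∈ e ∧ Disjoint e X := by
  simp only [mem_union] at hv
  rcases hv with (hv | hv) | hv
  · exact heavy_pick1 hmn h h12 h13 hc2 hc3 hv hh hvX h2 h3
  · exact heavy_pick1 hmn (p213 h) h12.symm h23 hc1 hc3 hv hh hvX h1 h3
  · exact heavy_pick1 hmn (p312 h) h13.symm h23.symm hc1 hc2 hv hh hvX h1 h2

end lems2

/-- partial rainbow matching on `Q`, avoiding the reserved vertices of unprocessed families -/
def GoodM {m : ℕ} {α : Type} [DecidableEq α] (F : Fin m → Finset (Finset α)) (U : Finset (Fin m))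
    (τ : Fin m → α) (Q : Finset (Fin m)) (e : Fin m → Finset α) : Prop :=
  (∀ i ∈ Q, e i ∈ F i) ∧ (∀ i ∈ Q, ∀ j ∈ Q, i ≠ j → Disjoint (e i) (e j)) ∧
    (∀ i ∈ Q, ∀ j, j ∉ U → j ∉ Q → τ j ∉ e i)

lemma GoodM.extend {m : ℕ} {α : Type} [DecidableEq α] {F : Fin m → Finset (Finset α)}
    {U : Finset (Fin m)} {τ : Fin m → α} {Q : Finset (Fin m)} {e : Fin m → Finset α}
    (h : GoodM F U τ Q e) {i : Fin m} (hi : i ∉ Q) {e' : Finset α} (he' : e' ∈ F i)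
    (hd : ∀ j ∈ Q, Disjoint e' (e j)) (hτ : ∀ j, j ∉ U → j ∉ Q → j ≠ i → τ j ∉ e') :
    ∃ e2, GoodM F U τ (insert i Q) e2 := by
  obtain ⟨h1, h2, h3⟩ := h
  have hne : ∀ j ∈ Q, j ≠ i := fun j hj hji => hi (hji ▸ hj)
  refine ⟨Function.update e i e', ?_, ?_, ?_⟩
  · intro j hj
    rcases mem_insert.1 hj with rfl | hj
    · simpa using he'
    · rw [Function.update_of_ne (hne j hj)]; exact h1 j hj
  · intro j hj0 l hl0 hjl
    rcases mem_insert.1 hj0 with hj | hj <;> rcases mem_insert.1 hl0 with hl | hl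
    · exact absurd (hj.trans hl.symm) hjl
    · rw [hj, Function.update_self, Function.update_of_ne (hne l hl)]; exact hd l hl
    · rw [hl, Function.update_self, Function.update_of_ne (hne j hj)]; exact (hd j hj).symm
    · rw [Function.update_of_ne (hne l hl), Function.update_of_ne (hne j hj)]
      exact h2 j hj l hl hjl
  · intro j hj l hl hlQ
    rw [mem_insert, not_or] at hlQ
    rcases mem_insert.1 hj with rfl | hj
    · rw [Function.update_self]; exact hτ l hl hlQ.2 hlQ.1
    · rw [Function.update_of_ne (hne j hj)]; exact h3 j hj l hl hlQ.2

lemma phase2 {m n : ℕ} {α : Type} [DecidableEq α] {V1 V2 V3 : Finset α} (hmn : m ≤ n)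
    (h12 : Disjoint V1 V2) (h13 : Disjoint V1 V3) (h23 : Disjoint V2 V3)
    (hc1 : V1.card = n) (hc2 : V2.card = n) (hc3 : V3.card = n)
    (F : Fin m → Finset (Finset α)) (hF : ∀ i, IsPartite3 V1 V2 V3 (F i))
    (U : Finset (Fin m)) (τ : Fin m → α)
    (hinj : ∀ i, i ∉ U → ∀ j, j ∉ U → τ i = τ j → i = j)
    (hτ : ∀ i, i ∉ U → τ i ∈ V1 ∪ V2 ∪ V3 ∧ 2 * m * n < hdeg (F i) (τ i))
    (h0 : ∃ e, GoodM F U τ U e) : ∃ e, GoodM F U τ univ e := by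
  have key : ∀ P : Finset (Fin m), ∃ e, GoodM F U τ (U ∪ P) e := by
    intro P
    induction P using Finset.induction_on with
    | empty => simpa using h0
    | insert i P hi ih =>
      obtain ⟨e, he⟩ := ih
      rw [union_insert]
      by_cases hiQ : i ∈ U ∪ P
      · rw [insert_eq_of_mem hiQ]; exact ⟨e, he⟩
      have hUQ : U ⊆ U ∪ P := subset_union_left
      generalize U ∪ P = Q at *
      have hiU : i ∉ U := fun h => hiQ (hUQ h)
      set X := Q.biUnion e ∪ ((univ \ Q).erase i).image τ with hX
      have hcardX : ∀ V : Finset α, (∀ j ∈ Q, (e j ∩ V).card = 1) → (X ∩ V).card ≤ m := by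
        intro V hV
        have s1 : X ∩ V ⊆ Q.biUnion (fun j => e j ∩ V) ∪ ((univ \ Q).erase i).image τ := by
          intro x hx
          simp only [hX, mem_inter, mem_union, mem_biUnion] at hx ⊢
          rcases hx with ⟨⟨j, hj, hxj⟩ | hx, hxV⟩
          · exact Or.inl ⟨j, hj, hxj, hxV⟩
          · exact Or.inr hx
        have s2 := (card_le_card s1).trans (card_union_le _ _)
        have s3 := card_biUnion_le_card_mul Q (fun j => e j ∩ V) 1 (fun j hj => (hV j hj).le)
        have s4 := card_image_le (s := (univ \ Q).erase i) (f := τ)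
        have s5 := card_le_card (erase_subset i (univ \ Q))
        have s6 := card_sdiff_add_card_eq_card (subset_univ Q)
        rw [card_univ, Fintype.card_fin] at s6
        omega
      have hp : ∀ j ∈ Q, _ := fun j hj => (hF j (e j) (he.1 j hj)).2
      have hvX : τ i ∉ X := by
        rw [hX, mem_union, not_or]
        constructor
        · rw [mem_biUnion]
          rintro ⟨j, hj, hx⟩
          exact he.2.2 j hj i hiU hiQ hx
        · rw [mem_image]
          rintro ⟨j, hj, hx⟩
          rw [mem_erase, mem_sdiff] at hj
          exact hj.1 (hinj j (fun h => hj.2.2 (hUQ h)) i hiU hx)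
      obtain ⟨e', he', -, hdX⟩ := heavy_pick hmn (hF i) h12 h13 h23 hc1 hc2 hc3 (hτ i hiU).1
        (hτ i hiU).2 hvX (hcardX V1 fun j hj => (hp j hj).1) (hcardX V2 fun j hj => (hp j hj).2.1)
        (hcardX V3 fun j hj => (hp j hj).2.2)
      rw [hX, disjoint_union_right] at hdX
      refine he.extend hiQ he' ?_ ?_
      · intro j hj
        exact disjoint_of_subset_right (subset_biUnion_of_mem e hj) hdX.1
      · intro j hjU hjQ hji hx
        refine disjoint_left.1 hdX.2 hx (mem_image_of_mem _ ?_)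
        simp [hji, hjQ]
  have := key univ
  rwa [union_eq_right.2 (subset_univ U)] at this

lemma phase1 {m L k : ℕ} {α : Type} [DecidableEq α] {V1 V2 V3 : Finset α}
    (F : Fin m → Finset (Finset α)) (hF : ∀ i, IsPartite3 V1 V2 V3 (F i))
    (U : Finset (Fin m)) (τ : Fin m → α) (B : Finset α)
    (hB : B ⊆ (univ \ U).image τ) (hk : B.card + k = m)
    (hlight : ∀ i ∈ U, ∀ v, v ∉ B → hdeg (F i) v ≤ L)
    (hcount : ∀ i ∈ U, 3 * (k - 1) * L < ((F i).filter (fun e => Disjoint e B)).card) :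
    ∃ e, GoodM F U τ U e := by
  have key : ∀ P : Finset (Fin m), P ⊆ U → ∃ e, GoodM F U τ P e := by
    intro P
    induction P using Finset.induction_on with
    | empty => intro _; exact ⟨fun _ => ∅, by simp [GoodM]⟩
    | insert i P hi ih =>
      intro hPU
      obtain ⟨e, he⟩ := ih ((subset_insert _ _).trans hPU)
      have hiU : i ∈ U := hPU (mem_insert_self _ _)
      have hcard := card_le_card hPU
      rw [card_insert_of_notMem hi] at hcard
      set T := (univ \ U).image τ with hT
      set Y := (P.biUnion e ∪ T) \ B with hY
      have c1 : Y.card ≤ P.card * 3 + (T.card - B.card) := by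
        have s1 : Y ⊆ P.biUnion e ∪ (T \ B) := by
          intro x hx
          simp only [hY, mem_sdiff, mem_union] at hx ⊢
          tauto
        have s2 := (card_le_card s1).trans (card_union_le _ _)
        have s3 := card_biUnion_le_card_mul P e 3 (fun j hj => by
          obtain ⟨x, _, y, _, z, _, h⟩ := part_rep (hF j) (he.1 j hj)
          rw [h]; exact card_le_three)
        rw [card_sdiff_of_subset hB] at s2
        omega
      have c2 : T.card ≤ m - U.card := by
        have s4 : T.card ≤ (univ \ U).card := card_image_le
        have s6 := card_sdiff_add_card_eq_card (subset_univ U)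
        rw [card_univ, Fintype.card_fin] at s6
        omega
      have c3 : B.card ≤ T.card := card_le_card hB
      have c5 : U.card ≤ m := by simpa using card_le_univ U
      have c4 : Y.card ≤ 3 * (k - 1) := by omega
      obtain ⟨e', he', hd1, hd2⟩ := light_pick (L := L) (E := F i) (B := B) (Y := Y)
        (fun y hy => hlight i hiU y (mem_sdiff.1 hy).2)
        (lt_of_le_of_lt (Nat.mul_le_mul_right L c4) (hcount i hiU))
      have hd3 : Disjoint e' (P.biUnion e ∪ T) := by
        rw [disjoint_left] at *
        intro x hx hx'
        exact hd2 hx (mem_sdiff.2 ⟨hx', hd1 hx⟩)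
      rw [disjoint_union_right] at hd3
      refine he.extend hi he' ?_ ?_
      · intro j hj
        exact disjoint_of_subset_right (subset_biUnion_of_mem e hj) hd3.1
      · intro j hjU hjQ hji hx
        refine disjoint_left.1 hd3.2 hx (mem_image_of_mem _ ?_)
        simp [hjU]
  exact key U (Subset.refl _)

/-- If `m = 3r + s` with `1 ≤ s ≤ 3`, `n ≥ 120m`, and `F 1, …, F m` are
3-partite 3-graphs on the same vertex classes of size `n` with
`δ₁(F i) > δ(n,r,s)` for all `i`, then `{F 1, …, F m}` admits a rainbow
matching of size `m`. -/
theorem small_rainbow_matchings (m n r s : ℕ)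
    (hm : m = 3 * r + s) (hs1 : 1 ≤ s) (hs3 : s ≤ 3) (hn : 120 * m ≤ n)
    (α : Type) [DecidableEq α] (V1 V2 V3 : Finset α)
    (h12 : Disjoint V1 V2) (h13 : Disjoint V1 V3) (h23 : Disjoint V2 V3)
    (hc1 : V1.card = n) (hc2 : V2.card = n) (hc3 : V3.card = n)
    (F : Fin m → Finset (Finset α))
    (hF : ∀ i, IsPartite3 V1 V2 V3 (F i))
    (hd : ∀ i, ∀ v ∈ V1 ∪ V2 ∪ V3, deltaLM n r s < hdeg (F i) v) :
    ∃ e : Fin m → Finset α,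
      (∀ i, e i ∈ F i) ∧ (∀ i j, i ≠ j → Disjoint (e i) (e j)) := by
  have hmn : m ≤ n := by omega
  have hn0 : 0 < V1.card := by omega
  obtain ⟨a, ha⟩ := card_pos.1 hn0
  obtain ⟨U, τ, B, hinj, hτH, hUB, hBT⟩ := hall_def a
    (fun i => (V1 ∪ V2 ∪ V3).filter (fun v => 2 * m * n < hdeg (F i) v))
  have hτ : ∀ i, i ∉ U → τ i ∈ V1 ∪ V2 ∪ V3 ∧ 2 * m * n < hdeg (F i) (τ i) :=
    fun i hi => mem_filter.1 (hτH i hi)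
  suffices h0 : ∃ e, GoodM F U τ U e by
    obtain ⟨e, h1, h2, -⟩ := phase2 hmn h12 h13 h23 hc1 hc2 hc3 F hF U τ hinj hτ h0
    exact ⟨e, fun i => h1 i (mem_univ i), fun i j => h2 i (mem_univ i) j (mem_univ j)⟩
  rcases U.eq_empty_or_nonempty with rfl | hUne
  · exact ⟨fun _ => ∅, by simp [GoodM]⟩
  have hU1 : 1 ≤ U.card := card_pos.2 hUne
  have hUm : U.card ≤ m := by simpa using card_le_univ U
  have hTc : ((univ \ U).image τ).card = m - U.card := by
    rw [card_image_of_injOn, card_sdiff_of_subset (subset_univ U), card_univ, Fintype.card_fin]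
    intro i hi j hj h
    rw [mem_coe, mem_sdiff] at hi hj
    exact hinj i hi.2 j hj.2 h
  have hBc := card_le_card hBT
  have hTV : (univ \ U).image τ ⊆ V1 ∪ V2 ∪ V3 := by
    intro x hx
    obtain ⟨i, hi, rfl⟩ := mem_image.1 hx
    exact (hτ i (mem_sdiff.1 hi).2).1
  have hBsum : (B ∩ V1).card + (B ∩ V2).card + (B ∩ V3).card = B.card := by
    rw [← card_union_of_disjoint, ← card_union_of_disjoint, ← inter_union_distrib_left,
      ← inter_union_distrib_left, inter_eq_left.2 (hBT.trans hTV)]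
    · rw [← inter_union_distrib_left]
      exact disjoint_of_subset_left inter_subset_right
        (disjoint_of_subset_right inter_subset_right (disjoint_union_left.2 ⟨h13, h23⟩))
    · exact disjoint_of_subset_left inter_subset_right
        (disjoint_of_subset_right inter_subset_right h12)
  obtain ⟨k, hk⟩ : ∃ k, B.card + k = m := ⟨m - B.card, by omega⟩
  have hk1 : 1 ≤ k := by omega
  by_cases hsp : s = 2 ∧ k = 2 ∧ (B ∩ V1).card = r ∧ (B ∩ V2).card = r ∧ (B ∩ V3).card = r
  · obtain ⟨rfl, rfl, hB1, hB2, hB3⟩ := hsp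
    have g1 : ∀ i, ∀ v ∈ V1, v ∉ B →
        2 ≤ ((F i).filter (fun e => v ∈ e ∧ Disjoint e B)).card := fun i =>
      deg_two (by omega) (hF i) h12 h13 hc2 hc3 (fun v hv => hd i v (by simp [hv])) hB2 hB3
    have g2 : ∀ i, ∀ v ∈ V2, v ∉ B →
        2 ≤ ((F i).filter (fun e => v ∈ e ∧ Disjoint e B)).card := fun i =>
      deg_two (by omega) (p213 (hF i)) h12.symm h23 hc1 hc3
        (fun v hv => hd i v (by simp [hv])) hB1 hB3
    have g3 : ∀ i, ∀ v ∈ V3, v ∉ B →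
        2 ≤ ((F i).filter (fun e => v ∈ e ∧ Disjoint e B)).card := fun i =>
      deg_two (by omega) (p312 (hF i)) h13.symm h23.symm hc1 hc2
        (fun v hv => hd i v (by simp [hv])) hB1 hB2
    obtain hU | hU : U.card = 1 ∨ U.card = 2 := by omega
    · obtain ⟨i, rfl⟩ := card_eq_one.1 hU
      have hw1 : ((univ \ {i}).image τ \ B).card = 1 := by
        rw [card_sdiff_of_subset hBT]; omega
      obtain ⟨w, hw⟩ := card_eq_one.1 hw1
      have hwV : w ∈ V1 ∪ V2 ∪ V3 := by
        have : w ∈ (univ \ {i}).image τ \ B := by rw [hw]; simp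
        exact hTV (mem_sdiff.1 this).1
      obtain ⟨e, he, heB, hwe⟩ : ∃ e ∈ F i, Disjoint e B ∧ w ∉ e := by
        simp only [mem_union] at hwV
        rcases hwV with (h | h) | h
        · exact avoid_one (by omega) (hF i) hc1 hB1 (g1 i) h
        · exact avoid_one (by omega) (p213 (hF i)) hc2 hB2 (g2 i) h
        · exact avoid_one (by omega) (p312 (hF i)) hc3 hB3 (g3 i) h
      refine ⟨fun _ => e, ?_, ?_, ?_⟩
      · intro j hj
        rw [mem_singleton.1 hj]; exact he
      · intro j hj l hl hjl
        rw [mem_singleton] at hj hl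
        exact absurd (hj.trans hl.symm) hjl
      · intro j _ l hl _ hx
        have hlT : τ l ∈ (univ \ {i}).image τ := mem_image_of_mem _ (by simpa using hl)
        by_cases hlB : τ l ∈ B
        · exact disjoint_left.1 heB hx hlB
        · have : τ l ∈ (univ \ {i}).image τ \ B := mem_sdiff.2 ⟨hlT, hlB⟩
          rw [hw, mem_singleton] at this
          exact hwe (this ▸ hx)
    · have hBe : B = (univ \ U).image τ := eq_of_subset_of_card_le hBT (by omega)
      obtain ⟨i, j, hij, rfl⟩ := card_eq_two.1 hU
      obtain ⟨e, he, e', he', heB, heB', hee⟩ := cross_pair (hF i) (hF j) h12 h13 h23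
        (by rw [card_sdiff, hB1]; omega) (by rw [card_sdiff, hB2]; omega)
        (by rw [card_sdiff, hB3]; omega) (g1 i) (g2 i) (g3 i) (g1 j)
      have ej : (if j = i then e else e') = e' := if_neg hij.symm
      refine ⟨fun x => if x = i then e else e', ?_, ?_, ?_⟩
      · intro x hx
        rw [mem_insert, mem_singleton] at hx
        rcases hx with rfl | rfl
        · simpa using he
        · simpa only [ej] using he'
      · intro x hx y hy hxy
        rw [mem_insert, mem_singleton] at hx hy
        rcases hx with hx | hx <;> rcases hy with hy | hy
        · exact absurd (hx.trans hy.symm) hxy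
        · rw [hx, hy]; simpa only [ej, if_true] using hee
        · rw [hx, hy]; simpa only [ej, if_true] using hee.symm
        · exact absurd (hx.trans hy.symm) hxy
      · intro x _ l hl _ hx
        have hlB : τ l ∈ B := by
          rw [hBe]; exact mem_image_of_mem _ (mem_sdiff.2 ⟨mem_univ _, hl⟩)
        by_cases hxi : x = i
        · simp only [hxi, if_true] at hx
          exact disjoint_left.1 heB hx hlB
        · simp only [hxi, if_false] at hx
          exact disjoint_left.1 heB' hx hlB
  · refine phase1 (L := 2 * m * n) (k := k) F hF U τ B hBT hk ?_ ?_
    · intro i hi v hvB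
      by_contra hcon
      push Not at hcon
      by_cases hvV : v ∈ V1 ∪ V2 ∪ V3
      · exact hvB (hUB i hi (mem_filter.2 ⟨hvV, hcon⟩))
      · obtain ⟨e, he⟩ := card_pos.1 (lt_of_le_of_lt (Nat.zero_le _) hcon)
        rw [mem_filter] at he
        exact hvV ((hF i e he.1).1 he.2)
    · intro i hi
      exact count_off hm hs1 hs3 hn hk1 (by omega) hsp (hF i) h12 h13 h23 hc1 hc2 hc3 (hd i)
        rfl rfl rfl
end

section
/- For every sufficiently small ε > 0 there exists n0 ∈ ℕ such that the following holds for all n ≥ n0. Let r, s be nonnegative integers with n = 3r + s and 1 ≤ s ≤ 3. Let H be a 4-partite 4-graph with vertex classes V1, V2, V3, V4, each of size n. If H is ε-close to H'_{1,3}(n) and d_H({x,y}) > δ(n,r,s) for every x ∈ V1 and every y ∈ V2 ∪ V3 ∪ V4, then H has a perfect matching. -/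
open Finset

/-- The number of edges of `E` containing both vertices `x` and `y`. -/
def hdeg2 {α : Type} [DecidableEq α] (E : Finset (Finset α)) (x y : α) : ℕ :=
  (E.filter (fun e => x ∈ e ∧ y ∈ e)).card

/-- `E` is the edge set of a 4-partite 4-graph with classes `V1, V2, V3, V4`. -/
def IsPartite4 {α : Type} [DecidableEq α] (V1 V2 V3 V4 : Finset α)
    (E : Finset (Finset α)) : Prop :=
  ∀ e ∈ E, e ⊆ V1 ∪ V2 ∪ V3 ∪ V4 ∧ (e ∩ V1).card = 1 ∧ (e ∩ V2).card = 1 ∧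
    (e ∩ V3).card = 1 ∧ (e ∩ V4).card = 1

/-- The edge set of `H'₁,₃(n)` for the choice `W2, W3, W4` of the partition
sets: all quadruples with one vertex in each class that meet `W2 ∪ W3 ∪ W4`
and meet `(V2 \ W2) ∪ (V3 \ W3) ∪ (V4 \ W4)`. -/
def H13edges {α : Type} [DecidableEq α] (V1 V2 V3 V4 W2 W3 W4 : Finset α) :
    Finset (Finset α) :=
  (V1 ∪ V2 ∪ V3 ∪ V4).powerset.filter (fun e =>
    (e ∩ V1).card = 1 ∧ (e ∩ V2).card = 1 ∧ (e ∩ V3).card = 1 ∧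
    (e ∩ V4).card = 1 ∧ (e ∩ (W2 ∪ W3 ∪ W4)).Nonempty ∧
    (e ∩ ((V2 \ W2) ∪ (V3 \ W3) ∪ (V4 \ W4))).Nonempty)

/-- `W2, W3, W4` is a valid choice of partition sets for `H'₁,₃(n)`:
`Wi ⊆ Vi`, `|Wi| ∈ {⌊n/3⌋, ⌈n/3⌉}` and `|W2| + |W3| + |W4| = n`. -/
def IsWChoice {α : Type} [DecidableEq α] (n : ℕ) (V2 V3 V4 W2 W3 W4 : Finset α) :
    Prop :=
  W2 ⊆ V2 ∧ W3 ⊆ V3 ∧ W4 ⊆ V4 ∧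
  (W2.card = n / 3 ∨ W2.card = (n + 2) / 3) ∧
  (W3.card = n / 3 ∨ W3.card = (n + 2) / 3) ∧
  (W4.card = n / 3 ∨ W4.card = (n + 2) / 3) ∧
  W2.card + W3.card + W4.card = n

/-- `H` (with edge set `E`) is `ε`-close to `H'₁,₃(n)`: for some valid choice of
the partition sets `W2, W3, W4`, at most `ε n⁴` edges of `H'₁,₃(n)` are missing
from `E`. -/
def CloseToH13 {α : Type} [DecidableEq α] (ε : ℝ) (n : ℕ)
    (V1 V2 V3 V4 : Finset α) (E : Finset (Finset α)) : Prop :=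
  ∃ W2 W3 W4 : Finset α, IsWChoice n V2 V3 V4 W2 W3 W4 ∧
    (((H13edges V1 V2 V3 V4 W2 W3 W4) \ E).card : ℝ) ≤ ε * n ^ 4

section CloseExtremal
open scoped Classical

/-- `PM R SX SA SB SC`: perfect matching of `R` on the given vertex sets. -/
inductive PM {X A B C : Type} (R : X → A → B → C → Prop) :
    Finset X → Finset A → Finset B → Finset C → Prop
  | nil : PM R ∅ ∅ ∅ ∅
  | cons {SX SA SB SC} (x : X) (a : A) (b : B) (c : C) :
      R x a b c → x ∉ SX → a ∉ SA → b ∉ SB → c ∉ SC → PM R SX SA SB SC →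
      PM R (insert x SX) (insert a SA) (insert b SB) (insert c SC)

theorem PM.card_eq {X A B C : Type} {R : X → A → B → C → Prop} {SX : Finset X} {SA : Finset A}
    {SB : Finset B} {SC : Finset C} (h : PM R SX SA SB SC) :
    SA.card = SX.card ∧ SB.card = SX.card ∧ SC.card = SX.card := by
  induction h with
  | nil => simp
  | cons x a b c _ hx ha hb hc _ ih =>
    rw [Finset.card_insert_of_notMem hx, Finset.card_insert_of_notMem ha,
      Finset.card_insert_of_notMem hb, Finset.card_insert_of_notMem hc]
    omega

theorem PM.union {X A B C : Type} {R : X → A → B → C → Prop} {SX : Finset X} {SA : Finset A}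
    {SB : Finset B} {SC : Finset C} {TX : Finset X} {TA : Finset A}
    {TB : Finset B} {TC : Finset C} (h : PM R SX SA SB SC) (h' : PM R TX TA TB TC)
    (dX : Disjoint SX TX) (dA : Disjoint SA TA) (dB : Disjoint SB TB) (dC : Disjoint SC TC) :
    PM R (SX ∪ TX) (SA ∪ TA) (SB ∪ TB) (SC ∪ TC) := by
  induction h with
  | nil => simpa using h'
  | cons x a b c hR hx ha hb hc _ ih =>
    rw [Finset.disjoint_insert_left] at dX dA dB dC
    simp only [Finset.insert_union]
    refine PM.cons x a b c hR ?_ ?_ ?_ ?_ (ih dX.2 dA.2 dB.2 dC.2) <;> simp [*]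

theorem PM.of_family {X A B C ι : Type} {R : X → A → B → C → Prop} (s : Finset ι)
    (f1 : ι → X) (f2 : ι → A) (f3 : ι → B) (f4 : ι → C)
    (i1 : Function.Injective f1) (i2 : Function.Injective f2)
    (i3 : Function.Injective f3) (i4 : Function.Injective f4)
    (h : ∀ i ∈ s, R (f1 i) (f2 i) (f3 i) (f4 i)) :
    PM R (s.image f1) (s.image f2) (s.image f3) (s.image f4) := by
  induction s using Finset.induction_on with
  | empty => simpa using PM.nil
  | insert i s hi ih =>
    simp only [Finset.image_insert]
    refine PM.cons _ _ _ _ (h i (Finset.mem_insert_self _ _)) ?_ ?_ ?_ ?_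
      (ih fun j hj => h j (Finset.mem_insert_of_mem hj))
    · rw [i1.mem_finset_image]; exact hi
    · rw [i2.mem_finset_image]; exact hi
    · rw [i3.mem_finset_image]; exact hi
    · rw [i4.mem_finset_image]; exact hi

theorem card_filter_equiv {α β : Type} [Fintype α] [Fintype β] (e : α ≃ β) (p : β → Prop)
    [DecidablePred p] [DecidablePred (fun a => p (e a))] :
    (Finset.univ.filter (fun a => p (e a))).card = (Finset.univ.filter p).card := by
  refine Finset.card_bij (fun a _ => e a) ?_ ?_ ?_
  · simp
  · simp
  · intro b hb
    exact ⟨e.symm b, by simpa using hb, by simp⟩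

theorem four_cycle {ι : Type} (i j k l : ι) (hij : i ≠ j) (hik : i ≠ k) (hil : i ≠ l)
    (hjk : j ≠ k) (hjl : j ≠ l) (hkl : k ≠ l) :
    ∃ p : Equiv.Perm ι, p i = j ∧ p j = k ∧ p k = l ∧ p l = i ∧
      ∀ m, m ≠ i → m ≠ j → m ≠ k → m ≠ l → p m = m := by
  refine ⟨Equiv.swap i j * Equiv.swap j k * Equiv.swap k l, ?_, ?_, ?_, ?_, ?_⟩ <;>
    simp only [Equiv.Perm.mul_apply] <;> intros <;> simp only [Equiv.swap_apply_def] <;> grind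

theorem near_complete_fin {N d : ℕ} (Q : Fin N → Fin N → Fin N → Fin N → Prop)
    (h1 : ∀ i, (Finset.univ.filter
      (fun p : Fin N × Fin N × Fin N => ¬ Q i p.1 p.2.1 p.2.2)).card ≤ d)
    (h2 : ∀ i, (Finset.univ.filter
      (fun p : Fin N × Fin N × Fin N => ¬ Q p.1 i p.2.1 p.2.2)).card ≤ d)
    (h3 : ∀ i, (Finset.univ.filter
      (fun p : Fin N × Fin N × Fin N => ¬ Q p.1 p.2.1 i p.2.2)).card ≤ d)
    (h4 : ∀ i, (Finset.univ.filter
      (fun p : Fin N × Fin N × Fin N => ¬ Q p.1 p.2.1 p.2.2 i)).card ≤ d)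
    (hd : 4 * d + 6 * N ^ 2 < N ^ 3) :
    ∃ σ2 σ3 σ4 : Equiv.Perm (Fin N), ∀ i, Q i (σ2 i) (σ3 i) (σ4 i) := by
  obtain ⟨⟨σ2, σ3, σ4⟩, -, hmin⟩ := Finset.exists_min_image
    (Finset.univ : Finset (Equiv.Perm (Fin N) × Equiv.Perm (Fin N) × Equiv.Perm (Fin N)))
    (fun σ => (Finset.univ.filter (fun i => ¬ Q i (σ.1 i) (σ.2.1 i) (σ.2.2 i))).card)
    Finset.univ_nonempty
  refine ⟨σ2, σ3, σ4, ?_⟩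
  by_contra hcon
  push Not at hcon
  obtain ⟨i, hi⟩ := hcon
  -- the good triple
  have key : ∃ p : Fin N × Fin N × Fin N,
      Q i (σ2 p.1) (σ3 p.2.1) (σ4 p.2.2) ∧ Q p.1 (σ2 p.2.1) (σ3 p.2.2) (σ4 i) ∧
      Q p.2.1 (σ2 p.2.2) (σ3 i) (σ4 p.1) ∧ Q p.2.2 (σ2 i) (σ3 p.1) (σ4 p.2.1) ∧
      i ≠ p.1 ∧ i ≠ p.2.1 ∧ i ≠ p.2.2 ∧ p.1 ≠ p.2.1 ∧ p.1 ≠ p.2.2 ∧ p.2.1 ≠ p.2.2 := by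
    by_contra hno
    push Not at hno
    have c1 : (Finset.univ.filter (fun p : Fin N × Fin N × Fin N =>
        ¬ Q i (σ2 p.1) (σ3 p.2.1) (σ4 p.2.2))).card ≤ d := by
      refine le_trans (le_of_eq ?_) (h1 i)
      exact card_filter_equiv (Equiv.prodCongr σ2 (Equiv.prodCongr σ3 σ4))
        (fun p => ¬ Q i p.1 p.2.1 p.2.2)
    have c2 : (Finset.univ.filter (fun p : Fin N × Fin N × Fin N =>
        ¬ Q p.1 (σ2 p.2.1) (σ3 p.2.2) (σ4 i))).card ≤ d := by
      refine le_trans (le_of_eq ?_) (h4 (σ4 i))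
      exact card_filter_equiv (Equiv.prodCongr (Equiv.refl _) (Equiv.prodCongr σ2 σ3))
        (fun p => ¬ Q p.1 p.2.1 p.2.2 (σ4 i))
    have c3 : (Finset.univ.filter (fun p : Fin N × Fin N × Fin N =>
        ¬ Q p.2.1 (σ2 p.2.2) (σ3 i) (σ4 p.1))).card ≤ d := by
      refine le_trans (le_of_eq ?_) (h3 (σ3 i))
      let e : Fin N × Fin N × Fin N ≃ Fin N × Fin N × Fin N :=
        ⟨fun p => (p.2.1, p.2.2, p.1), fun p => (p.2.2, p.1, p.2.1), fun _ => rfl, fun _ => rfl⟩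
      exact card_filter_equiv
        (e.trans (Equiv.prodCongr (Equiv.refl _) (Equiv.prodCongr σ2 σ4)))
        (fun p => ¬ Q p.1 p.2.1 (σ3 i) p.2.2)
    have c4 : (Finset.univ.filter (fun p : Fin N × Fin N × Fin N =>
        ¬ Q p.2.2 (σ2 i) (σ3 p.1) (σ4 p.2.1))).card ≤ d := by
      refine le_trans (le_of_eq ?_) (h2 (σ2 i))
      let e : Fin N × Fin N × Fin N ≃ Fin N × Fin N × Fin N :=
        ⟨fun p => (p.2.2, p.1, p.2.1), fun p => (p.2.1, p.2.2, p.1), fun _ => rfl, fun _ => rfl⟩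
      exact card_filter_equiv
        (e.trans (Equiv.prodCongr (Equiv.refl _) (Equiv.prodCongr σ3 σ4)))
        (fun p => ¬ Q p.1 (σ2 i) p.2.1 p.2.2)
    -- the degenerate triples
    have inj (f : Fin N × Fin N → Fin N × Fin N × Fin N) :
        (Finset.univ.image f).card ≤ N ^ 2 := by
      refine Finset.card_image_le.trans ?_
      simp [sq]
    have hsub : (Finset.univ : Finset (Fin N × Fin N × Fin N)) ⊆
        (((Finset.univ.filter (fun p : Fin N × Fin N × Fin N =>
        ¬ Q i (σ2 p.1) (σ3 p.2.1) (σ4 p.2.2))) ∪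
        (Finset.univ.filter (fun p : Fin N × Fin N × Fin N =>
        ¬ Q p.1 (σ2 p.2.1) (σ3 p.2.2) (σ4 i)))) ∪
        ((Finset.univ.filter (fun p : Fin N × Fin N × Fin N =>
        ¬ Q p.2.1 (σ2 p.2.2) (σ3 i) (σ4 p.1))) ∪
        (Finset.univ.filter (fun p : Fin N × Fin N × Fin N =>
        ¬ Q p.2.2 (σ2 i) (σ3 p.1) (σ4 p.2.1))))) ∪
        (((Finset.univ.image (fun q : Fin N × Fin N => (i, q.1, q.2))) ∪
        ((Finset.univ.image (fun q : Fin N × Fin N => (q.1, i, q.2))) ∪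
        (Finset.univ.image (fun q : Fin N × Fin N => (q.1, q.2, i))))) ∪
        ((Finset.univ.image (fun q : Fin N × Fin N => (q.1, q.1, q.2))) ∪
        ((Finset.univ.image (fun q : Fin N × Fin N => (q.1, q.2, q.1))) ∪
        (Finset.univ.image (fun q : Fin N × Fin N => (q.1, q.2, q.2)))))) := by
      rintro ⟨j, k, l⟩ -
      have := hno (j, k, l)
      simp only [Finset.mem_union, Finset.mem_filter, Finset.mem_univ, true_and,
        Finset.mem_image, Prod.exists, Prod.mk.injEq, ne_eq] at this ⊢
      by_contra hc
      push Not at hc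
      obtain ⟨⟨⟨q1, q2⟩, q3, q4⟩, ⟨e1, e2, e3⟩, e4, e5, e6⟩ := hc
      have n1 : i ≠ j := fun h => e1 k l h rfl rfl
      have n2 : i ≠ k := fun h => e2 j l rfl h rfl
      have n3 : i ≠ l := fun h => e3 j k rfl rfl h
      have n4 : j ≠ k := fun h => e4 j l rfl h rfl
      have n5 : j ≠ l := fun h => e5 j k rfl rfl h
      have n6 : k ≠ l := fun h => e6 j k rfl rfl h
      exact n6 (this q1 q2 q3 q4 n1 n2 n3 n4 n5)
    have hc := Finset.card_le_card hsub
    have hN : (Finset.univ : Finset (Fin N × Fin N × Fin N)).card = N ^ 3 := by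
      simp; ring
    rw [hN] at hc
    have := hc.trans (Finset.card_union_le _ _)
    have b1 := inj (fun q : Fin N × Fin N => (i, q.1, q.2))
    have b2 := inj (fun q : Fin N × Fin N => (q.1, i, q.2))
    have b3 := inj (fun q : Fin N × Fin N => (q.1, q.2, i))
    have b4 := inj (fun q : Fin N × Fin N => (q.1, q.1, q.2))
    have b5 := inj (fun q : Fin N × Fin N => (q.1, q.2, q.1))
    have b6 := inj (fun q : Fin N × Fin N => (q.1, q.2, q.2))
    have u {S T : Finset (Fin N × Fin N × Fin N)} {x y : ℕ} (hS : S.card ≤ x) (hT : T.card ≤ y) :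
        (S ∪ T).card ≤ x + y := (Finset.card_union_le _ _).trans (Nat.add_le_add hS hT)
    have := hc.trans (u (u (u c1 c2) (u c3 c4)) (u (u b1 (u b2 b3)) (u b4 (u b5 b6))))
    omega
  obtain ⟨⟨j, k, l⟩, q1, q2, q3, q4, n1, n2, n3, n4, n5, n6⟩ := key
  simp only at q1 q2 q3 q4 n1 n2 n3 n4 n5 n6
  obtain ⟨π, pi, pj, pk, pl, pm⟩ := four_cycle i j k l n1 n2 n3 n4 n5 n6
  have := hmin (σ2 * π, σ3 * π * π, σ4 * π * π * π) (Finset.mem_univ _)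
  refine absurd this (not_le.mpr (Finset.card_lt_card ?_))
  rw [Finset.ssubset_iff_of_subset]
  · refine ⟨i, by simpa using hi, ?_⟩
    rw [Finset.mem_filter]
    simp [Equiv.Perm.mul_apply, pi, pj, pk, q1]
  · intro m
    rw [Finset.mem_filter, Finset.mem_filter]
    simp only [Finset.mem_univ, true_and, Equiv.Perm.mul_apply]
    intro hm
    by_cases m1 : m = i
    · subst m1; exact hi
    by_cases m2 : m = j
    · subst m2; simp [pi, pj, pk, pl, q2] at hm
    by_cases m3 : m = k
    · subst m3; simp [pi, pj, pk, pl, q3] at hm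
    by_cases m4 : m = l
    · subst m4; simp [pi, pj, pk, pl, q4] at hm
    simpa [pm m m1 m2 m3 m4] using hm

theorem near_complete {X A B C : Type} {R : X → A → B → C → Prop}
    (SX : Finset X) (SA : Finset A) (SB : Finset B) (SC : Finset C) (N d : ℕ)
    (cX : SX.card = N) (cA : SA.card = N) (cB : SB.card = N) (cC : SC.card = N)
    (h1 : ∀ x ∈ SX, ((SA ×ˢ SB ×ˢ SC).filter
      (fun p => ¬ R x p.1 p.2.1 p.2.2)).card ≤ d)
    (h2 : ∀ a ∈ SA, ((SX ×ˢ SB ×ˢ SC).filter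
      (fun p => ¬ R p.1 a p.2.1 p.2.2)).card ≤ d)
    (h3 : ∀ b ∈ SB, ((SX ×ˢ SA ×ˢ SC).filter
      (fun p => ¬ R p.1 p.2.1 b p.2.2)).card ≤ d)
    (h4 : ∀ c ∈ SC, ((SX ×ˢ SA ×ˢ SB).filter
      (fun p => ¬ R p.1 p.2.1 p.2.2 c)).card ≤ d)
    (hd : 4 * d + 6 * N ^ 2 < N ^ 3) : PM R SX SA SB SC := by
  let eX := (SX.equivFinOfCardEq cX).symm
  let eA := (SA.equivFinOfCardEq cA).symm
  let eB := (SB.equivFinOfCardEq cB).symm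
  let eC := (SC.equivFinOfCardEq cC).symm
  have gen {P Q T : Type} (S1 : Finset P) (S2 : Finset Q) (S3 : Finset T)
      (e1 : Fin N ≃ S1) (e2 : Fin N ≃ S2) (e3 : Fin N ≃ S3) (F : P × Q × T → Prop)
      [DecidablePred F] [DecidablePred (fun p : Fin N × Fin N × Fin N =>
        F (e1 p.1, e2 p.2.1, e3 p.2.2))] :
      (Finset.univ.filter (fun p : Fin N × Fin N × Fin N =>
        F (e1 p.1, e2 p.2.1, e3 p.2.2))).card ≤ ((S1 ×ˢ S2 ×ˢ S3).filter F).card := by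
    refine Finset.card_le_card_of_injOn
      (fun p => ((e1 p.1 : P), (e2 p.2.1 : Q), (e3 p.2.2 : T))) ?_ ?_
    · intro p hp
      simpa using hp
    · rintro ⟨p, q, t⟩ _ ⟨p', q', t'⟩ _ h
      simpa [Subtype.val_inj] using h
  obtain ⟨σ2, σ3, σ4, h⟩ := near_complete_fin
    (fun i j k l => R (eX i) (eA j) (eB k) (eC l)) (d := d)
    (fun i => (gen SA SB SC eA eB eC (fun p => ¬ R (eX i) p.1 p.2.1 p.2.2)).trans (h1 (eX i) (eX i).2))
    (fun i => (gen SX SB SC eX eB eC (fun p => ¬ R p.1 (eA i) p.2.1 p.2.2)).trans (h2 (eA i) (eA i).2))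
    (fun i => (gen SX SA SC eX eA eC (fun p => ¬ R p.1 p.2.1 (eB i) p.2.2)).trans (h3 (eB i) (eB i).2))
    (fun i => (gen SX SA SB eX eA eB (fun p => ¬ R p.1 p.2.1 p.2.2 (eC i))).trans (h4 (eC i) (eC i).2)) hd
  have := PM.of_family (R := R) (Finset.univ : Finset (Fin N)) (fun i => (eX i : X))
    (fun i => (eA (σ2 i) : A)) (fun i => (eB (σ3 i) : B)) (fun i => (eC (σ4 i) : C))
    (Subtype.val_injective.comp eX.injective)
    (Subtype.val_injective.comp (eA.injective.comp σ2.injective))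
    (Subtype.val_injective.comp (eB.injective.comp σ3.injective))
    (Subtype.val_injective.comp (eC.injective.comp σ4.injective)) (fun i _ => h i)
  have im {P : Type} (S : Finset P) (e : Fin N ≃ S) :
      Finset.univ.image (fun i => (e i : P)) = S := by
    ext p
    simp only [Finset.mem_image, Finset.mem_univ, true_and]
    constructor
    · rintro ⟨i, rfl⟩; exact (e i).2
    · intro hp; exact ⟨e.symm ⟨p, hp⟩, by simp⟩
  have e1 := im SX eX
  have e2 := im SA (σ2.trans eA)
  have e3 := im SB (σ3.trans eB)
  have e4 := im SC (σ4.trans eC)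
  simp only [Equiv.trans_apply] at e2 e3 e4
  rw [e1, e2, e3, e4] at this
  exact this

/-- Number of elements of a finite type satisfying `p`. -/
noncomputable def cnt {T : Type} [Fintype T] (p : T → Prop) : ℕ := (Finset.univ.filter p).card

theorem cnt_mono {T : Type} [Fintype T] {p q : T → Prop} (h : ∀ t, p t → q t) :
    cnt p ≤ cnt q :=
  Finset.card_le_card (Finset.monotone_filter_right _ (fun t _ => h t))

theorem cnt_or {T : Type} [Fintype T] (p q : T → Prop) :
    cnt (fun t => p t ∨ q t) ≤ cnt p + cnt q := by
  refine le_trans (Finset.card_le_card ?_) (Finset.card_union_le _ _)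
  intro t
  simp

theorem cnt_or3 {T : Type} [Fintype T] (p q r : T → Prop) :
    cnt (fun t => p t ∨ q t ∨ r t) ≤ cnt p + cnt q + cnt r := by
  have h1 := cnt_or p (fun t => q t ∨ r t)
  have h2 := cnt_or q r
  omega

theorem cnt_or_le {T : Type} [Fintype T] {p q : T → Prop} {m k : ℕ} (h1 : cnt p ≤ m)
    (h2 : cnt q ≤ k) : cnt (fun t => p t ∨ q t) ≤ m + k :=
  (cnt_or p q).trans (Nat.add_le_add h1 h2)

theorem cnt_add_not {T : Type} [Fintype T] (p : T → Prop) :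
    cnt p + cnt (fun t => ¬ p t) = Fintype.card T := by
  unfold cnt
  have := Finset.card_filter_add_card_filter_not (s := (Finset.univ : Finset T)) p
  rw [Finset.card_univ] at this
  convert this

theorem cnt_and_add {T : Type} [Fintype T] (p q : T → Prop) :
    cnt (fun t => p t ∧ q t) + cnt (fun t => p t ∧ ¬ q t) = cnt p := by
  unfold cnt
  have := Finset.card_filter_add_card_filter_not (s := (Finset.univ.filter p)) q
  rw [Finset.filter_filter, Finset.filter_filter] at this
  convert this

theorem cnt_true {T : Type} [Fintype T] : cnt (fun _ : T => True) = Fintype.card T := by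
  simp [cnt]

theorem cnt_mem {T : Type} [Fintype T] (S : Finset T) : cnt (fun t => t ∈ S) = S.card := by
  simp [cnt]

theorem cnt_notMem {T : Type} [Fintype T] (S : Finset T) :
    cnt (fun t => t ∉ S) = Fintype.card T - S.card := by
  have := cnt_add_not (fun t => t ∈ S)
  rw [cnt_mem] at this
  omega

theorem cnt_equiv {T T' : Type} [Fintype T] [Fintype T'] (e : T ≃ T') (p : T' → Prop) :
    cnt (fun t => p (e t)) = cnt p := card_filter_equiv e p

theorem cnt_fiber {T S : Type} [Fintype T] [Fintype S] (p : T × S → Prop) :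
    cnt p = ∑ t, cnt (fun s => p (t, s)) := by
  unfold cnt
  simp only [Finset.card_filter]
  rw [Fintype.sum_prod_type]

theorem cnt_fiber_le {T S : Type} [Fintype T] [Fintype S] (p : T × S → Prop) (d : ℕ)
    (h : ∀ t, cnt (fun s => p (t, s)) ≤ d) : cnt p ≤ Fintype.card T * d := by
  rw [cnt_fiber]
  refine (Finset.sum_le_card_nsmul Finset.univ _ d (fun t _ => h t)).trans ?_
  simp

theorem cnt_and_prod {T S : Type} [Fintype T] [Fintype S] (p : T → Prop) (q : S → Prop) :
    cnt (fun t : T × S => p t.1 ∧ q t.2) = cnt p * cnt q := by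
  unfold cnt
  rw [← Finset.card_product]
  congr 1
  ext ⟨t, s⟩
  simp

theorem cnt_fst {T S : Type} [Fintype T] [Fintype S] (p : T → Prop) :
    cnt (fun t : T × S => p t.1) = cnt p * Fintype.card S := by
  rw [← cnt_true (T := S), ← cnt_and_prod]; simp

theorem cnt_snd {T S : Type} [Fintype T] [Fintype S] (q : S → Prop) :
    cnt (fun t : T × S => q t.2) = Fintype.card T * cnt q := by
  rw [← cnt_true (T := T), ← cnt_and_prod]; simp

theorem cnt_fiber_on_le {T S : Type} [Fintype T] [Fintype S] (p : T × S → Prop) (U : Finset T)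
    (d : ℕ) (h : ∀ t ∈ U, cnt (fun s => p (t, s)) ≤ d) :
    cnt (fun t => t.1 ∈ U ∧ p t) ≤ U.card * d := by
  rw [cnt_fiber]
  calc _ ≤ ∑ t, (if t ∈ U then d else 0) := by
        refine Finset.sum_le_sum fun t _ => ?_
        split_ifs with ht
        · simpa [ht] using h t ht
        · simp [ht, cnt]
    _ = U.card * d := by simp

theorem markov {T S : Type} [Fintype T] [Fintype S] (p : T × S → Prop) (d : ℕ) :
    cnt (fun t => d < cnt (fun s => p (t, s))) * d ≤ cnt p := by
  rw [cnt_fiber p]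
  have : cnt (fun t => d < cnt (fun s => p (t, s))) * d =
      ∑ t, if d < cnt (fun s => p (t, s)) then d else 0 := by
    conv_lhs => rw [cnt, Finset.card_filter, Finset.sum_mul]
    refine Finset.sum_congr rfl fun t _ => ?_
    split_ifs <;> simp
  rw [this]
  refine Finset.sum_le_sum fun t _ => ?_
  split_ifs with h
  · exact h.le
  · exact Nat.zero_le _

/-- Exactly one of the three vertices is a `W`-vertex. -/
def ExOne {A B C : Type} (WA : Finset A) (WB : Finset B) (WC : Finset C) (a : A) (b : B) (c : C) :
    Prop :=
  (a ∈ WA ∧ b ∉ WB ∧ c ∉ WC) ∨ (a ∉ WA ∧ b ∈ WB ∧ c ∉ WC) ∨ (a ∉ WA ∧ b ∉ WB ∧ c ∈ WC)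

theorem near_complete' {X A B C : Type} [Fintype X] [Fintype A] [Fintype B] [Fintype C]
    {R : X → A → B → C → Prop}
    (SX : Finset X) (SA : Finset A) (SB : Finset B) (SC : Finset C) (N d : ℕ)
    (cX : SX.card = N) (cA : SA.card = N) (cB : SB.card = N) (cC : SC.card = N)
    (h1 : ∀ x ∈ SX, cnt (fun p : A × B × C => (p.1 ∈ SA ∧ p.2.1 ∈ SB ∧ p.2.2 ∈ SC) ∧
      ¬ R x p.1 p.2.1 p.2.2) ≤ d)
    (h2 : ∀ a ∈ SA, cnt (fun p : X × B × C => (p.1 ∈ SX ∧ p.2.1 ∈ SB ∧ p.2.2 ∈ SC) ∧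
      ¬ R p.1 a p.2.1 p.2.2) ≤ d)
    (h3 : ∀ b ∈ SB, cnt (fun p : X × A × C => (p.1 ∈ SX ∧ p.2.1 ∈ SA ∧ p.2.2 ∈ SC) ∧
      ¬ R p.1 p.2.1 b p.2.2) ≤ d)
    (h4 : ∀ c ∈ SC, cnt (fun p : X × A × B => (p.1 ∈ SX ∧ p.2.1 ∈ SA ∧ p.2.2 ∈ SB) ∧
      ¬ R p.1 p.2.1 p.2.2 c) ≤ d)
    (hd : 4 * d + 6 * N ^ 2 < N ^ 3) : PM R SX SA SB SC := by
  refine near_complete SX SA SB SC N d cX cA cB cC ?_ ?_ ?_ ?_ hd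
  · intro x hx
    refine le_trans (Finset.card_le_card ?_) (h1 x hx)
    intro p; simp
  · intro x hx
    refine le_trans (Finset.card_le_card ?_) (h2 x hx)
    intro p; simp
  · intro x hx
    refine le_trans (Finset.card_le_card ?_) (h3 x hx)
    intro p; simp
  · intro x hx
    refine le_trans (Finset.card_le_card ?_) (h4 x hx)
    intro p; simp

theorem split_set {T : Type} (S : Finset T) (m k : ℕ) (h : S.card = m + k) :
    ∃ S1 S2 : Finset T, S1 ∪ S2 = S ∧ Disjoint S1 S2 ∧ S1.card = m ∧ S2.card = k := by
  obtain ⟨S1, h1, h2⟩ := Finset.exists_subset_card_eq (s := S) (n := m) (by omega)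
  refine ⟨S1, S \ S1, Finset.union_sdiff_of_subset h1, Finset.disjoint_sdiff, h2, ?_⟩
  rw [Finset.card_sdiff_of_subset h1]; omega

theorem split_PM {X A B C : Type} [Fintype X] [Fintype A] [Fintype B] [Fintype C]
    {R : X → A → B → C → Prop}
    (SX : Finset X) (SA : Finset A) (SB : Finset B) (SC : Finset C)
    (WA : Finset A) (WB : Finset B) (WC : Finset C) (N d : ℕ)
    (cX : SX.card = N) (cA : SA.card = N) (cB : SB.card = N) (cC : SC.card = N)
    (sA : WA ⊆ SA) (sB : WB ⊆ SB) (sC : WC ⊆ SC) (hsum : WA.card + WB.card + WC.card = N)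
    (h1 : ∀ x ∈ SX, cnt (fun p : A × B × C => (p.1 ∈ SA ∧ p.2.1 ∈ SB ∧ p.2.2 ∈ SC) ∧
      ExOne WA WB WC p.1 p.2.1 p.2.2 ∧ ¬ R x p.1 p.2.1 p.2.2) ≤ d)
    (h2 : ∀ a ∈ SA, cnt (fun p : X × B × C => (p.1 ∈ SX ∧ p.2.1 ∈ SB ∧ p.2.2 ∈ SC) ∧
      ExOne WA WB WC a p.2.1 p.2.2 ∧ ¬ R p.1 a p.2.1 p.2.2) ≤ d)
    (h3 : ∀ b ∈ SB, cnt (fun p : X × A × C => (p.1 ∈ SX ∧ p.2.1 ∈ SA ∧ p.2.2 ∈ SC) ∧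
      ExOne WA WB WC p.2.1 b p.2.2 ∧ ¬ R p.1 p.2.1 b p.2.2) ≤ d)
    (h4 : ∀ c ∈ SC, cnt (fun p : X × A × B => (p.1 ∈ SX ∧ p.2.1 ∈ SA ∧ p.2.2 ∈ SB) ∧
      ExOne WA WB WC p.2.1 p.2.2 c ∧ ¬ R p.1 p.2.1 p.2.2 c) ≤ d)
    (hdA : 4 * d + 6 * WA.card ^ 2 < WA.card ^ 3)
    (hdB : 4 * d + 6 * WB.card ^ 2 < WB.card ^ 3)
    (hdC : 4 * d + 6 * WC.card ^ 2 < WC.card ^ 3) : PM R SX SA SB SC := by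
  obtain ⟨XA, XR, uX, dX, cXA, cXR⟩ := split_set SX WA.card (WB.card + WC.card) (by omega)
  obtain ⟨XB, XC, uX', dX', cXB, cXC⟩ := split_set XR WB.card WC.card cXR
  obtain ⟨AB, AC, uA, dA, cAB, cAC⟩ := split_set (SA \ WA) WB.card WC.card
    (by rw [Finset.card_sdiff_of_subset sA]; omega)
  obtain ⟨BA, BC, uB, dB, cBA, cBC⟩ := split_set (SB \ WB) WA.card WC.card
    (by rw [Finset.card_sdiff_of_subset sB]; omega)
  obtain ⟨CA, CB, uC, dC, cCA, cCB⟩ := split_set (SC \ WC) WA.card WB.card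
    (by rw [Finset.card_sdiff_of_subset sC]; omega)
  have mX : ∀ x, x ∈ SX ↔ x ∈ XA ∨ x ∈ XB ∨ x ∈ XC := by
    intro x; rw [← uX, ← uX']; simp
  have mA : ∀ x, (x ∈ SA ∧ x ∉ WA) ↔ x ∈ AB ∨ x ∈ AC := by
    intro x; rw [← Finset.mem_sdiff, ← uA]; simp
  have mB : ∀ x, (x ∈ SB ∧ x ∉ WB) ↔ x ∈ BA ∨ x ∈ BC := by
    intro x; rw [← Finset.mem_sdiff, ← uB]; simp
  have mC : ∀ x, (x ∈ SC ∧ x ∉ WC) ↔ x ∈ CA ∨ x ∈ CB := by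
    intro x; rw [← Finset.mem_sdiff, ← uC]; simp
  have mA' : ∀ x, x ∈ WA → x ∈ SA := fun x h => sA h
  have mB' : ∀ x, x ∈ WB → x ∈ SB := fun x h => sB h
  have mC' : ∀ x, x ∈ WC → x ∈ SC := fun x h => sC h
  have p1 : PM R XA WA BA CA := by
    refine near_complete' XA WA BA CA WA.card d cXA rfl cBA cCA ?_ ?_ ?_ ?_ hdA
    · intro x hx
      refine (cnt_mono ?_).trans (h1 x (by grind))
      unfold ExOne; grind
    · intro x hx
      refine (cnt_mono ?_).trans (h2 x (by grind))
      unfold ExOne; grind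
    · intro x hx
      refine (cnt_mono ?_).trans (h3 x (by grind))
      unfold ExOne; grind
    · intro x hx
      refine (cnt_mono ?_).trans (h4 x (by grind))
      unfold ExOne; grind
  have p2 : PM R XB AB WB CB := by
    refine near_complete' XB AB WB CB WB.card d cXB cAB rfl cCB ?_ ?_ ?_ ?_ hdB
    · intro x hx
      refine (cnt_mono ?_).trans (h1 x (by grind))
      unfold ExOne; grind
    · intro x hx
      refine (cnt_mono ?_).trans (h2 x (by grind))
      unfold ExOne; grind
    · intro x hx
      refine (cnt_mono ?_).trans (h3 x (by grind))
      unfold ExOne; grind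
    · intro x hx
      refine (cnt_mono ?_).trans (h4 x (by grind))
      unfold ExOne; grind
  have p3 : PM R XC AC BC WC := by
    refine near_complete' XC AC BC WC WC.card d cXC cAC cBC rfl ?_ ?_ ?_ ?_ hdC
    · intro x hx
      refine (cnt_mono ?_).trans (h1 x (by grind))
      unfold ExOne; grind
    · intro x hx
      refine (cnt_mono ?_).trans (h2 x (by grind))
      unfold ExOne; grind
    · intro x hx
      refine (cnt_mono ?_).trans (h3 x (by grind))
      unfold ExOne; grind
    · intro x hx
      refine (cnt_mono ?_).trans (h4 x (by grind))
      unfold ExOne; grind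
  rw [Finset.disjoint_left] at dX dX' dA dB dC
  have mXR : ∀ x, x ∈ XR ↔ x ∈ XB ∨ x ∈ XC := by
    intro x; rw [← uX']; simp
  have q1 := p2.union p3 (Finset.disjoint_left.2 (by grind)) (Finset.disjoint_left.2 (by grind))
    (Finset.disjoint_left.2 (by grind)) (Finset.disjoint_left.2 (by grind))
  have q2 := p1.union q1 (Finset.disjoint_left.2 (by grind)) (Finset.disjoint_left.2 (by grind))
    (Finset.disjoint_left.2 (by grind)) (Finset.disjoint_left.2 (by grind))
  convert q2 using 1
  · ext x; grind
  · ext x; grind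
  · ext x; grind
  · ext x; grind

theorem greedy {σ τ : Type} (size : σ → ℕ) (good : σ → Prop) (cov : τ → σ → Prop) (k : ℕ)
    (T : Finset τ)
    (hstep : ∀ s, ∀ v ∈ T, good s → size s < k → ∃ s', good s' ∧ size s' ≤ size s + 1 ∧ cov v s' ∧
      ∀ v', cov v' s → cov v' s')
    (s0 : σ) (h0 : good s0) (hk : size s0 + T.card ≤ k) :
    ∃ s', good s' ∧ size s' ≤ size s0 + T.card ∧ ∀ v ∈ T, cov v s' := by
  induction T using Finset.induction_on with
  | empty => exact ⟨s0, h0, by simp, by simp⟩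
  | insert v T hv ih =>
    rw [Finset.card_insert_of_notMem hv] at hk ⊢
    obtain ⟨s1, g1, z1, c1⟩ := ih (fun s v hv => hstep s v (Finset.mem_insert_of_mem hv)) (by omega)
    obtain ⟨s2, g2, z2, c2, m2⟩ := hstep s1 v (Finset.mem_insert_self _ _) g1 (by omega)
    refine ⟨s2, g2, by omega, ?_⟩
    intro w hw
    rcases Finset.mem_insert.1 hw with rfl | hw
    · exact c2
    · exact m2 _ (c1 _ hw)

/-- The threshold for the number of missing pairs. -/
def Mrs (r s : ℕ) : ℕ :=
  if s = 1 then (2 * r + 1) ^ 2 else if s = 2 then (2 * r + 3) * (2 * r + 1)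
  else (2 * r + 3) * (2 * r + 2)

theorem arith_sorted (r s t a b c : ℕ) (h1 : 1 ≤ s) (h3 : s ≤ 3) (ht : 1 ≤ t)
    (hsum : a + b + c = 2 * (3 * r + s) + t) (hab : b ≤ a) (hbc : c ≤ b) (hb : 3 * r ≤ 2 * b)
    (hr : 10 ≤ r) :
    (s = 2 ∧ t = 2 ∧ a = 2 * r + 2 ∧ b = 2 * r + 2 ∧ c = 2 * r + 2) ∨
    6 * Mrs r s + (t - 1) * r ≤ 6 * (a * b) := by
  obtain ⟨t, rfl⟩ : ∃ t', t = t' + 1 := ⟨t - 1, by omega⟩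
  simp only [Nat.add_sub_cancel]
  obtain rfl | rfl | rfl : s = 1 ∨ s = 2 ∨ s = 3 := by omega
  · right
    simp only [Mrs]; norm_num
    by_cases h : b ≤ 2 * r + 1
    · obtain ⟨k, hk⟩ := Nat.exists_eq_add_of_le h
      have ha : 2 * r + 1 + 2 * k + t ≤ a := by omega
      have : (2 * r + 1 + 2 * k + t) * b ≤ a * b := Nat.mul_le_mul_right _ ha
      have hk2 : 2 * k ≤ r + 2 := by omega
      zify at *
      have hb' : (b : ℤ) = 2 * r + 1 - k := by linarith
      rw [hb'] at this ⊢
      nlinarith [mul_nonneg (Int.natCast_nonneg k) (by linarith : (0:ℤ) ≤ 2 * r + 1 - 2 * k),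
        mul_nonneg (Int.natCast_nonneg t) (by linarith : (0:ℤ) ≤ 2 * r + 1 - k - r)]
    · have h3a : 6 * r + 3 + t ≤ 3 * a := by omega
      nlinarith [Nat.mul_le_mul h3a (by omega : 2 * r + 1 ≤ b)]
  · simp only [Mrs]; norm_num
    by_cases h : b ≤ 2 * r + 1
    · right
      obtain ⟨k, hk⟩ := Nat.exists_eq_add_of_le h
      have ha : 2 * r + 3 + 2 * k + t ≤ a := by omega
      have : (2 * r + 3 + 2 * k + t) * b ≤ a * b := Nat.mul_le_mul_right _ ha
      have hk2 : 2 * k ≤ r + 2 := by omega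
      zify at *
      have hb' : (b : ℤ) = 2 * r + 1 - k := by linarith
      rw [hb'] at this ⊢
      nlinarith [mul_nonneg (Int.natCast_nonneg k) (by linarith : (0:ℤ) ≤ 2 * r - 1 - 2 * k),
        mul_nonneg (Int.natCast_nonneg t) (by linarith : (0:ℤ) ≤ 2 * r + 1 - k - r)]
    · by_cases hsp : t = 1 ∧ a = 2 * r + 2
      · left; omega
      · right
        rcases (by omega : t = 0 ∨ t = 1 ∨ 2 ≤ t) with rfl | rfl | ht2
        · nlinarith [Nat.mul_le_mul (by omega : 2 * r + 2 ≤ a) (by omega : 2 * r + 2 ≤ b)]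
        · nlinarith [Nat.mul_le_mul (by omega : 2 * r + 3 ≤ a) (by omega : 2 * r + 2 ≤ b)]
        · obtain ⟨u, rfl⟩ := Nat.exists_eq_add_of_le ht2
          nlinarith [Nat.mul_le_mul (by omega : 6 * r + 6 + u + 1 ≤ 3 * a)
            (by omega : 2 * r + 2 ≤ b)]
  · right
    simp only [Mrs]; norm_num
    by_cases h : b ≤ 2 * r + 2
    · obtain ⟨k, hk⟩ := Nat.exists_eq_add_of_le h
      have ha : 2 * r + 3 + 2 * k + t ≤ a := by omega
      have : (2 * r + 3 + 2 * k + t) * b ≤ a * b := Nat.mul_le_mul_right _ ha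
      have hk2 : 2 * k ≤ r + 4 := by omega
      zify at *
      have hb' : (b : ℤ) = 2 * r + 2 - k := by linarith
      rw [hb'] at this ⊢
      nlinarith [mul_nonneg (Int.natCast_nonneg k) (by linarith : (0:ℤ) ≤ 2 * r + 1 - 2 * k),
        mul_nonneg (Int.natCast_nonneg t) (by linarith : (0:ℤ) ≤ 2 * r + 2 - k - r)]
    · rcases (by omega : t ≤ 3 ∨ 3 ≤ t) with ht2 | ht2
      · nlinarith [Nat.mul_le_mul (by omega : 2 * r + 3 ≤ a) (by omega : 2 * r + 3 ≤ b),
          Nat.mul_le_mul_right r ht2]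
      · nlinarith [Nat.mul_le_mul (by omega : 6 * r + 7 + t ≤ 3 * a) (by omega : 2 * r + 3 ≤ b)]

/-- The two-edge special case, one symmetric half. -/
theorem two_edges_half {A B C : Type} (L L' : A → B → C → Prop) (hA : ∃ a a' a'' : A, a ≠ a' ∧ a ≠ a'' ∧ a' ≠ a'')
    (hB : ∀ b b' : B, ∃ b'', b'' ≠ b ∧ b'' ≠ b')
    (LB : ∀ b, ∃ a c a' c', (a, c) ≠ (a', c') ∧ L a b c ∧ L a' b c')
    (LA' : ∀ a, ∃ b c b' c', (b, c) ≠ (b', c') ∧ L' a b c ∧ L' a b' c')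
    (hx : ∀ a b c a' b' c', L a b c → L' a' b' c' → a = a' ∨ b = b' ∨ c = c')
    (a1 : A) (b : B) (c1 c2 : C) (hc : c1 ≠ c2) (h1 : L' a1 b c1) (h2 : L' a1 b c2) : False := by
  have key : ∀ a' b' c', L a' b' c' → a' = a1 ∨ b' = b := by
    intro a' b' c' h
    have := hx _ _ _ _ _ _ h h1
    have := hx _ _ _ _ _ _ h h2
    grind
  obtain ⟨b', hb', -⟩ := hB b b
  obtain ⟨b'', hb'', hb2⟩ := hB b b'
  obtain ⟨p, c, p', c', hne, e1, e2⟩ := LB b'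
  obtain ⟨q, c'', -, -, -, e3, -⟩ := LB b''
  have : p = a1 := (key _ _ _ e1).resolve_right hb'
  have : p' = a1 := (key _ _ _ e2).resolve_right hb'
  have : q = a1 := (key _ _ _ e3).resolve_right hb''
  subst p p' q
  have hcc : c ≠ c' := by rintro rfl; exact hne rfl
  obtain ⟨a3, ha3⟩ : ∃ a3, a3 ≠ a1 := by
    obtain ⟨x, y, z, h, -⟩ := hA
    by_cases hx1 : x = a1
    · exact ⟨y, by rintro rfl; exact h hx1⟩
    · exact ⟨x, hx1⟩
  have key2 : ∀ β γ, L' a3 β γ → β = b' ∧ γ = c'' := by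
    intro β γ h
    have i1 := hx _ _ _ _ _ _ e1 h
    have i2 := hx _ _ _ _ _ _ e2 h
    have i3 := hx _ _ _ _ _ _ e3 h
    grind
  obtain ⟨β, γ, β', γ', hne, f1, f2⟩ := LA' a3
  have := key2 _ _ f1
  have := key2 _ _ f2
  grind

theorem two_edges {A B C : Type} (L L' : A → B → C → Prop)
    (hA : ∃ a a' a'' : A, a ≠ a' ∧ a ≠ a'' ∧ a' ≠ a'')
    (hB : ∀ b b' : B, ∃ b'', b'' ≠ b ∧ b'' ≠ b') (hC : ∀ b b' : C, ∃ b'', b'' ≠ b ∧ b'' ≠ b')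
    (LA : ∀ a, ∃ b c b' c', (b, c) ≠ (b', c') ∧ L a b c ∧ L a b' c')
    (LB : ∀ b, ∃ a c a' c', (a, c) ≠ (a', c') ∧ L a b c ∧ L a' b c')
    (LC : ∀ c, ∃ a b a' b', (a, b) ≠ (a', b') ∧ L a b c ∧ L a' b' c)
    (LA' : ∀ a, ∃ b c b' c', (b, c) ≠ (b', c') ∧ L' a b c ∧ L' a b' c')
    (LB' : ∀ b, ∃ a c, L' a b c) :
    ∃ a b c a' b' c', L a b c ∧ L' a' b' c' ∧ a ≠ a' ∧ b ≠ b' ∧ c ≠ c' := by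
  by_contra hcon
  have hx : ∀ a b c a' b' c', L a b c → L' a' b' c' → a = a' ∨ b = b' ∨ c = c' := by
    intro a b c a' b' c' h h'
    by_contra hne
    push Not at hne
    exact hcon ⟨a, b, c, a', b', c', h, h', hne.1, hne.2.1, hne.2.2⟩
  obtain ⟨a1, a2, a3, h12, h13, h23⟩ := hA
  obtain ⟨b1, c1, b2, c2, hne, e1, e2⟩ := LA' a1
  by_cases hb : b1 = b2
  · subst hb
    exact two_edges_half L L' ⟨a1, a2, a3, h12, h13, h23⟩ hB LB LA' hx a1 b1 c1 c2
      (by rintro rfl; exact hne rfl) e1 e2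
  by_cases hc : c1 = c2
  · subst hc
    refine two_edges_half (fun a c b => L a b c) (fun a c b => L' a b c)
      ⟨a1, a2, a3, h12, h13, h23⟩ hC LC ?_ ?_ a1 c1 b1 b2 hb e1 e2
    · intro a
      obtain ⟨b, c, b', c', h, h', h''⟩ := LA' a
      exact ⟨c, b, c', b', by grind, h', h''⟩
    · intro a b c a' b' c' h h'
      have := hx _ _ _ _ _ _ h h'
      tauto
  have key : ∀ a, a ≠ a1 → L a b1 c2 ∧ L a b2 c1 := by
    intro a ha
    have k2 : ∀ β γ, L a β γ → (β = b1 ∧ γ = c2) ∨ (β = b2 ∧ γ = c1) := by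
      intro β γ h
      have := hx _ _ _ _ _ _ h e1
      have := hx _ _ _ _ _ _ h e2
      grind
    obtain ⟨β, γ, β', γ', hne, f1, f2⟩ := LA a
    have := k2 _ _ f1
    have := k2 _ _ f2
    grind
  obtain ⟨b3, hb31, hb32⟩ := hB b1 b2
  obtain ⟨a, c, h⟩ := LB' b3
  obtain ⟨a', ha', ha''⟩ : ∃ a', a' ≠ a1 ∧ a' ≠ a := by
    by_cases h : a = a2
    · exact ⟨a3, h13.symm, by rw [h]; exact h23.symm⟩
    · exact ⟨a2, h12.symm, fun h' => h h'.symm⟩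
  have i1 := hx _ _ _ _ _ _ (key a' ha').1 h
  have i2 := hx _ _ _ _ _ _ (key a' ha').2 h
  grind

theorem cnt_fiber_on_ge {T S : Type} [Fintype T] [Fintype S] (p : T × S → Prop) (U : Finset T)
    (d : ℕ) (h : ∀ t ∈ U, d ≤ cnt (fun s => p (t, s))) :
    U.card * d ≤ cnt (fun t => t.1 ∈ U ∧ p t) := by
  rw [cnt_fiber]
  calc U.card * d = ∑ t, (if t ∈ U then d else 0) := by simp
    _ ≤ _ := by
        refine Finset.sum_le_sum fun t _ => ?_
        split_ifs with ht
        · simpa [ht] using h t ht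
        · simp

theorem pair_lower {B C : Type} [Fintype B] [Fintype C] (Q : B → C → Prop) (UB : Finset B)
    (UC : Finset C) (M : ℕ) (h : cnt (fun p : B × C => ¬ Q p.1 p.2) < M) :
    UB.card * UC.card + 1 ≤
      cnt (fun p : B × C => (p.1 ∈ UB ∧ p.2 ∈ UC) ∧ Q p.1 p.2) + M := by
  have h1 := cnt_and_add (fun p : B × C => p.1 ∈ UB ∧ p.2 ∈ UC) (fun p => Q p.1 p.2)
  have h2 : cnt (fun p : B × C => p.1 ∈ UB ∧ p.2 ∈ UC) = UB.card * UC.card := by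
    rw [cnt_and_prod (fun b => b ∈ UB) (fun c => c ∈ UC), cnt_mem, cnt_mem]
  have h3 : cnt (fun p : B × C => (p.1 ∈ UB ∧ p.2 ∈ UC) ∧ ¬ Q p.1 p.2) ≤
    cnt (fun p : B × C => ¬ Q p.1 p.2) := cnt_mono (fun p hp => hp.2)
  omega

theorem triple_lower {A B C : Type} [Fintype A] [Fintype B] [Fintype C] (L : A → B → C → Prop)
    (UA : Finset A) (UB : Finset B) (UC : Finset C) (M k : ℕ)
    (h : ∀ a, cnt (fun p : B × C => ¬ L a p.1 p.2) < M)
    (hk : 6 * M + k ≤ 6 * (UB.card * UC.card)) :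
    UA.card * (k + 6) ≤ 6 * cnt (fun p : A × B × C => (p.1 ∈ UA ∧ p.2.1 ∈ UB ∧ p.2.2 ∈ UC) ∧
      L p.1 p.2.1 p.2.2) := by
  have h1 := cnt_fiber_on_ge (fun p : A × B × C => (p.2.1 ∈ UB ∧ p.2.2 ∈ UC) ∧
      L p.1 p.2.1 p.2.2) UA (UB.card * UC.card + 1 - M) (by
    intro a _
    have := pair_lower (fun b c => L a b c) UB UC M (h a)
    simp only at this ⊢
    omega)
  have h2 : cnt (fun p : A × B × C => p.1 ∈ UA ∧ (p.2.1 ∈ UB ∧ p.2.2 ∈ UC) ∧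
      L p.1 p.2.1 p.2.2) ≤ cnt (fun p : A × B × C => (p.1 ∈ UA ∧ p.2.1 ∈ UB ∧ p.2.2 ∈ UC) ∧
      L p.1 p.2.1 p.2.2) := cnt_mono (fun p hp => ⟨⟨hp.1, hp.2.1⟩, hp.2.2⟩)
  have h3 : k + 6 ≤ 6 * (UB.card * UC.card + 1 - M) := by omega
  calc UA.card * (k + 6) ≤ UA.card * (6 * (UB.card * UC.card + 1 - M)) :=
        Nat.mul_le_mul_left _ h3
    _ = 6 * (UA.card * (UB.card * UC.card + 1 - M)) := by ring
    _ ≤ _ := by omega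

theorem arith_any (r s t a b c : ℕ) (h1 : 1 ≤ s) (h3 : s ≤ 3) (ht : 1 ≤ t)
    (hsum : a + b + c = 2 * (3 * r + s) + t) (ha : 3 * r ≤ 2 * a) (hb : 3 * r ≤ 2 * b)
    (hc : 3 * r ≤ 2 * c) (hr : 10 ≤ r) :
    (s = 2 ∧ t = 2 ∧ a = 2 * r + 2 ∧ b = 2 * r + 2 ∧ c = 2 * r + 2) ∨
    6 * Mrs r s + (t - 1) * r ≤ 6 * (b * c) ∨ 6 * Mrs r s + (t - 1) * r ≤ 6 * (a * c) ∨
    6 * Mrs r s + (t - 1) * r ≤ 6 * (a * b) := by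
  rcases le_total a b with hab | hab <;> rcases le_total b c with hbc | hbc <;>
    rcases le_total a c with hac | hac
  · have := arith_sorted r s t c b a h1 h3 ht (by omega) hbc hab hb hr
    rw [mul_comm c b] at this; omega
  · have := arith_sorted r s t c b a h1 h3 ht (by omega) hbc hab hb hr
    rw [mul_comm c b] at this; omega
  · have := arith_sorted r s t b c a h1 h3 ht (by omega) hbc hac hc hr
    omega
  · have := arith_sorted r s t b a c h1 h3 ht (by omega) hab hac ha hr
    rw [mul_comm b a] at this; omega
  · have := arith_sorted r s t c a b h1 h3 ht (by omega) hac hab ha hr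
    rw [mul_comm c a] at this; omega
  · have := arith_sorted r s t a c b h1 h3 ht (by omega) hac hbc hc hr
    omega
  · have := arith_sorted r s t a b c h1 h3 ht (by omega) hab hbc hb hr
    omega
  · have := arith_sorted r s t a b c h1 h3 ht (by omega) hab hbc hb hr
    omega

theorem two_of_cnt {B C : Type} [Fintype B] [Fintype C] (UB : Finset B) (UC : Finset C)
    (Q : B → C → Prop)
    (h : 2 ≤ cnt (fun p : B × C => (p.1 ∈ UB ∧ p.2 ∈ UC) ∧ Q p.1 p.2)) :
    ∃ (b : UB) (c : UC) (b' : UB) (c' : UC), (b, c) ≠ (b', c') ∧ Q b c ∧ Q b' c' := by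
  obtain ⟨⟨b, c⟩, h1, ⟨b', c'⟩, h2, hne⟩ := Finset.one_lt_card.1 h
  simp only [Finset.mem_filter, Finset.mem_univ, true_and] at h1 h2
  refine ⟨⟨b, h1.1.1⟩, ⟨c, h1.1.2⟩, ⟨b', h2.1.1⟩, ⟨c', h2.1.2⟩, ?_, h1.2, h2.2⟩
  simpa using hne

theorem third_of_card {B : Type} (U : Finset B) (h : 3 ≤ U.card) (b b' : U) :
    ∃ b'' : U, b'' ≠ b ∧ b'' ≠ b' := by
  have : ∃ x ∈ (Finset.univ : Finset U), x ∉ ({b, b'} : Finset U) := by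
    by_contra hcon
    push Not at hcon
    have h1 := Finset.card_le_card (show (Finset.univ : Finset U) ⊆ {b, b'} from hcon)
    have h2 := Finset.card_le_two (a := b) (b := b')
    simp at h1
    omega
  obtain ⟨x, -, hx⟩ := this
  simp at hx
  exact ⟨x, hx⟩

/-- The crux: disjoint `UUU`-edges from the exact degree condition. -/
theorem crux {X A B C : Type} [Fintype X] [Fintype A] [Fintype B] [Fintype C]
    {R : X → A → B → C → Prop} (UA : Finset A) (UB : Finset B) (UC : Finset C)
    (n r s t g : ℕ) (hn : n = 3 * r + s) (hs1 : 1 ≤ s) (hs3 : s ≤ 3) (hr : 10 ≤ r)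
    (cX : Fintype.card X = n)
    (hsum : UA.card + UB.card + UC.card = 2 * n + t)
    (uA : 3 * r ≤ 2 * UA.card) (uB : 3 * r ≤ 2 * UB.card) (uC : 3 * r ≤ 2 * UC.card)
    (htn : 2 * t ≤ n) (hg : 1000 * g ≤ n ^ 3)
    (gA : ∀ a ∈ UA, cnt (fun p : X × B × C => (p.2.1 ∈ UB ∧ p.2.2 ∈ UC) ∧
      R p.1 a p.2.1 p.2.2) ≤ g)
    (gB : ∀ b ∈ UB, cnt (fun p : X × A × C => (p.2.1 ∈ UA ∧ p.2.2 ∈ UC) ∧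
      R p.1 p.2.1 b p.2.2) ≤ g)
    (gC : ∀ c ∈ UC, cnt (fun p : X × A × B => (p.2.1 ∈ UA ∧ p.2.2 ∈ UB) ∧
      R p.1 p.2.1 p.2.2 c) ≤ g)
    (dA : ∀ x a, cnt (fun p : B × C => ¬ R x a p.1 p.2) < Mrs r s)
    (dB : ∀ x b, cnt (fun p : A × C => ¬ R x p.1 b p.2) < Mrs r s)
    (dC : ∀ x c, cnt (fun p : A × B => ¬ R x p.1 p.2 c) < Mrs r s) :
    ∃ SX SA SB SC, PM R SX SA SB SC ∧ SX.card = t ∧ SA ⊆ UA ∧ SB ⊆ UB ∧ SC ⊆ UC := by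
  rcases Nat.eq_zero_or_pos t with rfl | ht
  · exact ⟨∅, ∅, ∅, ∅, PM.nil, by simp⟩
  rcases arith_any r s t UA.card UB.card UC.card hs1 hs3 ht (by omega) uA uB uC hr with
    ⟨rfl, rfl, eA, eB, eC⟩ | hcase
  · -- special case
    have hX : 1 < Fintype.card X := by omega
    obtain ⟨x, x', hxx⟩ := Fintype.one_lt_card_iff.1 hX
    have hM : (2 * r + 2) * (2 * r + 2) = Mrs r 2 + 1 := by simp [Mrs]; ring
    have tA : ∀ y : X, ∀ a : UA, ∃ (b : UB) (c : UC) (b' : UB) (c' : UC),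
        (b, c) ≠ (b', c') ∧ R y a b c ∧ R y a b' c' := by
      intro y a
      have := pair_lower (fun b c => R y a b c) UB UC _ (dA y a)
      rw [eB, eC, hM] at this
      exact two_of_cnt UB UC _ (by omega)
    have tB : ∀ y : X, ∀ a : UB, ∃ (b : UA) (c : UC) (b' : UA) (c' : UC),
        (b, c) ≠ (b', c') ∧ R y b a c ∧ R y b' a c' := by
      intro y a
      have := pair_lower (fun b c => R y b a c) UA UC _ (dB y a)
      rw [eA, eC, hM] at this
      exact two_of_cnt UA UC (fun b c => R y b a c) (by omega)
    have tC : ∀ y : X, ∀ a : UC, ∃ (b : UA) (c : UB) (b' : UA) (c' : UB),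
        (b, c) ≠ (b', c') ∧ R y b c a ∧ R y b' c' a := by
      intro y a
      have := pair_lower (fun b c => R y b c a) UA UB _ (dC y a)
      rw [eA, eB, hM] at this
      exact two_of_cnt UA UB (fun b c => R y b c a) (by omega)
    obtain ⟨a, b, c, a', b', c', h, h', na, nb, nc⟩ := two_edges
      (fun (a : UA) (b : UB) (c : UC) => R x a b c) (fun a b c => R x' a b c)
      (by
        obtain ⟨a, b, c, h1, h2, h3⟩ := Finset.two_lt_card_iff.1 (by omega : 2 < UA.card)
        refine ⟨⟨a, h1⟩, ⟨b, h2⟩, ⟨c, h3.1⟩, ?_⟩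
        simpa using h3.2)
      (third_of_card UB (by omega)) (third_of_card UC (by omega)) (tA x) (tB x) (tC x) (tA x')
      (fun b => by
        obtain ⟨a, c, -, -, -, h, -⟩ := tB x' b
        exact ⟨a, c, h⟩)
    have p := PM.cons x a.1 b.1 c.1 h (by simpa using hxx) (by simpa using fun h => na (Subtype.ext h))
      (by simpa using fun h => nb (Subtype.ext h)) (by simpa using fun h => nc (Subtype.ext h))
      (PM.cons x' a'.1 b'.1 c'.1 h' (by simp) (by simp) (by simp) (by simp) PM.nil)
    refine ⟨_, _, _, _, p, ?_, ?_, ?_, ?_⟩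
    · rw [Finset.card_insert_of_notMem (by simpa using hxx)]; simp
    · intro z hz
      simp at hz
      rcases hz with rfl | rfl
      · exact a.2
      · exact a'.2
    · intro z hz
      simp at hz
      rcases hz with rfl | rfl
      · exact b.2
      · exact b'.2
    · intro z hz
      simp at hz
      rcases hz with rfl | rfl
      · exact c.2
      · exact c'.2
  -- main case
  have hN : ∀ x, r * ((t - 1) * r + 6) ≤ 4 * cnt (fun p : A × B × C =>
      (p.1 ∈ UA ∧ p.2.1 ∈ UB ∧ p.2.2 ∈ UC) ∧ R x p.1 p.2.1 p.2.2) := by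
    intro x
    have fin : ∀ u N k : ℕ, 3 * r ≤ 2 * u → u * k ≤ 6 * N → r * k ≤ 4 * N := by
      intro u N k h1 h2
      have := Nat.mul_le_mul_right k h1
      nlinarith
    rcases hcase with h | h | h
    · exact fin _ _ _ uA (triple_lower (fun a b c => R x a b c) UA UB UC _ _ (dA x) h)
    · refine fin _ _ _ uB ((triple_lower (fun b a c => R x a b c) UB UA UC _ _ (dB x) h).trans ?_)
      refine Nat.mul_le_mul_left _ (le_of_eq ?_)
      let e : B × A × C ≃ A × B × C :=
        ⟨fun p => (p.2.1, p.1, p.2.2), fun p => (p.2.1, p.1, p.2.2), fun _ => rfl, fun _ => rfl⟩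
      rw [← cnt_equiv e]
      congr 1
      ext p
      simp only [e, Equiv.coe_fn_mk]
      tauto
    · refine fin _ _ _ uC ((triple_lower (fun c a b => R x a b c) UC UA UB _ _ (dC x) h).trans ?_)
      refine Nat.mul_le_mul_left _ (le_of_eq ?_)
      let e : C × A × B ≃ A × B × C :=
        ⟨fun p => (p.2.1, p.2.2, p.1), fun p => (p.2.2, p.1, p.2.1), fun _ => rfl, fun _ => rfl⟩
      rw [← cnt_equiv e]
      congr 1
      ext p
      simp only [e, Equiv.coe_fn_mk]
      tauto
  have main : ∀ j ≤ t, ∃ SX SA SB SC, PM R SX SA SB SC ∧ SX.card = j ∧ SA ⊆ UA ∧ SB ⊆ UB ∧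
      SC ⊆ UC := by
    intro j
    induction j with
    | zero => intro _; exact ⟨∅, ∅, ∅, ∅, PM.nil, by simp⟩
    | succ j ih =>
      intro hj
      obtain ⟨SX, SA, SB, SC, hPM, cS, sA, sB, sC⟩ := ih (by omega)
      have hcards := hPM.card_eq
      by_cases hex : ∃ x a b c, x ∉ SX ∧ a ∉ SA ∧ b ∉ SB ∧ c ∉ SC ∧ a ∈ UA ∧ b ∈ UB ∧ c ∈ UC ∧
          R x a b c
      · obtain ⟨x, a, b, c, hx, ha, hb, hc, ua, ub, uc, h⟩ := hex
        refine ⟨_, _, _, _, PM.cons x a b c h hx ha hb hc hPM, ?_, ?_, ?_, ?_⟩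
        · rw [Finset.card_insert_of_notMem hx, cS]
        · exact Finset.insert_subset ua sA
        · exact Finset.insert_subset ub sB
        · exact Finset.insert_subset uc sC
      exfalso
      push Not at hex
      obtain ⟨m, hm⟩ : ∃ m, m = (r * ((t - 1) * r + 6) + 3) / 4 := ⟨_, rfl⟩
      have low := cnt_fiber_on_ge (fun p : X × A × B × C =>
        (p.2.1 ∈ UA ∧ p.2.2.1 ∈ UB ∧ p.2.2.2 ∈ UC) ∧ R p.1 p.2.1 p.2.2.1 p.2.2.2) SXᶜ m (by
          intro x _
          have := hN x
          simp only
          omega)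
      have oA := cnt_fiber_on_le (fun p : A × X × B × C => (p.2.2.1 ∈ UB ∧ p.2.2.2 ∈ UC) ∧
        R p.2.1 p.1 p.2.2.1 p.2.2.2) SA g (fun a ha => gA a (sA ha))
      have oB := cnt_fiber_on_le (fun p : B × X × A × C => (p.2.2.1 ∈ UA ∧ p.2.2.2 ∈ UC) ∧
        R p.2.1 p.2.2.1 p.1 p.2.2.2) SB g (fun a ha => gB a (sB ha))
      have oC := cnt_fiber_on_le (fun p : C × X × A × B => (p.2.2.1 ∈ UA ∧ p.2.2.2 ∈ UB) ∧
        R p.2.1 p.2.2.1 p.2.2.2 p.1) SC g (fun a ha => gC a (sC ha))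
      let eA : X × A × B × C ≃ A × X × B × C :=
        ⟨fun p => (p.2.1, p.1, p.2.2.1, p.2.2.2), fun p => (p.2.1, p.1, p.2.2.1, p.2.2.2),
          fun _ => rfl, fun _ => rfl⟩
      let eB : X × A × B × C ≃ B × X × A × C :=
        ⟨fun p => (p.2.2.1, p.1, p.2.1, p.2.2.2), fun p => (p.2.1, p.2.2.1, p.1, p.2.2.2),
          fun _ => rfl, fun _ => rfl⟩
      let eC : X × A × B × C ≃ C × X × A × B :=
        ⟨fun p => (p.2.2.2, p.1, p.2.1, p.2.2.1), fun p => (p.2.1, p.2.2.1, p.2.2.2, p.1),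
          fun _ => rfl, fun _ => rfl⟩
      rw [← cnt_equiv eA] at oA
      rw [← cnt_equiv eB] at oB
      rw [← cnt_equiv eC] at oC
      have up := low.trans ((cnt_mono ?_).trans (cnt_or_le oA (cnt_or_le oB oC)))
      · rw [Finset.card_compl, cX, cS] at up
        rw [hcards.1, hcards.2.1, hcards.2.2, cS] at up
        have hm4 : r * ((t - 1) * r + 6) ≤ 4 * m := by omega
        have hnj : n ≤ 2 * (n - j) := by omega
        have e1 : n * (r * ((t - 1) * r + 6)) ≤ 24 * (j * g) := by
          calc n * (r * ((t - 1) * r + 6)) ≤ (2 * (n - j)) * (4 * m) := Nat.mul_le_mul hnj hm4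
            _ = 8 * ((n - j) * m) := by ring
            _ ≤ 8 * (3 * (j * g)) := by omega
            _ = _ := by ring
        have e2 : n * (r * (j * r + 6)) ≤ 24 * (j * g) := by
          refine le_trans ?_ e1
          gcongr
          omega
        have e3 : 1000 * (24 * (j * g)) ≤ 24 * (j * n ^ 3) := by
          calc 1000 * (24 * (j * g)) = 24 * (j * (1000 * g)) := by ring
            _ ≤ _ := by gcongr
        have e4 : n ^ 2 ≤ 16 * r ^ 2 := by
          have : n ≤ 4 * r := by omega
          nlinarith
        have e5 : j * n ^ 3 ≤ 16 * (j * (n * r ^ 2)) := by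
          calc j * n ^ 3 = j * n * n ^ 2 := by ring
            _ ≤ j * n * (16 * r ^ 2) := by gcongr
            _ = _ := by ring
        have e6 : n * (r * (j * r + 6)) = j * (n * r ^ 2) + 6 * (n * r) := by ring
        have e7 : 0 < n * r := by apply Nat.mul_pos <;> omega
        omega
      · rintro ⟨x, a, b, c⟩ ⟨hx, ⟨ua, ub, uc⟩, h⟩
        simp only [Finset.mem_compl] at hx
        simp only [eA, eB, eC, Equiv.coe_fn_mk]
        by_contra hcon
        push Not at hcon
        simp only at ua ub uc h
        have h1 : a ∉ SA := fun ha => hcon.1 ha ⟨ub, uc⟩ h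
        have h2 : b ∉ SB := fun ha => hcon.2.1 ha ⟨ua, uc⟩ h
        have h3 : c ∉ SC := fun ha => hcon.2.2 ha ⟨ua, ub⟩ h
        exact hex x a b c hx h1 h2 h3 ua ub uc h
  exact main t le_rfl

/-- The finset of elements satisfying `p`. -/
noncomputable def fs {T : Type} [Fintype T] (p : T → Prop) : Finset T := Finset.univ.filter p

theorem mem_fs {T : Type} [Fintype T] (p : T → Prop) (t : T) : t ∈ fs p ↔ p t := by
  simp [fs]

theorem card_fs {T : Type} [Fintype T] (p : T → Prop) : (fs p).card = cnt p := rfl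

theorem cnt4 {P Q T : Type} [Fintype P] [Fintype Q] [Fintype T] (n g : ℕ)
    (cP : Fintype.card P = n) (cQ : Fintype.card Q = n) (cT : Fintype.card T = n)
    (F : P × Q × T → Prop) (hF : cnt F ≤ g) (S1 : Finset P) (S2 : Finset Q) (S3 : Finset T) :
    cnt (fun p : P × Q × T => F p ∨ p.1 ∈ S1 ∨ p.2.1 ∈ S2 ∨ p.2.2 ∈ S3) ≤
      g + (S1.card + S2.card + S3.card) * n ^ 2 := by
  have h1 : cnt (fun p : P × Q × T => p.1 ∈ S1) ≤ S1.card * n ^ 2 := by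
    rw [cnt_fst (fun a => a ∈ S1), cnt_mem, Fintype.card_prod, cQ, cT]
    exact le_of_eq (by ring)
  have h2 : cnt (fun p : P × Q × T => p.2.1 ∈ S2) ≤ S2.card * n ^ 2 := by
    rw [cnt_snd (fun a : Q × T => a.1 ∈ S2), cnt_fst (fun a => a ∈ S2), cnt_mem, cP, cT]
    exact le_of_eq (by ring)
  have h3 : cnt (fun p : P × Q × T => p.2.2 ∈ S3) ≤ S3.card * n ^ 2 := by
    rw [cnt_snd (fun a : Q × T => a.2 ∈ S3), cnt_snd (fun a => a ∈ S3), cnt_mem, cP, cQ]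
    exact le_of_eq (by ring)
  refine (cnt_or_le hF (cnt_or_le h1 (cnt_or_le h2 h3))).trans (le_of_eq (by ring))

theorem cnt_exists {T : Type} [Fintype T] (p q : T → Prop) (h : cnt q < cnt p) :
    ∃ t, p t ∧ ¬ q t := by
  by_contra hcon
  push Not at hcon
  exact absurd (cnt_mono hcon) (not_le.2 h)

theorem ext_X {A B C : Type} [Fintype A] [Fintype B] [Fintype C] (L : A → B → C → Prop)
    (n M k : ℕ) (cA : Fintype.card A = n) (cB : Fintype.card B = n) (cC : Fintype.card C = n)
    (dA : ∀ a, cnt (fun p : B × C => ¬ L a p.1 p.2) < M)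
    (WA SA : Finset A) (WB SB : Finset B) (WC SC : Finset C)
    (kA : SA.card ≤ k) (kB : SB.card ≤ k) (kC : SC.card ≤ k)
    (wA : 100 * WA.card ≤ 34 * n) (wB : 100 * WB.card ≤ 34 * n) (wC : 100 * WC.card ≤ 34 * n)
    (hM : 100 * M ≤ 45 * n ^ 2) (hk : 100 * k ≤ n) (hn : 0 < n) :
    ∃ a b c, L a b c ∧ a ∉ SA ∧ b ∉ SB ∧ c ∉ SC ∧ ¬ (a ∈ WA ∧ b ∈ WB) ∧ ¬ (a ∈ WA ∧ c ∈ WC) ∧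
      ¬ (b ∈ WB ∧ c ∈ WC) := by
  have h1 : cnt (fun p : A × B × C => ¬ L p.1 p.2.1 p.2.2) ≤ n * M := by
    have := cnt_fiber_le (fun p : A × B × C => ¬ L p.1 p.2.1 p.2.2) M (fun a => (dA a).le)
    rwa [cA] at this
  have h2 : cnt (fun p : A × B × C => p.1 ∈ WA ∧ p.2.1 ∈ WB) ≤ WA.card * (WB.card * n) := by
    rw [cnt_and_prod (fun a => a ∈ WA) (fun p : B × C => p.1 ∈ WB), cnt_fst (fun b => b ∈ WB),
      cnt_mem, cnt_mem, cC]
  have h3 : cnt (fun p : A × B × C => p.1 ∈ WA ∧ p.2.2 ∈ WC) ≤ WA.card * (n * WC.card) := by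
    rw [cnt_and_prod (fun a => a ∈ WA) (fun p : B × C => p.2 ∈ WC), cnt_snd (fun b => b ∈ WC),
      cnt_mem, cnt_mem, cB]
  have h4 : cnt (fun p : A × B × C => p.2.1 ∈ WB ∧ p.2.2 ∈ WC) ≤ n * (WB.card * WC.card) := by
    rw [cnt_snd (fun p : B × C => p.1 ∈ WB ∧ p.2 ∈ WC),
      cnt_and_prod (fun b => b ∈ WB) (fun c => c ∈ WC), cnt_mem, cnt_mem, cA]
  have h5 := cnt4 n _ cA cB cC _ (cnt_or_le h1 (cnt_or_le h2 (cnt_or_le h3 h4))) SA SB SC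
  have h6 : cnt (fun _ : A × B × C => True) = n ^ 3 := by
    rw [cnt_true, Fintype.card_prod, Fintype.card_prod, cA, cB, cC]; ring
  obtain ⟨⟨a, b, c⟩, -, h⟩ := cnt_exists (fun _ : A × B × C => True) _ (by
    refine lt_of_le_of_lt h5 ?_
    rw [h6]
    have e1 : 10000 * (WA.card * (WB.card * n)) ≤ 1156 * n ^ 3 := by
      calc 10000 * (WA.card * (WB.card * n)) = (100 * WA.card) * (100 * WB.card) * n := by ring
        _ ≤ (34 * n) * (34 * n) * n := by gcongr
        _ = _ := by ring
    have e2 : 10000 * (WA.card * (n * WC.card)) ≤ 1156 * n ^ 3 := by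
      calc 10000 * (WA.card * (n * WC.card)) = (100 * WA.card) * (100 * WC.card) * n := by ring
        _ ≤ (34 * n) * (34 * n) * n := by gcongr
        _ = _ := by ring
    have e3 : 10000 * (n * (WB.card * WC.card)) ≤ 1156 * n ^ 3 := by
      calc 10000 * (n * (WB.card * WC.card)) = (100 * WB.card) * (100 * WC.card) * n := by ring
        _ ≤ (34 * n) * (34 * n) * n := by gcongr
        _ = _ := by ring
    have e4 : 100 * (n * M) ≤ 45 * n ^ 3 := by
      calc 100 * (n * M) = n * (100 * M) := by ring
        _ ≤ n * (45 * n ^ 2) := by gcongr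
        _ = _ := by ring
    have e5 : 100 * ((SA.card + SB.card + SC.card) * n ^ 2) ≤ 3 * n ^ 3 := by
      calc 100 * ((SA.card + SB.card + SC.card) * n ^ 2)
          ≤ 100 * ((k + k + k) * n ^ 2) := by gcongr
        _ = 3 * ((100 * k) * n ^ 2) := by ring
        _ ≤ 3 * (n * n ^ 2) := by gcongr
        _ = _ := by ring
    have e6 : 0 < n ^ 3 := by positivity
    omega)
  simp only at h
  refine ⟨a, b, c, ?_⟩
  tauto

theorem ext_A {X B C : Type} [Fintype X] [Fintype B] [Fintype C] (L : X → B → C → Prop)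
    (n g k : ℕ) (cX : Fintype.card X = n) (cB : Fintype.card B = n) (cC : Fintype.card C = n)
    (SX : Finset X) (WB WB' SB : Finset B) (WC WC' SC : Finset C)
    (hP : g ≤ cnt (fun p : X × B × C => (p.2.1 ∉ WB ∧ p.2.2 ∉ WC) ∧ L p.1 p.2.1 p.2.2))
    (hk : SX.card + (SB.card + (WB' \ WB).card) + (SC.card + (WC' \ WC).card) ≤ k)
    (hg : k * n ^ 2 < g) :
    ∃ x b c, L x b c ∧ x ∉ SX ∧ b ∉ SB ∧ c ∉ SC ∧ b ∉ WB' ∧ c ∉ WC' := by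
  have h0 : cnt (fun _ : X × B × C => False) ≤ 0 := by simp [cnt]
  have h5 := cnt4 n 0 cX cB cC _ h0 SX (SB ∪ (WB' \ WB)) (SC ∪ (WC' \ WC))
  obtain ⟨⟨x, b, c⟩, h, h'⟩ := cnt_exists _ _ (lt_of_lt_of_le (lt_of_le_of_lt h5 (by
    refine lt_of_le_of_lt ?_ hg
    rw [zero_add]
    refine Nat.mul_le_mul_right _ (le_trans ?_ hk)
    gcongr
    · exact Finset.card_union_le _ _
    · exact Finset.card_union_le _ _)) hP)
  simp only [Finset.mem_union, Finset.mem_sdiff] at h h'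
  refine ⟨x, b, c, ?_⟩
  tauto

theorem cnt_UU {X B C : Type} [Fintype X] [Fintype B] [Fintype C] (n : ℕ)
    (cX : Fintype.card X = n) (cB : Fintype.card B = n) (cC : Fintype.card C = n)
    (WB : Finset B) (WC : Finset C) :
    cnt (fun p : X × B × C => p.2.1 ∉ WB ∧ p.2.2 ∉ WC) =
      n * ((n - WB.card) * (n - WC.card)) := by
  rw [cnt_snd (fun p : B × C => p.1 ∉ WB ∧ p.2 ∉ WC),
    cnt_and_prod (fun b => b ∉ WB) (fun c => c ∉ WC), cnt_notMem, cnt_notMem, cX, cB, cC]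

/-- A vertex with few `UU`-pairs is nearly complete to the others. -/
theorem low_P {X B C : Type} [Fintype X] [Fintype B] [Fintype C] (L : X → B → C → Prop)
    (n g M e : ℕ) (cX : Fintype.card X = n) (cB : Fintype.card B = n) (cC : Fintype.card C = n)
    (WB : Finset B) (WC : Finset C) (d : ∀ x, cnt (fun p : B × C => ¬ L x p.1 p.2) < M)
    (hP : ¬ g ≤ cnt (fun p : X × B × C => (p.2.1 ∉ WB ∧ p.2.2 ∉ WC) ∧ L p.1 p.2.1 p.2.2))
    (hM : M ≤ (n - WB.card) * (n - WC.card) + e) :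
    cnt (fun p : X × B × C => (p.2.1 ∈ WB ∨ p.2.2 ∈ WC) ∧ ¬ L p.1 p.2.1 p.2.2) ≤ g + n * e := by
  have h1 : cnt (fun p : X × B × C => ¬ L p.1 p.2.1 p.2.2) ≤ n * M := by
    have := cnt_fiber_le (fun p : X × B × C => ¬ L p.1 p.2.1 p.2.2) M (fun a => (d a).le)
    rwa [cX] at this
  have h2 := cnt_and_add (fun p : X × B × C => ¬ L p.1 p.2.1 p.2.2)
    (fun p => p.2.1 ∉ WB ∧ p.2.2 ∉ WC)
  have h3 := cnt_and_add (fun p : X × B × C => p.2.1 ∉ WB ∧ p.2.2 ∉ WC)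
    (fun p => L p.1 p.2.1 p.2.2)
  rw [cnt_UU n cX cB cC] at h3
  have h4 : cnt (fun p : X × B × C => (p.2.1 ∉ WB ∧ p.2.2 ∉ WC) ∧ ¬ L p.1 p.2.1 p.2.2) ≤
    cnt (fun p : X × B × C => ¬ L p.1 p.2.1 p.2.2 ∧ (p.2.1 ∉ WB ∧ p.2.2 ∉ WC)) :=
    cnt_mono (fun p hp => ⟨hp.2, hp.1⟩)
  have h5 : cnt (fun p : X × B × C => (p.2.1 ∈ WB ∨ p.2.2 ∈ WC) ∧ ¬ L p.1 p.2.1 p.2.2) ≤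
    cnt (fun p : X × B × C => ¬ L p.1 p.2.1 p.2.2 ∧ ¬ (p.2.1 ∉ WB ∧ p.2.2 ∉ WC)) :=
    cnt_mono (fun p hp => ⟨hp.2, by tauto⟩)
  have h6 : n * M ≤ n * ((n - WB.card) * (n - WC.card)) + n * e := by
    rw [← Nat.mul_add]; exact Nat.mul_le_mul_left _ hM
  omega

theorem good_P {X B C : Type} [Fintype X] [Fintype B] [Fintype C] (L : X → B → C → Prop)
    (n g : ℕ) (cX : Fintype.card X = n) (cB : Fintype.card B = n) (cC : Fintype.card C = n)
    (WB : Finset B) (WC : Finset C)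
    (hmiss : cnt (fun p : X × B × C => (p.2.1 ∉ WB ∧ p.2.2 ∉ WC) ∧ ¬ L p.1 p.2.1 p.2.2) ≤ g)
    (wB : 100 * WB.card ≤ 34 * n) (wC : 100 * WC.card ≤ 34 * n) (hg : 2000 * g ≤ n ^ 3) :
    g ≤ cnt (fun p : X × B × C => (p.2.1 ∉ WB ∧ p.2.2 ∉ WC) ∧ L p.1 p.2.1 p.2.2) := by
  have h3 := cnt_and_add (fun p : X × B × C => p.2.1 ∉ WB ∧ p.2.2 ∉ WC)
    (fun p => L p.1 p.2.1 p.2.2)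
  rw [cnt_UU n cX cB cC] at h3
  have : n ^ 3 ≤ 4 * (n * ((n - WB.card) * (n - WC.card))) := by
    calc n ^ 3 = n * (n * n) := by ring
      _ ≤ n * ((2 * (n - WB.card)) * (2 * (n - WC.card))) := by
          gcongr <;> omega
      _ = _ := by ring
  omega

theorem bad_bound {T S : Type} [Fintype T] [Fintype S] (p : T × S → Prop) (n m : ℕ)
    (hn : 100000000 ≤ n) (hm : 4000000000 * m ≤ n ^ 4) (hp : cnt p = m) :
    (fs (fun t => n ^ 3 / 2000 < cnt (fun s => p (t, s)))).card ≤ n / 1000000 := by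
  have h := markov p (n ^ 3 / 2000)
  rw [card_fs]
  set z := cnt (fun t => n ^ 3 / 2000 < cnt (fun s => p (t, s))) with hz
  set g := n ^ 3 / 2000 with hg
  by_contra hcon
  have h1 : n < 1000000 * z := by omega
  have h3 : 4000 ≤ n ^ 3 := by
    calc 4000 ≤ n := by omega
      _ ≤ n ^ 3 := Nat.le_self_pow (by norm_num) n
  have h2 : n ^ 3 ≤ 4000 * g := by omega
  have h4 : n ^ 4 < n ^ 4 := by
    calc n ^ 4 = n * n ^ 3 := by ring
      _ < (1000000 * z) * n ^ 3 := by
          apply Nat.mul_lt_mul_of_pos_right h1; omega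
      _ ≤ (1000000 * z) * (4000 * g) := by gcongr
      _ = 4000000000 * (z * g) := by ring
      _ ≤ 4000000000 * m := by rw [← hp]; gcongr
      _ ≤ n ^ 4 := hm
  exact lt_irrefl _ h4

theorem choose3 {A B C : Type} (FA PA : Finset A) (FB PB : Finset B) (FC PC : Finset C)
    (hA : FA ⊆ PA) (hB : FB ⊆ PB) (hC : FC ⊆ PC) (m : ℕ)
    (h1 : FA.card + FB.card + FC.card ≤ m) (h2 : m ≤ PA.card + PB.card + PC.card) :
    ∃ WA WB WC, FA ⊆ WA ∧ WA ⊆ PA ∧ FB ⊆ WB ∧ WB ⊆ PB ∧ FC ⊆ WC ∧ WC ⊆ PC ∧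
      WA.card + WB.card + WC.card = m := by
  have a1 := Finset.card_le_card hA
  have a2 := Finset.card_le_card hB
  have a3 := Finset.card_le_card hC
  obtain ⟨x, y, z, x1, x2, y1, y2, z1, z2, hs⟩ : ∃ x y z : ℕ, FA.card ≤ x ∧ x ≤ PA.card ∧
      FB.card ≤ y ∧ y ≤ PB.card ∧ FC.card ≤ z ∧ z ≤ PC.card ∧ x + y + z = m := by
    generalize FA.card = fa at *
    generalize FB.card = fb at *
    generalize FC.card = fc at *
    generalize PA.card = pa at *
    generalize PB.card = pb at *
    generalize PC.card = pc at *
    refine ⟨min pa (m - fb - fc), min pb (m - min pa (m - fb - fc) - fc),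
      m - min pa (m - fb - fc) - min pb (m - min pa (m - fb - fc) - fc), ?_⟩
    omega
  obtain ⟨WA, p1, p2, p3⟩ := Finset.exists_subsuperset_card_eq hA x1 x2
  obtain ⟨WB, q1, q2, q3⟩ := Finset.exists_subsuperset_card_eq hB y1 y2
  obtain ⟨WC, r1, r2, r3⟩ := Finset.exists_subsuperset_card_eq hC z1 z2
  exact ⟨WA, WB, WC, p1, p2, q1, q2, r1, r2, by omega⟩

theorem select3 {A B C : Type} (WA PA BA : Finset A) (WB PB BB : Finset B) (WC PC BC : Finset C)
    (n : ℕ) (hA : WA \ BA ⊆ PA) (hB : WB \ BB ⊆ PB) (hC : WC \ BC ⊆ PC)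
    (hsum : WA.card + WB.card + WC.card = n) :
    ∃ WA' WB' WC', (BA ∩ PA ⊆ WA' ∧ WA \ BA ⊆ WA' ∧ WA' ⊆ PA) ∧
      (BB ∩ PB ⊆ WB' ∧ WB \ BB ⊆ WB' ∧ WB' ⊆ PB) ∧
      (BC ∩ PC ⊆ WC' ∧ WC \ BC ⊆ WC' ∧ WC' ⊆ PC) ∧
      (n ≤ WA'.card + WB'.card + WC'.card ∨ (WA' = PA ∧ WB' = PB ∧ WC' = PC)) ∧
      WA'.card + WB'.card + WC'.card ≤ n + (BA.card + BB.card + BC.card) := by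
  have fA : (BA ∩ PA) ∪ (WA \ BA) ⊆ PA := Finset.union_subset Finset.inter_subset_right hA
  have fB : (BB ∩ PB) ∪ (WB \ BB) ⊆ PB := Finset.union_subset Finset.inter_subset_right hB
  have fC : (BC ∩ PC) ∪ (WC \ BC) ⊆ PC := Finset.union_subset Finset.inter_subset_right hC
  have u {T : Type} (B P W : Finset T) : ((B ∩ P) ∪ (W \ B)).card ≤ W.card + B.card := by
    refine (Finset.card_union_le _ _).trans ?_
    have := Finset.card_le_card (Finset.inter_subset_left (s₁ := B) (s₂ := P))
    have := Finset.card_le_card (Finset.sdiff_subset (s := W) (t := B))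
    omega
  have u1 := u BA PA WA
  have u2 := u BB PB WB
  have u3 := u BC PC WC
  have c1 := Finset.card_le_card fA
  have c2 := Finset.card_le_card fB
  have c3 := Finset.card_le_card fC
  obtain ⟨WA', WB', WC', a1, a2, b1, b2, d1, d2, hs⟩ := choose3 _ _ _ _ _ _ fA fB fC
    (max (((BA ∩ PA) ∪ (WA \ BA)).card + ((BB ∩ PB) ∪ (WB \ BB)).card +
      ((BC ∩ PC) ∪ (WC \ BC)).card) (min n (PA.card + PB.card + PC.card))) (by omega) (by omega)
  refine ⟨WA', WB', WC', ⟨(Finset.subset_union_left).trans a1, (Finset.subset_union_right).trans a1,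
    a2⟩, ⟨(Finset.subset_union_left).trans b1, (Finset.subset_union_right).trans b1,
    b2⟩, ⟨(Finset.subset_union_left).trans d1, (Finset.subset_union_right).trans d1,
    d2⟩, ?_, by omega⟩
  by_cases h : n ≤ WA'.card + WB'.card + WC'.card
  · exact Or.inl h
  · right
    have k1 := Finset.card_le_card a2
    have k2 := Finset.card_le_card b2
    have k3 := Finset.card_le_card d2
    exact ⟨Finset.eq_of_subset_of_card_le a2 (by omega),
      Finset.eq_of_subset_of_card_le b2 (by omega), Finset.eq_of_subset_of_card_le d2 (by omega)⟩


lemma insert_inter_le {A : Type} (S W : Finset A) (a : A) :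
    (insert a S ∩ W).card ≤ (S ∩ W).card + (if a ∈ W then 1 else 0) := by
  split_ifs with h
  · rw [Finset.insert_inter_of_mem h]; exact Finset.card_insert_le _ _
  · rw [Finset.insert_inter_of_notMem h]; simp

lemma cover_stage {X A B C : Type} [Fintype X] [Fintype A] [Fintype B] [Fintype C]
    {R : X → A → B → C → Prop} (n q g t M : ℕ)
    (cX : Fintype.card X = n) (cA : Fintype.card A = n) (cB : Fintype.card B = n)
    (cC : Fintype.card C = n) (hn : 0 < n)
    (WA WA' : Finset A) (WB WB' : Finset B) (WC WC' : Finset C)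
    (BX : Finset X) (DA : Finset A) (DB : Finset B) (DC : Finset C)
    (hT : BX.card + DA.card + DB.card + DC.card ≤ 10 * q) (ht : t ≤ 3 * q)
    (wA : 100 * WA'.card ≤ 34 * n) (wB : 100 * WB'.card ≤ 34 * n)
    (wC : 100 * WC'.card ≤ 34 * n)
    (eA : (WA' \ WA).card ≤ 6 * q) (eB : (WB' \ WB).card ≤ 6 * q) (eC : (WC' \ WC).card ≤ 6 * q)
    (hq : 10000 * q ≤ n) (hg : 51 * q * n ^ 2 < g)
    (hM : 100 * M ≤ 45 * n ^ 2)
    (dA : ∀ (x : X) (a : A), cnt (fun p : B × C => ¬R x a p.1 p.2) < M)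
    (pA : ∀ a ∈ DA, g ≤ cnt (fun p : X × B × C => (p.2.1 ∉ WB ∧ p.2.2 ∉ WC) ∧ R p.1 a p.2.1 p.2.2))
    (pB : ∀ b ∈ DB, g ≤ cnt (fun p : X × A × C => (p.2.1 ∉ WA ∧ p.2.2 ∉ WC) ∧ R p.1 p.2.1 b p.2.2))
    (pC : ∀ c ∈ DC, g ≤ cnt (fun p : X × A × B => (p.2.1 ∉ WA ∧ p.2.2 ∉ WB) ∧ R p.1 p.2.1 p.2.2 c))
    (SX : Finset X) (SA : Finset A) (SB : Finset B) (SC : Finset C)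
    (h0 : PM R SX SA SB SC) (h0t : SX.card = t)
    (h0A : SA ⊆ WA'ᶜ) (h0B : SB ⊆ WB'ᶜ) (h0C : SC ⊆ WC'ᶜ) :
    ∃ (SX : Finset X) (SA : Finset A) (SB : Finset B) (SC : Finset C), PM R SX SA SB SC ∧
      (SA ∩ WA').card + (SB ∩ WB').card + (SC ∩ WC').card + t ≤ SX.card ∧ SX.card ≤ 13 * q ∧
      BX ⊆ SX ∧ DA ⊆ SA ∧ DB ⊆ SB ∧ DC ⊆ SC := by
  let size : Finset X × Finset A × Finset B × Finset C → ℕ := fun S => S.1.card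
  let good : Finset X × Finset A × Finset B × Finset C → Prop := fun S =>
    PM R S.1 S.2.1 S.2.2.1 S.2.2.2 ∧ (S.2.1 ∩ WA').card + (S.2.2.1 ∩ WB').card +
      (S.2.2.2 ∩ WC').card + t ≤ S.1.card
  let cov : X ⊕ A ⊕ B ⊕ C → Finset X × Finset A × Finset B × Finset C → Prop := fun v S =>
    match v with
    | .inl x => x ∈ S.1
    | .inr (.inl a) => a ∈ S.2.1
    | .inr (.inr (.inl b)) => b ∈ S.2.2.1
    | .inr (.inr (.inr c)) => c ∈ S.2.2.2
  let T : Finset (X ⊕ A ⊕ B ⊕ C) := BX.disjSum (DA.disjSum (DB.disjSum DC))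
  have cT : T.card = BX.card + DA.card + DB.card + DC.card := by
    simp only [T, Finset.card_disjSum]; omega
  have key : ∀ S : Finset X × Finset A × Finset B × Finset C, good S → ∀ v : X ⊕ A ⊕ B ⊕ C,
      (∃ x a b c, R x a b c ∧ x ∉ S.1 ∧ a ∉ S.2.1 ∧ b ∉ S.2.2.1 ∧ c ∉ S.2.2.2 ∧
        ¬(a ∈ WA' ∧ b ∈ WB') ∧ ¬(a ∈ WA' ∧ c ∈ WC') ∧ ¬(b ∈ WB' ∧ c ∈ WC') ∧
        (v = .inl x ∨ v = .inr (.inl a) ∨ v = .inr (.inr (.inl b)) ∨ v = .inr (.inr (.inr c)))) →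
      ∃ s', good s' ∧ size s' ≤ size S + 1 ∧ cov v s' ∧ ∀ v', cov v' S → cov v' s' := by
    rintro ⟨TX, TA, TB, TC⟩ ⟨hpm, hc⟩ v ⟨x, a, b, c, hR, hx, ha, hb, hc', h1, h2, h3, hv⟩
    refine ⟨(insert x TX, insert a TA, insert b TB, insert c TC),
      ⟨PM.cons x a b c hR hx ha hb hc' hpm, ?_⟩, ?_, ?_, ?_⟩
    · have iA := insert_inter_le TA WA' a
      have iB := insert_inter_le TB WB' b
      have iC := insert_inter_le TC WC' c
      simp only at hx hc ⊢
      rw [Finset.card_insert_of_notMem hx]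
      by_cases q1 : a ∈ WA' <;> by_cases q2 : b ∈ WB' <;> by_cases q3 : c ∈ WC' <;>
        simp only [q1, q2, q3, if_true, if_false] at iA iB iC h1 h2 h3 <;>
        first | omega | exact absurd trivial (by tauto)
    · exact Finset.card_insert_le _ _
    · rcases hv with rfl | rfl | rfl | rfl <;> simp [cov]
    · rintro (y | y | y | y) hy <;> simp only [cov] at hy ⊢ <;> exact Finset.mem_insert_of_mem hy
  have hstep : ∀ S, ∀ v ∈ T, good S → size S < 13 * q →
      ∃ s', good s' ∧ size s' ≤ size S + 1 ∧ cov v s' ∧ ∀ v', cov v' S → cov v' s' := by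
    intro S v hv hS hsz
    by_cases hcv : cov v S
    · exact ⟨S, hS, by omega, hcv, fun _ h => h⟩
    apply key S hS
    obtain ⟨TX, TA, TB, TC⟩ := S
    obtain ⟨hpm, hc⟩ := hS
    obtain ⟨e1, e2, e3⟩ := hpm.card_eq
    simp only [size] at hsz e1 e2 e3
    simp only
    rcases v with x | a | b | c
    · obtain ⟨a, b, c, h1, h2, h3, h4, h5, h6, h7⟩ := ext_X (R x) n M (13 * q) cA cB cC (dA x)
        WA' TA WB' TB WC' TC (by omega) (by omega) (by omega) wA wB wC hM (by omega) hn
      exact ⟨x, a, b, c, h1, hcv, h2, h3, h4, h5, h6, h7, Or.inl rfl⟩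
    · have hv' : a ∈ DA := by simpa [T] using hv
      obtain ⟨x, b, c, h1, h2, h3, h4, h5, h6⟩ := ext_A (fun x b c => R x a b c) n g (51 * q)
        cX cB cC TX WB WB' TB WC WC' TC (pA a hv') (by omega) hg
      exact ⟨x, a, b, c, h1, h2, hcv, h3, h4, by tauto, by tauto, by tauto, Or.inr (Or.inl rfl)⟩
    · have hv' : b ∈ DB := by simpa [T] using hv
      obtain ⟨x, a, c, h1, h2, h3, h4, h5, h6⟩ := ext_A (fun x a c => R x a b c) n g (51 * q)
        cX cA cC TX WA WA' TA WC WC' TC (pB b hv') (by omega) hg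
      exact ⟨x, a, b, c, h1, h2, h3, hcv, h4, by tauto, by tauto, by tauto,
        Or.inr (Or.inr (Or.inl rfl))⟩
    · have hv' : c ∈ DC := by simpa [T] using hv
      obtain ⟨x, a, b, h1, h2, h3, h4, h5, h6⟩ := ext_A (fun x a b => R x a b c) n g (51 * q)
        cX cA cB TX WA WA' TA WB WB' TB (pC c hv') (by omega) hg
      exact ⟨x, a, b, c, h1, h2, h3, h4, hcv, by tauto, by tauto, by tauto,
        Or.inr (Or.inr (Or.inr rfl))⟩
  have z : ∀ {A : Type} [Fintype A] (S W : Finset A), S ⊆ Wᶜ → (S ∩ W).card = 0 := by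
    intro A _ S W h
    rw [Finset.card_eq_zero]
    ext y
    simp only [Finset.mem_inter, Finset.notMem_empty, iff_false]
    rintro ⟨h1, h2⟩
    exact (Finset.mem_compl.1 (h h1)) h2
  obtain ⟨⟨TX, TA, TB, TC⟩, ⟨hpm, hc⟩, hsz, hcov⟩ := greedy size good cov (13 * q) T hstep
    (SX, SA, SB, SC) ⟨h0, by simp only; rw [z _ _ h0A, z _ _ h0B, z _ _ h0C]; omega⟩
    (by simp only [size]; omega)
  simp only [size] at hsz
  refine ⟨TX, TA, TB, TC, hpm, hc, by omega, ?_, ?_, ?_, ?_⟩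
  · exact fun x hx => hcov (.inl x) (by simpa [T] using hx)
  · exact fun x hx => hcov (.inr (.inl x)) (by simpa [T] using hx)
  · exact fun x hx => hcov (.inr (.inr (.inl x))) (by simpa [T] using hx)
  · exact fun x hx => hcov (.inr (.inr (.inr x))) (by simpa [T] using hx)


def Miss {X A B C : Type} (R : X → A → B → C → Prop) (WA : Finset A) (WB : Finset B)
    (WC : Finset C) (x : X) (a : A) (b : B) (c : C) : Prop :=
  ¬R x a b c ∧ (a ∈ WA ∨ b ∈ WB ∨ c ∈ WC) ∧ (a ∉ WA ∨ b ∉ WB ∨ c ∉ WC)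

lemma final_arith1 (n w : ℕ) (hn : 100000000 ≤ n) (hw : 3 * n ≤ 10 * w) :
    4 * (n ^ 3 / 1000) + 6 * w ^ 2 < w ^ 3 := by
  have h1 : 1000 * (n ^ 3 / 1000) ≤ n ^ 3 := Nat.mul_div_le _ _
  obtain ⟨v, rfl⟩ : ∃ v, w = v + 6 := ⟨w - 6, by omega⟩
  have h2 : 29 * n ≤ 100 * v := by omega
  have h3 : (3 * n) ^ 2 ≤ (10 * (v + 6)) ^ 2 := Nat.pow_le_pow_left hw 2
  have h4 : 29 * n * (3 * n) ^ 2 ≤ 100 * v * (10 * (v + 6)) ^ 2 := Nat.mul_le_mul h2 h3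
  have h5 : 0 < n ^ 3 := by positivity
  nlinarith

lemma final_arith2 (n q k : ℕ) (hn : 100000000 ≤ n) (hq : 1000000 * q ≤ n) (hk : k ≤ 13 * q) :
    n ^ 3 / 2000 + k * n ^ 2 ≤ n ^ 3 / 1000 := by
  have h2 : 1000000 * (k * n ^ 2) ≤ 13 * n ^ 3 := by
    have : 1000000 * k ≤ 13 * n := by omega
    calc 1000000 * (k * n ^ 2) = (1000000 * k) * n ^ 2 := by ring
      _ ≤ (13 * n) * n ^ 2 := Nat.mul_le_mul_right _ this
      _ = _ := by ring
  have h5 : 1000000 ≤ n ^ 3 := by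
    calc 1000000 ≤ n := by omega
      _ ≤ n ^ 3 := Nat.le_self_pow (by norm_num) n
  omega

lemma final_arith3 (n : ℕ) (hn : 100000000 ≤ n) :
    n ^ 3 / 2000 + n * (4 * n) ≤ n ^ 3 / 1000 := by
  have h2 : 100000000 * (n * (4 * n)) ≤ 4 * n ^ 3 := by
    calc 100000000 * (n * (4 * n)) ≤ n * (n * (4 * n)) := Nat.mul_le_mul_right _ hn
      _ = _ := by ring
  have h5 : 1000000 ≤ n ^ 3 := by
    calc 1000000 ≤ n := by omega
      _ ≤ n ^ 3 := Nat.le_self_pow (by norm_num) n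
  omega

lemma prop_X (a1 a2 b1 b2 c1 c2 R : Prop) (ha : a2 → a1) (hb : b2 → b1) (hc : c2 → c1)
    (h : a2 ∧ ¬b2 ∧ ¬c2 ∨ ¬a2 ∧ b2 ∧ ¬c2 ∨ ¬a2 ∧ ¬b2 ∧ c2) (hR : ¬R) :
    (¬R ∧ (a1 ∨ b1 ∨ c1) ∧ (¬a1 ∨ ¬b1 ∨ ¬c1)) ∨ (a1 ∧ ¬a2) ∨ (b1 ∧ ¬b2) ∨ (c1 ∧ ¬c2) := by
  by_cases a1 <;> by_cases a2 <;> by_cases b1 <;> by_cases b2 <;> simp_all <;> tauto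

lemma prop_A (a1 a2 b1 b2 c1 c2 R Z : Prop) (ha : a2 → a1) (hb : b2 → b1) (hc : c2 → c1)
    (h : a2 ∧ ¬b2 ∧ ¬c2 ∨ ¬a2 ∧ b2 ∧ ¬c2 ∨ ¬a2 ∧ ¬b2 ∧ c2) (hR : ¬R) :
    (¬R ∧ (a1 ∨ b1 ∨ c1) ∧ (¬a1 ∨ ¬b1 ∨ ¬c1)) ∨ Z ∨ (b1 ∧ ¬b2) ∨ (c1 ∧ ¬c2) := by
  by_cases a1 <;> by_cases a2 <;> by_cases b1 <;> by_cases b2 <;> simp_all <;> tauto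

lemma prop_B (a1 a2 b1 b2 c1 c2 R Z : Prop) (ha : a2 → a1) (hb : b2 → b1) (hc : c2 → c1)
    (h : a2 ∧ ¬b2 ∧ ¬c2 ∨ ¬a2 ∧ b2 ∧ ¬c2 ∨ ¬a2 ∧ ¬b2 ∧ c2) (hR : ¬R) :
    (¬R ∧ (a1 ∨ b1 ∨ c1) ∧ (¬a1 ∨ ¬b1 ∨ ¬c1)) ∨ Z ∨ (a1 ∧ ¬a2) ∨ (c1 ∧ ¬c2) := by
  by_cases a1 <;> by_cases a2 <;> by_cases b1 <;> by_cases b2 <;> simp_all <;> tauto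

lemma prop_C (a1 a2 b1 b2 c1 c2 R Z : Prop) (ha : a2 → a1) (hb : b2 → b1) (hc : c2 → c1)
    (h : a2 ∧ ¬b2 ∧ ¬c2 ∨ ¬a2 ∧ b2 ∧ ¬c2 ∨ ¬a2 ∧ ¬b2 ∧ c2) (hR : ¬R) :
    (¬R ∧ (a1 ∨ b1 ∨ c1) ∧ (¬a1 ∨ ¬b1 ∨ ¬c1)) ∨ Z ∨ (a1 ∧ ¬a2) ∨ (b1 ∧ ¬b2) := by
  by_cases a1 <;> by_cases a2 <;> by_cases b1 <;> by_cases b2 <;> simp_all <;> tauto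

lemma final_stage {X A B C : Type} [Fintype X] [Fintype A] [Fintype B] [Fintype C]
    {R : X → A → B → C → Prop} (n q M : ℕ)
    (cX : Fintype.card X = n) (cA : Fintype.card A = n) (cB : Fintype.card B = n)
    (cC : Fintype.card C = n) (hn : 100000000 ≤ n) (hq : 1000000 * q ≤ n)
    (WA VA : Finset A) (WB VB : Finset B) (WC VC : Finset C)
    (SX : Finset X) (SA : Finset A) (SB : Finset B) (SC : Finset C)
    (hS : PM R SX SA SB SC) (hk : SX.card ≤ 13 * q)
    (wA : WA.card ≤ (n + 2) / 3) (wB : WB.card ≤ (n + 2) / 3) (wC : WC.card ≤ (n + 2) / 3)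
    (wsum : WA.card + WB.card + WC.card = n)
    (vA : VA ⊆ WA) (vB : VB ⊆ WB) (vC : VC ⊆ WC)
    (vA' : VA ⊆ SAᶜ) (vB' : VB ⊆ SBᶜ) (vC' : VC ⊆ SCᶜ)
    (vsum : VA.card + VB.card + VC.card = n - SX.card)
    (mA : M ≤ (n - WB.card) * (n - WC.card) + 4 * n)
    (mB : M ≤ (n - WA.card) * (n - WC.card) + 4 * n)
    (mC : M ≤ (n - WA.card) * (n - WB.card) + 4 * n)
    (dA : ∀ (x : X) (a : A), cnt (fun p : B × C => ¬R x a p.1 p.2) < M)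
    (dB : ∀ (x : X) (b : B), cnt (fun p : A × C => ¬R x p.1 b p.2) < M)
    (dC : ∀ (x : X) (c : C), cnt (fun p : A × B => ¬R x p.1 p.2 c) < M)
    (gX : ∀ x ∉ SX, cnt (fun p : A × B × C => Miss R WA WB WC x p.1 p.2.1 p.2.2) ≤ n ^ 3 / 2000)
    (gA : ∀ a ∉ SA, cnt (fun p : X × B × C => Miss R WA WB WC p.1 a p.2.1 p.2.2) ≤ n ^ 3 / 2000 ∨
      (a ∉ VA ∧ ¬ n ^ 3 / 2000 ≤
        cnt (fun p : X × B × C => (p.2.1 ∉ WB ∧ p.2.2 ∉ WC) ∧ R p.1 a p.2.1 p.2.2)))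
    (gB : ∀ b ∉ SB, cnt (fun p : X × A × C => Miss R WA WB WC p.1 p.2.1 b p.2.2) ≤ n ^ 3 / 2000 ∨
      (b ∉ VB ∧ ¬ n ^ 3 / 2000 ≤
        cnt (fun p : X × A × C => (p.2.1 ∉ WA ∧ p.2.2 ∉ WC) ∧ R p.1 p.2.1 b p.2.2)))
    (gC : ∀ c ∉ SC, cnt (fun p : X × A × B => Miss R WA WB WC p.1 p.2.1 p.2.2 c) ≤ n ^ 3 / 2000 ∨
      (c ∉ VC ∧ ¬ n ^ 3 / 2000 ≤
        cnt (fun p : X × A × B => (p.2.1 ∉ WA ∧ p.2.2 ∉ WB) ∧ R p.1 p.2.1 p.2.2 c))) :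
    PM R univ univ univ univ := by
  obtain ⟨e1, e2, e3⟩ := hS.card_eq
  have kA := Finset.card_sdiff_of_subset vA
  have kB := Finset.card_sdiff_of_subset vB
  have kC := Finset.card_sdiff_of_subset vC
  have lA := Finset.card_le_card vA
  have lB := Finset.card_le_card vB
  have lC := Finset.card_le_card vC
  have rest : PM R SXᶜ SAᶜ SBᶜ SCᶜ := by
    refine split_PM SXᶜ SAᶜ SBᶜ SCᶜ VA VB VC (n - SX.card) (n ^ 3 / 1000)
      (by rw [Finset.card_compl, cX]) (by rw [Finset.card_compl, cA, e1])
      (by rw [Finset.card_compl, cB, e2]) (by rw [Finset.card_compl, cC, e3])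
      vA' vB' vC' vsum ?_ ?_ ?_ ?_ (final_arith1 _ _ hn (by omega))
      (final_arith1 _ _ hn (by omega)) (final_arith1 _ _ hn (by omega))
    · intro x hx
      have h := cnt4 n _ cA cB cC _ (gX x (Finset.mem_compl.1 hx)) (WA \ VA) (WB \ VB) (WC \ VC)
      refine le_trans (le_trans (cnt_mono ?_) h) (final_arith2 n q _ hn hq (by omega))
      rintro ⟨a, b, c⟩ ⟨-, h1, h2⟩
      simp only [Miss, Finset.mem_sdiff]
      exact prop_X _ _ _ _ _ _ _ (@vA a) (@vB b) (@vC c) h1 h2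
    · intro a ha
      rcases gA a (Finset.mem_compl.1 ha) with h | ⟨hV, h⟩
      · have h := cnt4 n _ cX cB cC _ h ∅ (WB \ VB) (WC \ VC)
        refine le_trans (le_trans (cnt_mono ?_) h)
          (final_arith2 n q _ hn hq (by rw [Finset.card_empty]; omega))
        rintro ⟨x, b, c⟩ ⟨-, h1, h2⟩
        simp only [Miss, Finset.mem_sdiff]
        exact prop_A _ _ _ _ _ _ _ _ (@vA a) (@vB b) (@vC c) h1 h2
      · have h := low_P (fun x b c => R x a b c) n _ M (4 * n) cX cB cC WB WC
          (fun x => dA x a) h mA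
        refine le_trans (le_trans (cnt_mono ?_) h) (final_arith3 n hn)
        rintro ⟨x, b, c⟩ ⟨-, h1, h2⟩
        simp only [ExOne] at h1 ⊢
        have hb := @vB b; have hc := @vC c
        clear h dA dB dC gA gB gC gX mA mB mC
        refine ⟨?_, h2⟩
        rcases h1 with ⟨p1, p2, p3⟩ | ⟨p1, p2, p3⟩ | ⟨p1, p2, p3⟩ <;> grind
    · intro b hb
      rcases gB b (Finset.mem_compl.1 hb) with h | ⟨hV, h⟩
      · have h := cnt4 n _ cX cA cC _ h ∅ (WA \ VA) (WC \ VC)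
        refine le_trans (le_trans (cnt_mono ?_) h)
          (final_arith2 n q _ hn hq (by rw [Finset.card_empty]; omega))
        rintro ⟨x, a, c⟩ ⟨-, h1, h2⟩
        simp only [Miss, Finset.mem_sdiff]
        exact prop_B _ _ _ _ _ _ _ _ (@vA a) (@vB b) (@vC c) h1 h2
      · have h := low_P (fun x a c => R x a b c) n _ M (4 * n) cX cA cC WA WC
          (fun x => dB x b) h mB
        refine le_trans (le_trans (cnt_mono ?_) h) (final_arith3 n hn)
        rintro ⟨x, a, c⟩ ⟨-, h1, h2⟩
        simp only [ExOne] at h1 ⊢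
        have ha := @vA a; have hc := @vC c
        clear h dA dB dC gA gB gC gX mA mB mC
        refine ⟨?_, h2⟩
        rcases h1 with ⟨p1, p2, p3⟩ | ⟨p1, p2, p3⟩ | ⟨p1, p2, p3⟩ <;> grind
    · intro c hc
      rcases gC c (Finset.mem_compl.1 hc) with h | ⟨hV, h⟩
      · have h := cnt4 n _ cX cA cB _ h ∅ (WA \ VA) (WB \ VB)
        refine le_trans (le_trans (cnt_mono ?_) h)
          (final_arith2 n q _ hn hq (by rw [Finset.card_empty]; omega))
        rintro ⟨x, a, b⟩ ⟨-, h1, h2⟩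
        simp only [Miss, Finset.mem_sdiff]
        exact prop_C _ _ _ _ _ _ _ _ (@vA a) (@vB b) (@vC c) h1 h2
      · have h := low_P (fun x a b => R x a b c) n _ M (4 * n) cX cA cB WA WB
          (fun x => dC x c) h mC
        refine le_trans (le_trans (cnt_mono ?_) h) (final_arith3 n hn)
        rintro ⟨x, a, b⟩ ⟨-, h1, h2⟩
        simp only [ExOne] at h1 ⊢
        have ha := @vA a; have hb := @vB b
        clear h dA dB dC gA gB gC gX mA mB mC
        refine ⟨?_, h2⟩
        rcases h1 with ⟨p1, p2, p3⟩ | ⟨p1, p2, p3⟩ | ⟨p1, p2, p3⟩ <;> grind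
  have := hS.union rest disjoint_compl_right disjoint_compl_right disjoint_compl_right
    disjoint_compl_right
  simpa only [Finset.union_compl] using this


lemma Mrs_le (r s : ℕ) : Mrs r s ≤ (2 * r + 3) * (2 * r + 2) := by
  unfold Mrs
  split_ifs <;> nlinarith

lemma Mrs_le1 (n r s : ℕ) (hn : n = 3 * r + s) (h1 : 1 ≤ s) (h3 : s ≤ 3) (hb : 100000000 ≤ n) :
    100 * Mrs r s ≤ 45 * n ^ 2 := by
  have h := Mrs_le r s
  have : 3 * r ≤ n := by omega
  have : (3 * r) ^ 2 ≤ n ^ 2 := Nat.pow_le_pow_left this 2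
  have hr : 1000 ≤ r := by omega
  nlinarith

lemma Mrs_le2 (n r s w w' : ℕ) (hn : n = 3 * r + s) (h1 : 1 ≤ s) (h3 : s ≤ 3)
    (hb : 100000000 ≤ n) (hw : w ≤ (n + 2) / 3) (hw' : w' ≤ (n + 2) / 3) :
    Mrs r s ≤ (n - w) * (n - w') + 4 * n := by
  have h := Mrs_le r s
  have h2 : (2 * r) * (2 * r) ≤ (n - w) * (n - w') := Nat.mul_le_mul (by omega) (by omega)
  have hr : 1000 ≤ r := by omega
  nlinarith

lemma arith51 (n q : ℕ) (hn : 100000000 ≤ n) (hq : 1000000 * q ≤ n) :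
    51 * q * n ^ 2 < n ^ 3 / 2000 := by
  have h2 : 1000000 * (51 * q * n ^ 2) ≤ 51 * n ^ 3 := by
    calc 1000000 * (51 * q * n ^ 2) = (1000000 * q) * (51 * n ^ 2) := by ring
      _ ≤ n * (51 * n ^ 2) := Nat.mul_le_mul_right _ hq
      _ = _ := by ring
  have h5 : 1000000 ≤ n ^ 3 := by
    calc 1000000 ≤ n := by omega
      _ ≤ n ^ 3 := Nat.le_self_pow (by norm_num) n
  omega

lemma card_swap {A : Type} (W W' : Finset A) :
    W'.card + (W \ W').card = W.card + (W' \ W).card := by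
  have h1 := Finset.card_sdiff_add_card_inter W W'
  have h2 := Finset.card_sdiff_add_card_inter W' W
  rw [Finset.inter_comm] at h2
  omega

lemma card_D {A : Type} (W W' B : Finset A) :
    (W' \ (W \ B)).card ≤ (W' \ W).card + B.card := by
  refine le_trans (Finset.card_le_card ?_) (Finset.card_union_le _ _)
  intro a; simp only [Finset.mem_sdiff, Finset.mem_union]; tauto

lemma mem_of_eq_fs {T : Type} [Fintype T] {S : Finset T} {p : T → Prop} (h : S = fs p) (t : T) :
    t ∈ S ↔ p t := by
  subst h; exact mem_fs p t

lemma prop_U (b b' c c' R Z : Prop) (h1 : ¬b') (h2 : ¬c') (h3 : R) :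
    ((¬b ∧ ¬c) ∧ R) ∨ Z ∨ (b ∧ ¬b') ∨ (c ∧ ¬c') := by
  tauto

set_option maxHeartbeats 2000000 in
lemma typed_main {X A B C : Type} [Fintype X] [Fintype A] [Fintype B] [Fintype C]
    {R : X → A → B → C → Prop} (n r s : ℕ) (hn : n = 3 * r + s) (hs1 : 1 ≤ s) (hs3 : s ≤ 3)
    (hb : 100000000 ≤ n)
    (cX : Fintype.card X = n) (cA : Fintype.card A = n) (cB : Fintype.card B = n)
    (cC : Fintype.card C = n)
    (WA : Finset A) (WB : Finset B) (WC : Finset C)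
    (wA : WA.card ≤ (n + 2) / 3) (wB : WB.card ≤ (n + 2) / 3) (wC : WC.card ≤ (n + 2) / 3)
    (wsum : WA.card + WB.card + WC.card = n)
    (hMiss : 4000000000 * cnt (fun p : X × A × B × C =>
      Miss R WA WB WC p.1 p.2.1 p.2.2.1 p.2.2.2) ≤ n ^ 4)
    (dA : ∀ (x : X) (a : A), cnt (fun p : B × C => ¬R x a p.1 p.2) < Mrs r s)
    (dB : ∀ (x : X) (b : B), cnt (fun p : A × C => ¬R x p.1 b p.2) < Mrs r s)
    (dC : ∀ (x : X) (c : C), cnt (fun p : A × B => ¬R x p.1 p.2 c) < Mrs r s) :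
    PM R univ univ univ univ := by
  obtain ⟨q, hqd⟩ : ∃ q, q = n / 1000000 := ⟨_, rfl⟩
  have hq : 1000000 * q ≤ n := by omega
  have g2000 : 2000 * (n ^ 3 / 2000) ≤ n ^ 3 := Nat.mul_div_le _ _
  obtain ⟨BX, hBX⟩ : ∃ S, S = fs (fun x : X => n ^ 3 / 2000 < cnt (fun p : A × B × C =>
    Miss R WA WB WC x p.1 p.2.1 p.2.2)) := ⟨_, rfl⟩
  obtain ⟨BA, hBA⟩ : ∃ S, S = fs (fun a : A => n ^ 3 / 2000 < cnt (fun p : X × B × C =>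
    Miss R WA WB WC p.1 a p.2.1 p.2.2)) := ⟨_, rfl⟩
  obtain ⟨BB, hBB⟩ : ∃ S, S = fs (fun b : B => n ^ 3 / 2000 < cnt (fun p : X × A × C =>
    Miss R WA WB WC p.1 p.2.1 b p.2.2)) := ⟨_, rfl⟩
  obtain ⟨BC, hBC⟩ : ∃ S, S = fs (fun c : C => n ^ 3 / 2000 < cnt (fun p : X × A × B =>
    Miss R WA WB WC p.1 p.2.1 p.2.2 c)) := ⟨_, rfl⟩
  have bX : BX.card ≤ q := by
    rw [hBX, hqd]
    exact bad_bound (fun p : X × A × B × C => Miss R WA WB WC p.1 p.2.1 p.2.2.1 p.2.2.2)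
      n _ hb hMiss rfl
  have bA : BA.card ≤ q := by
    rw [hBA, hqd]
    let e : A × X × B × C ≃ X × A × B × C := ⟨fun p => (p.2.1, p.1, p.2.2.1, p.2.2.2),
      fun p => (p.2.1, p.1, p.2.2.1, p.2.2.2), fun _ => rfl, fun _ => rfl⟩
    exact bad_bound (fun p : A × X × B × C => Miss R WA WB WC p.2.1 p.1 p.2.2.1 p.2.2.2)
      n _ hb hMiss (cnt_equiv e (fun p : X × A × B × C => Miss R WA WB WC p.1 p.2.1 p.2.2.1 p.2.2.2))
  have bB : BB.card ≤ q := by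
    rw [hBB, hqd]
    let e : B × X × A × C ≃ X × A × B × C := ⟨fun p => (p.2.1, p.2.2.1, p.1, p.2.2.2),
      fun p => (p.2.2.1, p.1, p.2.1, p.2.2.2), fun _ => rfl, fun _ => rfl⟩
    exact bad_bound (fun p : B × X × A × C => Miss R WA WB WC p.2.1 p.2.2.1 p.1 p.2.2.2)
      n _ hb hMiss (cnt_equiv e (fun p : X × A × B × C => Miss R WA WB WC p.1 p.2.1 p.2.2.1 p.2.2.2))
  have bC : BC.card ≤ q := by
    rw [hBC, hqd]
    let e : C × X × A × B ≃ X × A × B × C := ⟨fun p => (p.2.1, p.2.2.1, p.2.2.2, p.1),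
      fun p => (p.2.2.2, p.1, p.2.1, p.2.2.1), fun _ => rfl, fun _ => rfl⟩
    exact bad_bound (fun p : C × X × A × B => Miss R WA WB WC p.2.1 p.2.2.1 p.2.2.2 p.1)
      n _ hb hMiss (cnt_equiv e (fun p : X × A × B × C => Miss R WA WB WC p.1 p.2.1 p.2.2.1 p.2.2.2))
  obtain ⟨PA, hPA⟩ : ∃ S, S = fs (fun a : A => n ^ 3 / 2000 ≤
    cnt (fun p : X × B × C => (p.2.1 ∉ WB ∧ p.2.2 ∉ WC) ∧ R p.1 a p.2.1 p.2.2)) := ⟨_, rfl⟩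
  obtain ⟨PB, hPB⟩ : ∃ S, S = fs (fun b : B => n ^ 3 / 2000 ≤
    cnt (fun p : X × A × C => (p.2.1 ∉ WA ∧ p.2.2 ∉ WC) ∧ R p.1 p.2.1 b p.2.2)) := ⟨_, rfl⟩
  obtain ⟨PC, hPC⟩ : ∃ S, S = fs (fun c : C => n ^ 3 / 2000 ≤
    cnt (fun p : X × A × B => (p.2.1 ∉ WA ∧ p.2.2 ∉ WB) ∧ R p.1 p.2.1 p.2.2 c)) := ⟨_, rfl⟩
  have mBX := mem_of_eq_fs hBX
  have mBA := mem_of_eq_fs hBA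
  have mBB := mem_of_eq_fs hBB
  have mBC := mem_of_eq_fs hBC
  have mPA := mem_of_eq_fs hPA
  have mPB := mem_of_eq_fs hPB
  have mPC := mem_of_eq_fs hPC
  clear hBX hBA hBB hBC hPA hPB hPC hMiss
  have sA : WA \ BA ⊆ PA := by
    intro a ha
    obtain ⟨h1, h2⟩ := Finset.mem_sdiff.1 ha
    rw [mPA]
    refine good_P (fun x b c => R x a b c) n _ cX cB cC WB WC
      (le_trans (cnt_mono ?_) (not_lt.1 (fun h => h2 ((mBA a).2 h)))) (by omega) (by omega) g2000
    rintro p ⟨⟨h3, h4⟩, h5⟩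
    exact ⟨h5, Or.inl h1, Or.inr (Or.inl h3)⟩
  have sB : WB \ BB ⊆ PB := by
    intro b hb'
    obtain ⟨h1, h2⟩ := Finset.mem_sdiff.1 hb'
    rw [mPB]
    refine good_P (fun x a c => R x a b c) n _ cX cA cC WA WC
      (le_trans (cnt_mono ?_) (not_lt.1 (fun h => h2 ((mBB b).2 h)))) (by omega) (by omega) g2000
    rintro p ⟨⟨h3, h4⟩, h5⟩
    exact ⟨h5, Or.inr (Or.inl h1), Or.inl h3⟩
  have sC : WC \ BC ⊆ PC := by
    intro c hc
    obtain ⟨h1, h2⟩ := Finset.mem_sdiff.1 hc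
    rw [mPC]
    refine good_P (fun x a b => R x a b c) n _ cX cA cB WA WB
      (le_trans (cnt_mono ?_) (not_lt.1 (fun h => h2 ((mBC c).2 h)))) (by omega) (by omega) g2000
    rintro p ⟨⟨h3, h4⟩, h5⟩
    exact ⟨h5, Or.inr (Or.inr h1), Or.inl h3⟩
  obtain ⟨WA', WB', WC', ⟨fA, gA, pA⟩, ⟨fB, gB, pB⟩, ⟨fC, gC, pC⟩, halt, hup⟩ :=
    select3 WA PA BA WB PB BB WC PC BC n sA sB sC wsum
  have jA : (WA \ WA').card ≤ BA.card := Finset.card_le_card fun a ha => by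
    by_contra h; simp only [Finset.mem_sdiff] at ha
    exact ha.2 (gA (Finset.mem_sdiff.2 ⟨ha.1, h⟩))
  have jB : (WB \ WB').card ≤ BB.card := Finset.card_le_card fun a ha => by
    by_contra h; simp only [Finset.mem_sdiff] at ha
    exact ha.2 (gB (Finset.mem_sdiff.2 ⟨ha.1, h⟩))
  have jC : (WC \ WC').card ≤ BC.card := Finset.card_le_card fun a ha => by
    by_contra h; simp only [Finset.mem_sdiff] at ha
    exact ha.2 (gC (Finset.mem_sdiff.2 ⟨ha.1, h⟩))
  have swA := card_swap WA WA'
  have swB := card_swap WB WB'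
  have swC := card_swap WC WC'
  have cDA := card_D WA WA' BA
  have cDB := card_D WB WB' BB
  have cDC := card_D WC WC' BC
  have tex : ∃ (SX : Finset X) (SA : Finset A) (SB : Finset B) (SC : Finset C),
      PM R SX SA SB SC ∧ SX.card = n - (WA'.card + WB'.card + WC'.card) ∧
      SA ⊆ WA'ᶜ ∧ SB ⊆ WB'ᶜ ∧ SC ⊆ WC'ᶜ := by
    by_cases hge : n ≤ WA'.card + WB'.card + WC'.card
    · exact ⟨∅, ∅, ∅, ∅, PM.nil, by rw [Finset.card_empty]; omega, by simp, by simp, by simp⟩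
    · obtain ⟨qA, qB, qC⟩ := halt.resolve_left hge
      have ccA : (WA'ᶜ).card = n - WA'.card := by rw [Finset.card_compl, cA]
      have ccB : (WB'ᶜ).card = n - WB'.card := by rw [Finset.card_compl, cB]
      have ccC : (WC'ᶜ).card = n - WC'.card := by rw [Finset.card_compl, cC]
      refine crux WA'ᶜ WB'ᶜ WC'ᶜ n r s (n - (WA'.card + WB'.card + WC'.card)) (n ^ 3 / 1000)
        hn hs1 hs3 (by omega) cX (by omega) (by omega) (by omega) (by omega) (by omega)
        (Nat.mul_div_le _ _) ?_ ?_ ?_ dA dB dC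
      · intro a ha
        rw [Finset.mem_compl, qA, mPA] at ha
        have h := cnt4 n _ cX cB cC _ (not_le.1 ha).le ∅ (WB \ WB') (WC \ WC')
        refine le_trans (le_trans (cnt_mono ?_) h)
          (final_arith2 n q _ hb hq (by rw [Finset.card_empty]; omega))
        rintro ⟨x, b, c⟩ ⟨⟨h1, h2⟩, h3⟩
        simp only [Finset.mem_compl, Finset.mem_sdiff] at h1 h2 ⊢
        exact prop_U _ _ _ _ _ _ h1 h2 h3
      · intro b hb'
        rw [Finset.mem_compl, qB, mPB] at hb'
        have h := cnt4 n _ cX cA cC _ (not_le.1 hb').le ∅ (WA \ WA') (WC \ WC')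
        refine le_trans (le_trans (cnt_mono ?_) h)
          (final_arith2 n q _ hb hq (by rw [Finset.card_empty]; omega))
        rintro ⟨x, a, c⟩ ⟨⟨h1, h2⟩, h3⟩
        simp only [Finset.mem_compl, Finset.mem_sdiff] at h1 h2 ⊢
        exact prop_U _ _ _ _ _ _ h1 h2 h3
      · intro c hc
        rw [Finset.mem_compl, qC, mPC] at hc
        have h := cnt4 n _ cX cA cB _ (not_le.1 hc).le ∅ (WA \ WA') (WB \ WB')
        refine le_trans (le_trans (cnt_mono ?_) h)
          (final_arith2 n q _ hb hq (by rw [Finset.card_empty]; omega))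
        rintro ⟨x, a, b⟩ ⟨⟨h1, h2⟩, h3⟩
        simp only [Finset.mem_compl, Finset.mem_sdiff] at h1 h2 ⊢
        exact prop_U _ _ _ _ _ _ h1 h2 h3
  obtain ⟨TX, TA, TB, TC, hT, hTt, tA, tB, tC⟩ := tex
  obtain ⟨SX, SA, SB, SC, hS, hSt, hSk, iX, iA, iB, iC⟩ := cover_stage n q (n ^ 3 / 2000)
    (n - (WA'.card + WB'.card + WC'.card)) (Mrs r s) cX cA cB cC (by omega)
    WA WA' WB WB' WC WC' BX (WA' \ (WA \ BA)) (WB' \ (WB \ BB)) (WC' \ (WC \ BC))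
    (by omega) (by omega) (by omega) (by omega) (by omega) (by omega) (by omega) (by omega)
    (by omega) (arith51 n q hb hq) (Mrs_le1 n r s hn hs1 hs3 hb) dA
    (fun a ha => (mPA a).1 (pA (Finset.mem_sdiff.1 ha).1))
    (fun a ha => (mPB a).1 (pB (Finset.mem_sdiff.1 ha).1))
    (fun a ha => (mPC a).1 (pC (Finset.mem_sdiff.1 ha).1))
    TX TA TB TC hT hTt tA tB tC
  have rA := Finset.card_sdiff_add_card_inter WA' SA
  have rB := Finset.card_sdiff_add_card_inter WB' SB
  have rC := Finset.card_sdiff_add_card_inter WC' SC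
  rw [Finset.inter_comm] at rA rB rC
  obtain ⟨VA, VB, VC, -, vA, -, vB, -, vC, vsum⟩ := choose3 ∅ (WA' \ SA) ∅ (WB' \ SB) ∅ (WC' \ SC)
    (Finset.empty_subset _) (Finset.empty_subset _) (Finset.empty_subset _) (n - SX.card)
    (by simp only [Finset.card_empty]; omega) (by omega)
  have kA : ∀ a ∈ VA, a ∈ WA \ BA := fun a ha => by
    obtain ⟨h1, h2⟩ := Finset.mem_sdiff.1 (vA ha)
    by_contra h
    exact h2 (iA (Finset.mem_sdiff.2 ⟨h1, h⟩))
  have kB : ∀ a ∈ VB, a ∈ WB \ BB := fun a ha => by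
    obtain ⟨h1, h2⟩ := Finset.mem_sdiff.1 (vB ha)
    by_contra h
    exact h2 (iB (Finset.mem_sdiff.2 ⟨h1, h⟩))
  have kC : ∀ a ∈ VC, a ∈ WC \ BC := fun a ha => by
    obtain ⟨h1, h2⟩ := Finset.mem_sdiff.1 (vC ha)
    by_contra h
    exact h2 (iC (Finset.mem_sdiff.2 ⟨h1, h⟩))
  refine final_stage n q (Mrs r s) cX cA cB cC hb hq WA VA WB VB WC VC SX SA SB SC hS hSk
    wA wB wC wsum
    (fun a ha => (Finset.mem_sdiff.1 (kA a ha)).1)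
    (fun a ha => (Finset.mem_sdiff.1 (kB a ha)).1)
    (fun a ha => (Finset.mem_sdiff.1 (kC a ha)).1)
    (fun a ha => Finset.mem_compl.2 (Finset.mem_sdiff.1 (vA ha)).2)
    (fun a ha => Finset.mem_compl.2 (Finset.mem_sdiff.1 (vB ha)).2)
    (fun a ha => Finset.mem_compl.2 (Finset.mem_sdiff.1 (vC ha)).2) vsum
    (Mrs_le2 n r s _ _ hn hs1 hs3 hb wB wC) (Mrs_le2 n r s _ _ hn hs1 hs3 hb wA wC)
    (Mrs_le2 n r s _ _ hn hs1 hs3 hb wA wB) dA dB dC ?_ ?_ ?_ ?_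
  · intro x hx
    exact not_lt.1 (fun h => hx (iX ((mBX x).2 h)))
  · intro a ha
    by_cases hB : a ∈ BA
    · refine Or.inr ⟨fun h => (Finset.mem_sdiff.1 (kA a h)).2 hB, fun h => ha (iA ?_)⟩
      exact Finset.mem_sdiff.2 ⟨fA (Finset.mem_inter.2 ⟨hB, (mPA a).2 h⟩),
        fun h => (Finset.mem_sdiff.1 h).2 hB⟩
    · exact Or.inl (not_lt.1 (fun h => hB ((mBA a).2 h)))
  · intro a ha
    by_cases hB : a ∈ BB
    · refine Or.inr ⟨fun h => (Finset.mem_sdiff.1 (kB a h)).2 hB, fun h => ha (iB ?_)⟩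
      exact Finset.mem_sdiff.2 ⟨fB (Finset.mem_inter.2 ⟨hB, (mPB a).2 h⟩),
        fun h => (Finset.mem_sdiff.1 h).2 hB⟩
    · exact Or.inl (not_lt.1 (fun h => hB ((mBB a).2 h)))
  · intro a ha
    by_cases hB : a ∈ BC
    · refine Or.inr ⟨fun h => (Finset.mem_sdiff.1 (kC a h)).2 hB, fun h => ha (iC ?_)⟩
      exact Finset.mem_sdiff.2 ⟨fC (Finset.mem_inter.2 ⟨hB, (mPC a).2 h⟩),
        fun h => (Finset.mem_sdiff.1 h).2 hB⟩
    · exact Or.inl (not_lt.1 (fun h => hB ((mBC a).2 h)))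


lemma quad_inter {α : Type} [DecidableEq α] {V : Finset α} {x a b c : α}
    (hx : x ∈ V) (ha : a ∉ V) (hb : b ∉ V) (hc : c ∉ V) :
    ({x, a, b, c} : Finset α) ∩ V = {x} := by
  ext v; simp only [Finset.mem_inter, Finset.mem_insert, Finset.mem_singleton]
  grind

lemma quad_p2 {α : Type} [DecidableEq α] (x a b c : α) :
    ({x, a, b, c} : Finset α) = {a, x, b, c} := Finset.insert_comm _ _ _

lemma quad_p3 {α : Type} [DecidableEq α] (x a b c : α) :
    ({x, a, b, c} : Finset α) = {b, x, a, c} := by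
  rw [Finset.insert_comm a b, Finset.insert_comm x b]

lemma quad_p4 {α : Type} [DecidableEq α] (x a b c : α) :
    ({x, a, b, c} : Finset α) = {c, x, a, b} := by
  rw [Finset.pair_comm b c, quad_p3]

lemma eq_of_inter_one {α : Type} [DecidableEq α] {e V : Finset α} (h : (e ∩ V).card = 1)
    {x y : α} (hx : x ∈ e) (hxV : x ∈ V) (hy : y ∈ e) (hyV : y ∈ V) : y = x := by
  obtain ⟨z, hz⟩ := Finset.card_eq_one.1 h
  have h1 : x ∈ e ∩ V := Finset.mem_inter.2 ⟨hx, hxV⟩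
  have h2 : y ∈ e ∩ V := Finset.mem_inter.2 ⟨hy, hyV⟩
  rw [hz, Finset.mem_singleton] at h1 h2
  rw [h1, h2]

lemma ex_of_inter_one {α : Type} [DecidableEq α] {e V : Finset α} (h : (e ∩ V).card = 1) :
    ∃ x, x ∈ e ∧ x ∈ V := by
  obtain ⟨z, hz⟩ := Finset.card_eq_one.1 h
  have : z ∈ e ∩ V := by rw [hz]; simp
  exact ⟨z, Finset.mem_inter.1 this⟩

lemma edge_eq {α : Type} [DecidableEq α] {V1 V2 V3 V4 e : Finset α}
    (h : e ⊆ V1 ∪ V2 ∪ V3 ∪ V4 ∧ (e ∩ V1).card = 1 ∧ (e ∩ V2).card = 1 ∧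
    (e ∩ V3).card = 1 ∧ (e ∩ V4).card = 1) {x a b c : α}
    (hx : x ∈ e) (hx1 : x ∈ V1) (ha : a ∈ e) (ha2 : a ∈ V2) (hb : b ∈ e) (hb3 : b ∈ V3)
    (hc : c ∈ e) (hc4 : c ∈ V4) : e = {x, a, b, c} := by
  obtain ⟨h0, h1, h2, h3, h4⟩ := h
  ext v
  simp only [Finset.mem_insert, Finset.mem_singleton]
  constructor
  · intro hv
    have := h0 hv
    simp only [Finset.mem_union] at this
    rcases this with ((h | h) | h) | h
    · exact Or.inl (eq_of_inter_one h1 hx hx1 hv h)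
    · exact Or.inr (Or.inl (eq_of_inter_one h2 ha ha2 hv h))
    · exact Or.inr (Or.inr (Or.inl (eq_of_inter_one h3 hb hb3 hv h)))
    · exact Or.inr (Or.inr (Or.inr (eq_of_inter_one h4 hc hc4 hv h)))
  · rintro (rfl | rfl | rfl | rfl) <;> assumption

lemma delta_Mrs (n r s : ℕ) (hn : n = 3 * r + s) (h1 : 1 ≤ s) (h3 : s ≤ 3) :
    deltaLM n r s = n ^ 2 - Mrs r s := by
  unfold deltaLM Mrs
  have : s = 1 ∨ s = 2 ∨ s = 3 := by omega
  rcases this with rfl | rfl | rfl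
  · simp only [if_true]; congr 2; omega
  · simp only [if_true, show ¬ (2 = 1) by omega, if_false]
    congr 2 <;> omega
  · simp only [show ¬ (3 = 1) by omega, show ¬ (3 = 2) by omega, if_false]
    congr 2 <;> omega

lemma deg_conv {α B C : Type} [DecidableEq α] [Fintype B] [Fintype C] (E : Finset (Finset α))
    (n r s : ℕ) (hn : n = 3 * r + s) (h1 : 1 ≤ s) (h3 : s ≤ 3)
    (cB : Fintype.card B = n) (cC : Fintype.card C = n) (x y : α) (Q : B → C → Finset α)
    (hQ : ∀ e ∈ E, x ∈ e → y ∈ e → ∃ b c, e = Q b c) (hd : deltaLM n r s < hdeg2 E x y) :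
    cnt (fun p : B × C => ¬ Q p.1 p.2 ∈ E) < Mrs r s := by
  rw [delta_Mrs n r s hn h1 h3] at hd
  have h := cnt_add_not (fun p : B × C => Q p.1 p.2 ∈ E)
  rw [Fintype.card_prod, cB, cC, ← pow_two] at h
  have h2 : hdeg2 E x y ≤ cnt (fun p : B × C => Q p.1 p.2 ∈ E) := by
    unfold hdeg2
    rw [← card_fs]
    refine le_trans (Finset.card_le_card ?_) (Finset.card_image_le (f := fun p : B × C => Q p.1 p.2))
    intro e he
    obtain ⟨he, hx, hy⟩ := Finset.mem_filter.1 he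
    obtain ⟨b, c, rfl⟩ := hQ e he hx hy
    exact Finset.mem_image.2 ⟨(b, c), (mem_fs _ _).2 he, rfl⟩
  omega

lemma ex_ins {T : Type} {_ : DecidableEq T} (S : Finset T) (x : T) (p : T → Prop) :
    (∃ y ∈ insert x S, p y) ↔ (p x ∨ ∃ y ∈ S, p y) := by
  simp only [Finset.mem_insert]
  constructor
  · rintro ⟨y, rfl | h, hp⟩
    · exact Or.inl hp
    · exact Or.inr ⟨y, h, hp⟩
  · rintro (h | ⟨y, h, hp⟩)
    · exact ⟨x, Or.inl rfl, h⟩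
    · exact ⟨y, Or.inr h, hp⟩

lemma or_shuffle (x a b c p q r s : Prop) :
    ((x ∨ a ∨ b ∨ c) ∨ (p ∨ q ∨ r ∨ s)) ↔ ((x ∨ p) ∨ (a ∨ q) ∨ (b ∨ r) ∨ (c ∨ s)) := by
  constructor
  · rintro ((h | h | h | h) | (h | h | h | h)) <;> simp [h]
  · rintro ((h | h) | (h | h) | (h | h) | (h | h)) <;> simp [h]

lemma PM_conv {α : Type} [DecidableEq α] (V1 V2 V3 V4 : Finset α)
    (h12 : ∀ v ∈ V1, v ∉ V2) (h13 : ∀ v ∈ V1, v ∉ V3) (h14 : ∀ v ∈ V1, v ∉ V4)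
    (h23 : ∀ v ∈ V2, v ∉ V3) (h24 : ∀ v ∈ V2, v ∉ V4) (h34 : ∀ v ∈ V3, v ∉ V4)
    (E : Finset (Finset α)) (SX : Finset V1) (SA : Finset V2) (SB : Finset V3) (SC : Finset V4)
    (h : PM (fun (x : V1) (a : V2) (b : V3) (c : V4) => ({x.1, a.1, b.1, c.1} : Finset α) ∈ E)
      SX SA SB SC) :
    ∃ M : Finset (Finset α), M ⊆ E ∧ (∀ e ∈ M, ∀ f ∈ M, e ≠ f → Disjoint e f) ∧
      ∀ v, (∃ e ∈ M, v ∈ e) ↔ ((∃ x ∈ SX, x.1 = v) ∨ (∃ x ∈ SA, x.1 = v) ∨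
        (∃ x ∈ SB, x.1 = v) ∨ (∃ x ∈ SC, x.1 = v)) := by
  induction h with
  | nil => exact ⟨∅, by simp, by simp, by simp⟩
  | @cons SX SA SB SC x a b c hR hx ha hb hc _ ih =>
    obtain ⟨M, hME, hMd, hMc⟩ := ih
    have hdis : ∀ e ∈ M, Disjoint e ({x.1, a.1, b.1, c.1} : Finset α) := by
      intro e he
      rw [Finset.disjoint_left]
      intro v hv hv'
      have hcv := (hMc v).1 ⟨e, he, hv⟩
      simp only [Finset.mem_insert, Finset.mem_singleton] at hv'
      have X1 := x.2
      have X2 := a.2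
      have X3 := b.2
      have X4 := c.2
      rcases hcv with ⟨y, hy, hyv⟩ | ⟨y, hy, hyv⟩ | ⟨y, hy, hyv⟩ | ⟨y, hy, hyv⟩ <;>
        have Y := y.2 <;> rw [hyv] at Y <;>
        rcases hv' with hv' | hv' | hv' | hv' <;>
        first
        | exact hx (by rwa [← Subtype.ext (hyv.trans hv')])
        | exact ha (by rwa [← Subtype.ext (hyv.trans hv')])
        | exact hb (by rwa [← Subtype.ext (hyv.trans hv')])
        | exact hc (by rwa [← Subtype.ext (hyv.trans hv')])
        | (rw [hv'] at Y
           first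
           | exact h12 _ X1 Y | exact h12 _ Y X2 | exact h13 _ X1 Y | exact h13 _ Y X3
           | exact h14 _ X1 Y | exact h14 _ Y X4 | exact h23 _ X2 Y | exact h23 _ Y X3
           | exact h24 _ X2 Y | exact h24 _ Y X4 | exact h34 _ X3 Y | exact h34 _ Y X4)
    refine ⟨insert {x.1, a.1, b.1, c.1} M, ?_, ?_, ?_⟩
    · exact Finset.insert_subset hR hME
    · intro e he f hf hef
      rcases Finset.mem_insert.1 he with rfl | he <;> rcases Finset.mem_insert.1 hf with rfl | hf
      · exact absurd rfl hef
      · exact (hdis f hf).symm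
      · exact hdis e he
      · exact hMd e he f hf hef
    · intro v
      rw [ex_ins, ex_ins, ex_ins, ex_ins, ex_ins, hMc v]
      simp only [Finset.mem_insert, Finset.mem_singleton]
      rw [@eq_comm α v x.1, @eq_comm α v a.1, @eq_comm α v b.1, @eq_comm α v c.1]
      exact or_shuffle _ _ _ _ _ _ _ _

set_option maxHeartbeats 2000000 in
lemma conv_main {α : Type} [DecidableEq α] (n r s : ℕ) (hn : n = 3 * r + s) (hs1 : 1 ≤ s)
    (hs3 : s ≤ 3) (hb : 100000000 ≤ n) (V1 V2 V3 V4 : Finset α)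
    (h12 : ∀ v ∈ V1, v ∉ V2) (h13 : ∀ v ∈ V1, v ∉ V3) (h14 : ∀ v ∈ V1, v ∉ V4)
    (h23 : ∀ v ∈ V2, v ∉ V3) (h24 : ∀ v ∈ V2, v ∉ V4) (h34 : ∀ v ∈ V3, v ∉ V4)
    (c1 : V1.card = n) (c2 : V2.card = n) (c3 : V3.card = n) (c4 : V4.card = n)
    (E : Finset (Finset α)) (hE : IsPartite4 V1 V2 V3 V4 E)
    (W2 W3 W4 : Finset α) (hW : IsWChoice n V2 V3 V4 W2 W3 W4)
    (hM : 4000000000 * ((H13edges V1 V2 V3 V4 W2 W3 W4) \ E).card ≤ n ^ 4)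
    (hd : ∀ x ∈ V1, ∀ y ∈ V2 ∪ V3 ∪ V4, deltaLM n r s < hdeg2 E x y) :
    ∃ M : Finset (Finset α), M ⊆ E ∧ (∀ e ∈ M, ∀ f ∈ M, e ≠ f → Disjoint e f) ∧
          (∀ v ∈ V1 ∪ V2 ∪ V3 ∪ V4, ∃ e ∈ M, v ∈ e) := by
  obtain ⟨s2, s3, s4, w2, w3, w4, wsum⟩ := hW
  have cX : Fintype.card V1 = n := by rw [Fintype.card_coe, c1]
  have cA : Fintype.card V2 = n := by rw [Fintype.card_coe, c2]
  have cB : Fintype.card V3 = n := by rw [Fintype.card_coe, c3]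
  have cC : Fintype.card V4 = n := by rw [Fintype.card_coe, c4]
  have csub : ∀ V W : Finset α, W ⊆ V → (fs (fun a : V => a.1 ∈ W)).card = W.card := by
    intro V W h
    rw [← Finset.card_map (Function.Embedding.subtype (· ∈ V))]
    congr 1
    ext v
    simp only [Finset.mem_map, mem_fs, Function.Embedding.subtype_apply]
    exact ⟨fun ⟨a, h1, h2⟩ => h2 ▸ h1, fun hv => ⟨⟨v, h hv⟩, hv, rfl⟩⟩
  have e2 := csub V2 W2 s2
  have e3 := csub V3 W3 s3
  have e4 := csub V4 W4 s4
  have hpm : PM (fun (x : V1) (a : V2) (b : V3) (c : V4) =>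
      ({x.1, a.1, b.1, c.1} : Finset α) ∈ E) univ univ univ univ := by
    refine typed_main n r s hn hs1 hs3 hb cX cA cB cC (fs (fun a : V2 => a.1 ∈ W2))
      (fs (fun a : V3 => a.1 ∈ W3)) (fs (fun a : V4 => a.1 ∈ W4)) (by omega) (by omega)
      (by omega) (by omega) (le_trans (Nat.mul_le_mul_left _ ?_) hM) ?_ ?_ ?_
    · rw [← card_fs]
      refine Finset.card_le_card_of_injOn
        (fun p : V1 × V2 × V3 × V4 => ({p.1.1, p.2.1.1, p.2.2.1.1, p.2.2.2.1} : Finset α)) ?_ ?_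
      · rintro ⟨⟨x, hx⟩, ⟨a, ha⟩, ⟨b, hb'⟩, ⟨c, hc⟩⟩ hp
        have hp := (mem_fs _ _).1 hp
        simp only [Miss, mem_fs] at hp
        obtain ⟨hp1, hp2, hp3⟩ := hp
        refine Finset.mem_coe.2 (Finset.mem_sdiff.2 ⟨?_, hp1⟩)
        unfold H13edges
        have q1 : ({x, a, b, c} : Finset α) ∩ V1 = {x} := quad_inter hx
          (fun h => h12 _ h ha) (fun h => h13 _ h hb') (fun h => h14 _ h hc)
        have q2 : ({x, a, b, c} : Finset α) ∩ V2 = {a} := by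
          rw [show ({x, a, b, c} : Finset α) = {a, x, b, c} from quad_p2 x a b c]
          exact quad_inter ha (h12 _ hx) (fun h => h23 _ h hb') (fun h => h24 _ h hc)
        have q3 : ({x, a, b, c} : Finset α) ∩ V3 = {b} := by
          rw [show ({x, a, b, c} : Finset α) = {b, x, a, c} from quad_p3 x a b c]
          exact quad_inter hb' (h13 _ hx) (h23 _ ha) (fun h => h34 _ h hc)
        have q4 : ({x, a, b, c} : Finset α) ∩ V4 = {c} := by
          rw [show ({x, a, b, c} : Finset α) = {c, x, a, b} from quad_p4 x a b c]
          exact quad_inter hc (h14 _ hx) (h24 _ ha) (h34 _ hb')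
        refine Finset.mem_filter.2 ⟨?_, by rw [q1]; rfl, by rw [q2]; rfl, by rw [q3]; rfl,
          by rw [q4]; rfl, ?_, ?_⟩
        · rw [Finset.mem_powerset]
          intro v
          simp only [Finset.mem_insert, Finset.mem_singleton, Finset.mem_union]
          rintro (rfl | rfl | rfl | rfl)
          · exact Or.inl (Or.inl (Or.inl hx))
          · exact Or.inl (Or.inl (Or.inr ha))
          · exact Or.inl (Or.inr hb')
          · exact Or.inr hc
        · rcases hp2 with h | h | h
          · exact ⟨a, by simp [h]⟩
          · exact ⟨b, by simp [h]⟩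
          · exact ⟨c, by simp [h]⟩
        · rcases hp3 with h | h | h
          · exact ⟨a, by simp [h, ha]⟩
          · exact ⟨b, by simp [h, hb']⟩
          · exact ⟨c, by simp [h, hc]⟩
      · rintro ⟨⟨x, hx⟩, ⟨a, ha⟩, ⟨b, hb'⟩, ⟨c, hc⟩⟩ - ⟨⟨x', hx'⟩, ⟨a', ha'⟩, ⟨b', hb''⟩, ⟨c', hc'⟩⟩ - h
        simp only at h
        have g1 : x ∈ ({x', a', b', c'} : Finset α) := by rw [← h]; simp
        have g2 : a ∈ ({x', a', b', c'} : Finset α) := by rw [← h]; simp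
        have g3 : b ∈ ({x', a', b', c'} : Finset α) := by rw [← h]; simp
        have g4 : c ∈ ({x', a', b', c'} : Finset α) := by rw [← h]; simp
        simp only [Finset.mem_insert, Finset.mem_singleton] at g1 g2 g3 g4
        have : x = x' := by
          rcases g1 with rfl | rfl | rfl | rfl
          · rfl
          · exact absurd ha' (h12 _ hx)
          · exact absurd hb'' (h13 _ hx)
          · exact absurd hc' (h14 _ hx)
        have : a = a' := by
          rcases g2 with rfl | rfl | rfl | rfl
          · exact absurd ha (h12 _ hx')
          · rfl
          · exact absurd hb'' (h23 _ ha)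
          · exact absurd hc' (h24 _ ha)
        have : b = b' := by
          rcases g3 with rfl | rfl | rfl | rfl
          · exact absurd hb' (h13 _ hx')
          · exact absurd hb' (h23 _ ha')
          · rfl
          · exact absurd hc' (h34 _ hb')
        have : c = c' := by
          rcases g4 with rfl | rfl | rfl | rfl
          · exact absurd hc (h14 _ hx')
          · exact absurd hc (h24 _ ha')
          · exact absurd hc (h34 _ hb'')
          · rfl
        subst_vars
        rfl
    · intro x a
      refine deg_conv E n r s hn hs1 hs3 cB cC x.1 a.1 (fun b c => {x.1, a.1, b.1, c.1}) ?_
        (hd x.1 x.2 a.1 (by simp [a.2]))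
      intro e he hx ha
      have h := hE e he
      obtain ⟨b, hb1, hb2⟩ := ex_of_inter_one h.2.2.2.1
      obtain ⟨c, hc1, hc2⟩ := ex_of_inter_one h.2.2.2.2
      exact ⟨⟨b, hb2⟩, ⟨c, hc2⟩, edge_eq h hx x.2 ha a.2 hb1 hb2 hc1 hc2⟩
    · intro x b
      refine deg_conv E n r s hn hs1 hs3 cA cC x.1 b.1 (fun a c => {x.1, a.1, b.1, c.1}) ?_
        (hd x.1 x.2 b.1 (by simp [b.2]))
      intro e he hx hb1
      have h := hE e he
      obtain ⟨a, ha1, ha2⟩ := ex_of_inter_one h.2.2.1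
      obtain ⟨c, hc1, hc2⟩ := ex_of_inter_one h.2.2.2.2
      exact ⟨⟨a, ha2⟩, ⟨c, hc2⟩, edge_eq h hx x.2 ha1 ha2 hb1 b.2 hc1 hc2⟩
    · intro x c
      refine deg_conv E n r s hn hs1 hs3 cA cB x.1 c.1 (fun a b => {x.1, a.1, b.1, c.1}) ?_
        (hd x.1 x.2 c.1 (by simp [c.2]))
      intro e he hx hc1
      have h := hE e he
      obtain ⟨a, ha1, ha2⟩ := ex_of_inter_one h.2.2.1
      obtain ⟨b, hb1, hb2⟩ := ex_of_inter_one h.2.2.2.1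
      exact ⟨⟨a, ha2⟩, ⟨b, hb2⟩, edge_eq h hx x.2 ha1 ha2 hb1 hb2 hc1 c.2⟩
  obtain ⟨M, m1, m2, m3⟩ := PM_conv V1 V2 V3 V4 h12 h13 h14 h23 h24 h34 E _ _ _ _ hpm
  refine ⟨M, m1, m2, fun v hv => (m3 v).2 ?_⟩
  simp only [Finset.mem_union] at hv
  rcases hv with ((h | h) | h) | h
  · exact Or.inl ⟨⟨v, h⟩, Finset.mem_univ _, rfl⟩
  · exact Or.inr (Or.inl ⟨⟨v, h⟩, Finset.mem_univ _, rfl⟩)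
  · exact Or.inr (Or.inr (Or.inl ⟨⟨v, h⟩, Finset.mem_univ _, rfl⟩))
  · exact Or.inr (Or.inr (Or.inr ⟨⟨v, h⟩, Finset.mem_univ _, rfl⟩))

end CloseExtremal

/-- For every sufficiently small `ε > 0` there is `n0` such that for all
`n ≥ n0` with `n = 3r + s`, `1 ≤ s ≤ 3`: if `H` is a 4-partite 4-graph with
classes of size `n` which is `ε`-close to `H'₁,₃(n)` and satisfies
`d_H({x,y}) > δ(n,r,s)` for all `x ∈ V1`, `y ∈ V2 ∪ V3 ∪ V4`, then `H` has a
perfect matching. -/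
theorem close_extremal_perfect_matching :
    ∃ ε0 : ℝ, 0 < ε0 ∧ ∀ ε : ℝ, 0 < ε → ε < ε0 →
    ∃ n0 : ℕ, ∀ n : ℕ, n0 ≤ n → ∀ r s : ℕ, n = 3 * r + s → 1 ≤ s → s ≤ 3 →
    ∀ (α : Type) [DecidableEq α], ∀ V1 V2 V3 V4 : Finset α,
      Disjoint V1 V2 → Disjoint V1 V3 → Disjoint V1 V4 →
      Disjoint V2 V3 → Disjoint V2 V4 → Disjoint V3 V4 →
      V1.card = n → V2.card = n → V3.card = n → V4.card = n →
      ∀ E : Finset (Finset α),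
        IsPartite4 V1 V2 V3 V4 E →
        CloseToH13 ε n V1 V2 V3 V4 E →
        (∀ x ∈ V1, ∀ y ∈ V2 ∪ V3 ∪ V4, deltaLM n r s < hdeg2 E x y) →
        ∃ M : Finset (Finset α),
          M ⊆ E ∧
          (∀ e ∈ M, ∀ f ∈ M, e ≠ f → Disjoint e f) ∧
          (∀ v ∈ V1 ∪ V2 ∪ V3 ∪ V4, ∃ e ∈ M, v ∈ e) := by
  refine ⟨1 / 4000000000, by norm_num, fun ε _ hε1 => ⟨100000000, ?_⟩⟩
  intro n hn r s hrs hs1 hs3 α _ V1 V2 V3 V4 d12 d13 d14 d23 d24 d34 c1 c2 c3 c4 E hE hC hd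
  obtain ⟨W2, W3, W4, hW, hcard⟩ := hC
  refine conv_main n r s hrs hs1 hs3 hn V1 V2 V3 V4
    (fun v h => Finset.disjoint_left.1 d12 h) (fun v h => Finset.disjoint_left.1 d13 h)
    (fun v h => Finset.disjoint_left.1 d14 h) (fun v h => Finset.disjoint_left.1 d23 h)
    (fun v h => Finset.disjoint_left.1 d24 h) (fun v h => Finset.disjoint_left.1 d34 h)
    c1 c2 c3 c4 E hE W2 W3 W4 hW ?_ hd
  have h1 : ε * (n : ℝ) ^ 4 ≤ 1 / 4000000000 * (n : ℝ) ^ 4 :=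
    mul_le_mul_of_nonneg_right hε1.le (by positivity)
  have h2 := hcard.trans h1
  have h3 : (4000000000 : ℝ) * (((H13edges V1 V2 V3 V4 W2 W3 W4) \ E).card : ℝ) ≤ (n : ℝ) ^ 4 := by
    linarith
  exact_mod_cast h3
end
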